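/- Let m ∈ {1,2} and let n ∈ ℕ with 3 ∤ n. Then H_{2,m,3}(n) = −δ_{n=□}·n^{3/2}/2 − δ_{n≡1 (mod 3)}·∑_{d∣n, d²<n} d³ + ( (3/4)·n·σ(n) − (n/2)·∑_{d∣n} min(d, n/d) + (1/4)·a(n) if n ≡ 1 (mod 3); (1/2)·n·σ(n) if n ≡ 2 (mod 3) ). -/

import Mathlib

open scoped BigOperators

namespace HurwitzPaper

/-- Evaluation of the binary quadratic form `(a,b,c)` (i.e. `a x² + b x y + c y²`). -/
def formEval (Q : ℤ × ℤ × ℤ) (x y : ℤ) : ℤ :=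
  Q.1 * x ^ 2 + Q.2.1 * x * y + Q.2.2 * y ^ 2

/-- Discriminant `b² - 4ac` of the form `(a,b,c)`. -/
def formDisc (Q : ℤ × ℤ × ℤ) : ℤ := Q.2.1 ^ 2 - 4 * Q.1 * Q.2.2

/-- Right action of `γ ∈ SL₂(ℤ)` on a binary quadratic form: `(Q∘γ)(x,y) = Q(ax+by, cx+dy)`. -/
def formAct (γ : Matrix.SpecialLinearGroup (Fin 2) ℤ) (Q : ℤ × ℤ × ℤ) : ℤ × ℤ × ℤ :=
  (formEval Q (γ.1 0 0) (γ.1 1 0),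
   formEval Q (γ.1 0 0 + γ.1 0 1) (γ.1 1 0 + γ.1 1 1)
     - formEval Q (γ.1 0 0) (γ.1 1 0) - formEval Q (γ.1 0 1) (γ.1 1 1),
   formEval Q (γ.1 0 1) (γ.1 1 1))

/-- A form is positive definite iff its leading coefficient is positive and its
discriminant is negative. -/
def IsPosDef (Q : ℤ × ℤ × ℤ) : Prop := 0 < Q.1 ∧ formDisc Q < 0

/-- `SL₂(ℤ)`-equivalence classes of positive definite integral binary quadratic forms
of discriminant `-N`. -/
abbrev FormClasses (N : ℤ) :=
  Quot (fun (Q Q' : {Q : ℤ × ℤ × ℤ // formDisc Q = -N ∧ IsPosDef Q}) =>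
    ∃ γ : Matrix.SpecialLinearGroup (Fin 2) ℤ, formAct γ Q.1 = Q'.1)

/-- The Hurwitz class number `H(N)`: each class of positive definite forms of
discriminant `-N` is counted with weight `1/ω_Q = 2/#Γ_Q`, where `Γ_Q` is the stabilizer
of (a representative of) the class in `SL₂(ℤ)`; `H(0) = -1/12`, and `H(N) = 0` when no
such forms exist (in particular for `N < 0` and `N ≡ 1, 2 (mod 4)`). -/
noncomputable def hurwitzClassNumber (N : ℤ) : ℝ :=
  if N = 0 then -(1 / 12)
  else ∑ᶠ c : FormClasses N,
    (2 : ℝ) / (Nat.card {γ : Matrix.SpecialLinearGroup (Fin 2) ℤ //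
      formAct γ c.out.1 = c.out.1})

/-- `H_{κ,m,M}(n) = ∑_{t ≡ m (mod M)} t^κ H(4n - t²)`. -/
noncomputable def HH (κ : ℕ) (m : ℤ) (M : ℕ) (n : ℕ) : ℝ :=
  ∑ᶠ t : ℤ, if t % (M : ℤ) = m % (M : ℤ) then
    (t : ℝ) ^ κ * hurwitzClassNumber (4 * n - t ^ 2) else 0

/-- `a(n)`: the `n`-th Fourier coefficient of `η(3τ)⁸ = q ∏_{k≥1} (1-q^{3k})⁸`
(the factors with `k > n` do not affect the coefficient of `q^n`). -/
noncomputable def etaCoeff (n : ℕ) : ℤ :=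
  Polynomial.coeff (Polynomial.X * ∏ k ∈ Finset.Icc 1 n, (1 - Polynomial.X ^ (3 * k)) ^ 8 : Polynomial ℤ) n

section
/-- positive quadruples with `a d + B c = n`. -/
noncomputable def quads (n : ℤ) : Finset (ℤ × ℤ × ℤ × ℤ) :=
  (Finset.Icc 1 n ×ˢ Finset.Icc 1 n ×ˢ Finset.Icc 1 n ×ˢ Finset.Icc 1 n).filter
    (fun p => p.1 * p.2.2.2 + p.2.1 * p.2.2.1 = n)

lemma mem_quads {n a B c d : ℤ} :
    (a, B, c, d) ∈ quads n ↔ 0 < a ∧ 0 < B ∧ 0 < c ∧ 0 < d ∧ a * d + B * c = n := by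
  simp only [quads, Finset.mem_filter, Finset.mem_product, Finset.mem_Icc]
  constructor
  · rintro ⟨⟨⟨h1, _⟩, ⟨h2, _⟩, ⟨h3, _⟩, ⟨h4, _⟩⟩, h⟩
    exact ⟨h1, h2, h3, h4, h⟩
  · rintro ⟨h1, h2, h3, h4, h⟩
    refine ⟨⟨⟨h1, ?_⟩, ⟨h2, ?_⟩, ⟨h3, ?_⟩, ⟨h4, ?_⟩⟩, h⟩ <;> nlinarith [mul_pos h1 h4, mul_pos h2 h3]

/-- Sum over quadruples. -/
noncomputable def QS {R : Type*} [AddCommMonoid R] (n : ℤ) (F : ℤ → ℤ → ℤ → ℤ → R) : R :=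
  ∑ p ∈ quads n, F p.1 p.2.1 p.2.2.1 p.2.2.2

section
variable {R : Type*} [AddCommMonoid R]

lemma QS_congr {n : ℤ} {F G : ℤ → ℤ → ℤ → ℤ → R}
    (h : ∀ a B c d, 0 < a → 0 < B → 0 < c → 0 < d → a * d + B * c = n → F a B c d = G a B c d) :
    QS n F = QS n G := by
  refine Finset.sum_congr rfl ?_
  rintro ⟨a, B, c, d⟩ hp
  obtain ⟨h1, h2, h3, h4, h5⟩ := mem_quads.1 hp
  exact h a B c d h1 h2 h3 h4 h5

open scoped Classical in
lemma QS_bij (n : ℤ) {P Q : ℤ → ℤ → ℤ → ℤ → Prop} {F G : ℤ → ℤ → ℤ → ℤ → R}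
    (i j : ℤ → ℤ → ℤ → ℤ → ℤ × ℤ × ℤ × ℤ)
    (hi : ∀ a B c d, 0 < a → 0 < B → 0 < c → 0 < d → P a B c d →
      (0 < (i a B c d).1 ∧ 0 < (i a B c d).2.1 ∧ 0 < (i a B c d).2.2.1 ∧ 0 < (i a B c d).2.2.2) ∧
      Q (i a B c d).1 (i a B c d).2.1 (i a B c d).2.2.1 (i a B c d).2.2.2)
    (hj : ∀ a B c d, 0 < a → 0 < B → 0 < c → 0 < d → Q a B c d →
      (0 < (j a B c d).1 ∧ 0 < (j a B c d).2.1 ∧ 0 < (j a B c d).2.2.1 ∧ 0 < (j a B c d).2.2.2) ∧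
      P (j a B c d).1 (j a B c d).2.1 (j a B c d).2.2.1 (j a B c d).2.2.2)
    (hij : ∀ a B c d, j (i a B c d).1 (i a B c d).2.1 (i a B c d).2.2.1 (i a B c d).2.2.2
      = (a, B, c, d))
    (hji : ∀ a B c d, i (j a B c d).1 (j a B c d).2.1 (j a B c d).2.2.1 (j a B c d).2.2.2
      = (a, B, c, d))
    (hn : ∀ a B c d, (i a B c d).1 * (i a B c d).2.2.2 + (i a B c d).2.1 * (i a B c d).2.2.1
      = a * d + B * c)
    (hF : ∀ a B c d, 0 < a → 0 < B → 0 < c → 0 < d → a * d + B * c = n → P a B c d →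
      F a B c d = G (i a B c d).1 (i a B c d).2.1 (i a B c d).2.2.1 (i a B c d).2.2.2) :
    QS n (fun a B c d => if P a B c d then F a B c d else 0)
      = QS n (fun a B c d => if Q a B c d then G a B c d else 0) := by
  unfold QS
  rw [← Finset.sum_filter, ← Finset.sum_filter]
  refine Finset.sum_nbij' (fun p => i p.1 p.2.1 p.2.2.1 p.2.2.2)
    (fun p => j p.1 p.2.1 p.2.2.1 p.2.2.2) ?_ ?_ ?_ ?_ ?_
  · rintro ⟨a, B, c, d⟩ hp
    obtain ⟨hp, hP⟩ := Finset.mem_filter.1 hp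
    obtain ⟨h1, h2, h3, h4, h5⟩ := mem_quads.1 hp
    obtain ⟨⟨k1, k2, k3, k4⟩, k5⟩ := hi a B c d h1 h2 h3 h4 hP
    exact Finset.mem_filter.2 ⟨mem_quads.2 ⟨k1, k2, k3, k4, (hn a B c d).trans h5⟩, k5⟩
  · rintro ⟨a, B, c, d⟩ hp
    obtain ⟨hp, hP⟩ := Finset.mem_filter.1 hp
    obtain ⟨h1, h2, h3, h4, h5⟩ := mem_quads.1 hp
    obtain ⟨⟨k1, k2, k3, k4⟩, k5⟩ := hj a B c d h1 h2 h3 h4 hP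
    have := hn (j a B c d).1 (j a B c d).2.1 (j a B c d).2.2.1 (j a B c d).2.2.2
    rw [hji] at this
    exact Finset.mem_filter.2 ⟨mem_quads.2 ⟨k1, k2, k3, k4, this.symm.trans h5⟩, k5⟩
  · rintro ⟨a, B, c, d⟩ _; exact hij a B c d
  · rintro ⟨a, B, c, d⟩ _; exact hji a B c d
  · rintro ⟨a, B, c, d⟩ hp
    obtain ⟨hp, hP⟩ := Finset.mem_filter.1 hp
    obtain ⟨h1, h2, h3, h4, h5⟩ := mem_quads.1 hp
    exact hF a B c d h1 h2 h3 h4 h5 hP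

lemma QS_sym1 (n : ℤ) (F : ℤ → ℤ → ℤ → ℤ → R) : QS n (fun a B c d => F d B c a) = QS n F := by
  have := QS_bij n (P := fun _ _ _ _ => True) (Q := fun _ _ _ _ => True)
    (F := fun a B c d => F d B c a) (G := F)
    (fun a B c d => (d, B, c, a)) (fun a B c d => (d, B, c, a))
    (by intros; simp; omega) (by intros; simp; omega) (by intros; rfl) (by intros; rfl)
    (by intros; dsimp only; ring) (by intros; rfl)
  simpa using this

lemma QS_sym2 (n : ℤ) (F : ℤ → ℤ → ℤ → ℤ → R) : QS n (fun a B c d => F a c B d) = QS n F := by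
  have := QS_bij n (P := fun _ _ _ _ => True) (Q := fun _ _ _ _ => True)
    (F := fun a B c d => F a c B d) (G := F)
    (fun a B c d => (a, c, B, d)) (fun a B c d => (a, c, B, d))
    (by intros; simp; omega) (by intros; simp; omega) (by intros; rfl) (by intros; rfl)
    (by intros; dsimp only; ring) (by intros; rfl)
  simpa using this

lemma QS_sym3 (n : ℤ) (F : ℤ → ℤ → ℤ → ℤ → R) : QS n (fun a B c d => F B a d c) = QS n F := by
  have := QS_bij n (P := fun _ _ _ _ => True) (Q := fun _ _ _ _ => True)
    (F := fun a B c d => F B a d c) (G := F)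
    (fun a B c d => (B, a, d, c)) (fun a B c d => (B, a, d, c))
    (by intros; simp; omega) (by intros; simp; omega) (by intros; rfl) (by intros; rfl)
    (by intros; dsimp only; ring) (by intros; rfl)
  simpa using this

lemma QS_add (n : ℤ) (F G : ℤ → ℤ → ℤ → ℤ → R) :
    QS n (fun a B c d => F a B c d + G a B c d) = QS n F + QS n G := Finset.sum_add_distrib

end

lemma QS_sub {R : Type*} [AddCommGroup R] (n : ℤ) (F G : ℤ → ℤ → ℤ → ℤ → R) :
    QS n (fun a B c d => F a B c d - G a B c d) = QS n F - QS n G := Finset.sum_sub_distrib ..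

lemma QS_neg {R : Type*} [AddCommGroup R] (n : ℤ) (F : ℤ → ℤ → ℤ → ℤ → R) :
    QS n (fun a B c d => - F a B c d) = - QS n F := Finset.sum_neg_distrib ..

lemma QS_mul {R : Type*} [CommRing R] (n : ℤ) (k : R) (F : ℤ → ℤ → ℤ → ℤ → R) :
    QS n (fun a B c d => k * F a B c d) = k * QS n F := (Finset.mul_sum ..).symm

/-- sum over the face `a = c`: `n = a * (B + d)`. -/
noncomputable def FS {R : Type*} [AddCommMonoid R] (n : ℤ) (F : ℤ → ℤ → ℤ → R) : R :=
  QS n (fun a B c d => if a = c then F a B d else 0)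

/-- The engine. -/
theorem engine (n : ℤ) (f φ : ℤ → ℤ → ℤ → ℤ → ℤ)
    (h1 : ∀ a B c d : ℤ, a * d + B * c = n →
      φ (B + d) (a - c) d c - φ a B c d = φ (d + B) (c - a) B a - φ c d a B)
    (h2 : ∀ a B c d : ℤ, a * d + B * c = n →
      f a B c d + f d B c a + f a c B d + f d c B a + f B a d c + f c a d B + f B d a c + f c d a B
      + (φ (B + d) (a - c) d c - φ a B c d) + (φ (B + a) (d - c) a c - φ d B c a)
      + (φ (c + d) (a - B) d B - φ a c B d) + (φ (c + a) (d - B) a B - φ d c B a) = 0) :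
    2 * QS n f = FS n (fun a B d => φ a B a d - φ (B + d) 0 d a) := by
  set J : ℤ → ℤ → ℤ → ℤ → ℤ := fun a B c d => φ (B + d) (a - c) d c - φ a B c d with hJ
  have e1 : QS n (fun a B c d => if c < a then φ (B + d) (a - c) d c else 0)
      = QS n (fun a B c d => if c < a then φ a B c d else 0) := by
    have := QS_bij n (P := fun a B c d => c < a) (Q := fun a B c d => c < a)
      (F := fun a B c d => φ (B + d) (a - c) d c) (G := φ)
      (fun a B c d => (B + d, a - c, d, c)) (fun a B c d => (B + d, a - c, d, c))
      (by intros; dsimp only; omega) (by intros; dsimp only; omega)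
      (by intros; dsimp only; ext <;> simp) (by intros; dsimp only; ext <;> simp)
      (by intros; dsimp only; ring) (by intros; rfl)
    convert this
  have e2 : QS n (fun a B c d => if c < a then J a B c d else 0) = 0 := by
    rw [← sub_eq_zero, ← QS_sub] at e1
    refine (QS_congr ?_).trans e1
    intros; simp only [hJ]; split_ifs <;> ring
  have s1 : ∀ F : ℤ → ℤ → ℤ → ℤ → ℤ, QS n (fun a B c d => F d B c a) = QS n F := QS_sym1 n
  have s2 : ∀ F : ℤ → ℤ → ℤ → ℤ → ℤ, QS n (fun a B c d => F a c B d) = QS n F := QS_sym2 n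
  have s3 : ∀ F : ℤ → ℤ → ℤ → ℤ → ℤ, QS n (fun a B c d => F B a d c) = QS n F := QS_sym3 n
  have s4 : ∀ F : ℤ → ℤ → ℤ → ℤ → ℤ, QS n (fun a B c d => F d c B a) = QS n F := fun F => by
    rw [← s1 F, ← s2 (fun a B c d => F d B c a)]
  have s5 : ∀ F : ℤ → ℤ → ℤ → ℤ → ℤ, QS n (fun a B c d => F c a d B) = QS n F := fun F => by
    rw [← s1 F, ← s3 (fun a B c d => F d B c a)]
  have s6 : ∀ F : ℤ → ℤ → ℤ → ℤ → ℤ, QS n (fun a B c d => F B d a c) = QS n F := fun F => by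
    rw [← s2 F, ← s3 (fun a B c d => F a c B d)]
  have s7 : ∀ F : ℤ → ℤ → ℤ → ℤ → ℤ, QS n (fun a B c d => F c d a B) = QS n F := fun F => by
    rw [← s4 F, ← s3 (fun a B c d => F d c B a)]
  have e3 : QS n (fun a B c d => if a < c then J a B c d else 0) = 0 := by
    refine (Eq.trans (QS_congr ?_) (s7 (fun a B c d => if c < a then J a B c d else 0))).trans e2
    intro a B c d _ _ _ _ h
    by_cases hh : a < c
    · simp only [hh, if_true, hJ]
      exact h1 _ _ _ _ (by linarith)
    · simp [hh]
  have e4 : QS n J = FS n (fun a B d => J a B a d) := by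
    have : QS n J = QS n (fun a B c d => if c < a then J a B c d else 0)
        + QS n (fun a B c d => if a < c then J a B c d else 0)
        + FS n (fun a B d => J a B a d) := by
      rw [FS, ← QS_add, ← QS_add]
      refine QS_congr ?_
      intro a B c d _ _ _ _ _
      rcases lt_trichotomy a c with h | h | h
      · simp [h, h.ne, h.le, not_lt.2 h.le]
      · simp [h]
      · simp [h, h.ne', not_lt.2 h.le]
    rw [this, e2, e3]; simp
  have key : QS n f + QS n f + QS n f + QS n f + QS n f + QS n f + QS n f + QS n f
      + QS n J + QS n J + QS n J + QS n J = 0 := by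
    have : QS n (fun a B c d => f a B c d + f d B c a + f a c B d + f d c B a + f B a d c
        + f c a d B + f B d a c + f c d a B
        + J a B c d + J d B c a + J a c B d + J d c B a) = 0 := by
      rw [← Finset.sum_const_zero (s := quads n)]
      exact QS_congr (G := fun _ _ _ _ => 0) (fun a B c d _ _ _ _ h => h2 a B c d h)
    simp only [QS_add] at this
    rw [s1 f, s2 f, s3 f, s4 f, s5 f, s6 f, s7 f, s1 J, s2 J, s4 J] at this
    exact this
  have : FS n (fun a B d => φ a B a d - φ (B + d) 0 d a) = - FS n (fun a B d => J a B a d) := by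
    rw [FS, FS, ← QS_neg]
    refine QS_congr ?_
    intros; simp only [hJ]; split_ifs <;> simp
  rw [this, ← e4]; linarith
end

section
def ev (k : Fin 10 → ℤ) (a B c d : ℤ) : ℤ :=
  k 0 * (a * a) + k 1 * (a * B) + k 2 * (a * c) + k 3 * (a * d) + k 4 * (B * B) + k 5 * (B * c)
    + k 6 * (B * d) + k 7 * (c * c) + k 8 * (c * d) + k 9 * (d * d)

def code (a B c d : ZMod 3) : ℕ := 27 * a.val + 9 * B.val + 3 * c.val + d.val

def co1 (a B c d : ZMod 3) : Fin 10 → ℤ :=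
  let x := code a B c d
  if x = 40 ∨ x = 80 then ![2, 2, -6, 0, -2, 0, 8, 2, 2, -2] else
  if x = 42 ∨ x = 75 then ![12, 0, -12, 2, 2, -2, 2, 2, -2, -2] else
  if x = 52 ∨ x = 68 then ![2, 2, 8, 0, -2, 0, -6, 2, 2, -2] else
  fun _ => 0

def co2 (a B c d : ZMod 3) : Fin 10 → ℤ :=
  let x := code a B c d
  if x = 15 ∨ x = 21 then ![0, -6, 0, 0, 0, 0, 0, 0, -6, 0] else
  if x = 17 ∨ x = 22 then ![0, 0, 0, -6, 0, 0, 0, 0, 0, 0] else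
  if x = 29 ∨ x = 55 then ![0, -6, 0, 0, 0, 6, 0, 0, 0, 0] else
  if x = 32 ∨ x = 61 then ![0, 0, 0, -6, 0, 0, 0, 0, 0, 0] else
  if x = 48 ∨ x = 69 then ![0, 0, 0, 6, 0, 0, 0, 0, 0, 0] else
  fun _ => 0

def co3 (a B c d : ZMod 3) : Fin 10 → ℤ :=
  let x := code a B c d
  if x = 12 ∨ x = 24 then ![4, 0, -6, 0, -2, 0, -6, 2, 0, -4] else
  if x = 13 ∨ x = 26 then ![0, 0, -2, 0, 0, 0, -4, 2, 0, -4] else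
  if x = 14 ∨ x = 25 then ![0, 0, 0, 0, 0, 0, -2, 4, 0, 0] else
  if x = 31 ∨ x = 62 then ![0, 0, -2, 0, 0, 0, 0, 4, 0, 0] else
  if x = 39 ∨ x = 78 then ![4, 0, -2, 0, -2, 0, 2, 0, 0, 0] else
  if x = 50 ∨ x = 70 then ![0, 0, 2, 0, 0, 0, 4, 0, 0, 0] else
  if x = 51 ∨ x = 66 then ![4, 0, -4, 0, -2, 0, -2, 0, 0, 0] else
  fun _ => 0

def co5 (a B c d : ZMod 3) : Fin 10 → ℤ :=
  let x := code a B c d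
  if x = 40 ∨ x = 80 then ![9, 6, -12, 6, 0, 6, -96, 9, 6, 0] else
  if x = 47 ∨ x = 64 then ![6, 0, -6, 12, 96, 0, 96, 9, -6, 0] else
  if x = 52 ∨ x = 68 then ![0, 6, -96, -6, -9, -6, -12, 0, 6, -9] else
  fun _ => 0

def co6 (a B c d : ZMod 3) : Fin 10 → ℤ :=
  let x := code a B c d
  if x = 12 ∨ x = 24 then ![-70, 52, 70, 0, 0, 0, 70, 0, 52, 70] else
  if x = 13 ∨ x = 26 then ![-4, 46, 0, 44, 0, -48, 68, 0, 0, 68] else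
  if x = 14 ∨ x = 25 then ![0, 0, 0, 52, 0, 0, 70, 0, 0, 70] else
  if x = 31 ∨ x = 62 then ![0, 0, 0, 0, 0, -52, -70, 0, 0, 0] else
  if x = 34 ∨ x = 59 then ![0, 46, 68, 48, 4, -44, 0, -68, 0, 0] else
  if x = 39 ∨ x = 78 then ![-70, -52, 70, -52, 0, 52, -70, 0, 0, 0] else
  if x = 51 ∨ x = 66 then ![-68, 0, 68, -44, 0, 48, 0, 0, 46, 4] else
  fun _ => 0

/-- substitution `(a,B,c,d) ↦ (B+d, a-c, d, c)` on coefficient vectors -/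
def pT (k : Fin 10 → ℤ) : Fin 10 → ℤ :=
  ![k 4, k 1, -2 * k 4 + k 6, k 1 + k 5, k 0, -k 1 + k 3, 2 * k 0 + k 2, k 4 - k 6 + k 9,
    -k 1 + k 3 - k 5 + k 8, k 0 + k 2 + k 7]
def p1 (k : Fin 10 → ℤ) : Fin 10 → ℤ := ![k 9, k 6, k 8, k 3, k 4, k 5, k 1, k 7, k 2, k 0]
def p2 (k : Fin 10 → ℤ) : Fin 10 → ℤ := ![k 0, k 2, k 1, k 3, k 7, k 5, k 8, k 4, k 6, k 9]
def p3 (k : Fin 10 → ℤ) : Fin 10 → ℤ := ![k 4, k 1, k 6, k 5, k 0, k 3, k 2, k 9, k 8, k 7]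

lemma ev_pT (k : Fin 10 → ℤ) (a B c d : ℤ) : ev k (B + d) (a - c) d c = ev (pT k) a B c d := by
  simp [ev, pT]; ring
lemma ev_p1 (k : Fin 10 → ℤ) (a B c d : ℤ) : ev k d B c a = ev (p1 k) a B c d := by
  simp [ev, p1]; ring
lemma ev_p2 (k : Fin 10 → ℤ) (a B c d : ℤ) : ev k a c B d = ev (p2 k) a B c d := by
  simp [ev, p2]; ring
lemma ev_p3 (k : Fin 10 → ℤ) (a B c d : ℤ) : ev k B a d c = ev (p3 k) a B c d := by
  simp [ev, p3]; ring
lemma ev_add (k l : Fin 10 → ℤ) (a B c d : ℤ) :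
    ev k a B c d + ev l a B c d = ev (k + l) a B c d := by
  simp [ev]; ring
lemma ev_sub (k l : Fin 10 → ℤ) (a B c d : ℤ) :
    ev k a B c d - ev l a B c d = ev (k - l) a B c d := by
  simp [ev]; ring

/-- extend coefficients depending on residues to a function -/
def eF (C : ZMod 3 → ZMod 3 → ZMod 3 → ZMod 3 → Fin 10 → ℤ) (a B c d : ℤ) : ℤ :=
  ev (C a B c d) a B c d

def Jc (C : ZMod 3 → ZMod 3 → ZMod 3 → ZMod 3 → Fin 10 → ℤ) (a B c d : ZMod 3) : Fin 10 → ℤ :=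
  pT (C (B + d) (a - c) d c) - C a B c d

lemma eF_J (C : ZMod 3 → ZMod 3 → ZMod 3 → ZMod 3 → Fin 10 → ℤ) (a B c d : ℤ) :
    eF C (B + d) (a - c) d c - eF C a B c d = eF (Jc C) a B c d := by
  unfold eF Jc
  rw [ev_pT, ev_sub]; push_cast; rfl

theorem engineEv (n : ℤ) (r : ZMod 3) (hr : (n : ZMod 3) = r)
    (F C : ZMod 3 → ZMod 3 → ZMod 3 → ZMod 3 → Fin 10 → ℤ)
    (h1 : ∀ a B c d : ZMod 3, a * d + B * c = r → ∀ i,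
      Jc C a B c d i = p2 (p1 (p3 (Jc C c d a B))) i)
    (h2 : ∀ a B c d : ZMod 3, a * d + B * c = r → ∀ i,
      F a B c d i + p1 (F d B c a) i + p2 (F a c B d) i + p2 (p1 (F d c B a)) i
      + p3 (F B a d c) i + p2 (p3 (F c a d B)) i + p1 (p3 (F B d a c)) i
      + p2 (p1 (p3 (F c d a B))) i
      + Jc C a B c d i + p1 (Jc C d B c a) i + p2 (Jc C a c B d) i + p2 (p1 (Jc C d c B a)) i = 0) :
    2 * QS n (eF F) = FS n (fun a B d => eF C a B a d - eF C (B + d) 0 d a) := by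
  have hz : ∀ a B c d : ℤ, a * d + B * c = n → (a : ZMod 3) * d + B * c = r := by
    intro a B c d h; rw [← hr, ← h]; push_cast; ring
  refine engine n (eF F) (eF C) ?_ ?_
  · intro a B c d h
    rw [eF_J, eF_J C c d a B]
    unfold eF
    rw [ev_p3 _ d c B a, ev_p1 _ a c B d, ev_p2 _ a B c d]
    congr 1; funext i; exact h1 _ _ _ _ (hz _ _ _ _ h) i
  · intro a B c d h
    rw [eF_J, eF_J C d B c a, eF_J C a c B d, eF_J C d c B a]
    unfold eF
    rw [ev_p1 _ a B c d, ev_p2 _ a B c d, ev_p1 _ a c B d, ev_p2 _ a B c d,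
      ev_p3 _ a B c d, ev_p3 _ a c B d, ev_p2 _ a B c d, ev_p3 _ d B c a, ev_p1 _ a B c d,
      ev_p3 _ d c B a, ev_p1 _ a c B d, ev_p2 _ a B c d,
      ev_p1 _ a B c d, ev_p2 _ a B c d, ev_p1 _ a c B d, ev_p2 _ a B c d]
    simp only [ev_add]
    have : ∀ k : Fin 10 → ℤ, (∀ i, k i = 0) → ev k a B c d = 0 := by
      intro k hk; simp [ev, hk]
    apply this
    intro i
    exact h2 _ _ _ _ (hz _ _ _ _ h) i

/-- Basis vector for the monomial `B d`. -/
def uBd (x : ℤ) : Fin 10 → ℤ := ![0, 0, 0, 0, 0, 0, x, 0, 0, 0]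
def F1 (a B c d : ZMod 3) : Fin 10 → ℤ :=
  uBd ((if a * d = 1 ∧ B * c = 1 then 3 else 0) - (if a * d = 2 ∧ c = 0 ∧ B ≠ 0 then 12 else 0))
def F2 (a _B c d : ZMod 3) : Fin 10 → ℤ :=
  uBd (if a * d = 2 ∧ c = 0 then (if _B = 0 then -12 else 6) else 0)
def F3 (a B c d : ZMod 3) : Fin 10 → ℤ :=
  uBd ((if a * d = 1 ∧ c = 0 then (if B = 0 then -12 else -6) else 0)
    + (if a * d = 2 ∧ B * c = 2 then 3 else 0))
def FG (a B c d : ZMod 3) : Fin 10 → ℤ :=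
  uBd ((if a * d = 1 ∧ c = 0 ∧ B ≠ 0 then 12 else 0) - (if a * d = 2 ∧ B * c = 2 then 3 else 0))
def F5 (a _B c d : ZMod 3) : Fin 10 → ℤ :=
  (if a + d - c = 0 then 0 else ![1, 0, -2, 2, 0, 0, 0, 1, -2, 1])
  - (if a + d + c = 0 then 0 else ![1, 0, 2, 2, 0, 0, 0, 1, 2, 1])
def F5' (a B c d : ZMod 3) : Fin 10 → ℤ := fun i =>
  3 * F5 a B c d i - 12 * F1 a B c d i - 2 * F2 a B c d i
def F6 (a B c d : ZMod 3) : Fin 10 → ℤ := fun i =>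
  2 * F5 a B c d i - 3 * FG a B c d i - 23 * F3 a B c d i

theorem cert1 (n : ℤ) (hr : (n : ZMod 3) = 2) :
    2 * QS n (eF F1) = FS n (fun a B d => eF co1 a B a d - eF co1 (B + d) 0 d a) :=
  engineEv n 2 hr F1 co1 (by decide +kernel) (by decide +kernel)
theorem cert2 (n : ℤ) (hr : (n : ZMod 3) = 2) :
    2 * QS n (eF F2) = FS n (fun a B d => eF co2 a B a d - eF co2 (B + d) 0 d a) :=
  engineEv n 2 hr F2 co2 (by decide +kernel) (by decide +kernel)
theorem cert3 (n : ℤ) (hr : (n : ZMod 3) = 1) :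
    2 * QS n (eF F3) = FS n (fun a B d => eF co3 a B a d - eF co3 (B + d) 0 d a) :=
  engineEv n 1 hr F3 co3 (by decide +kernel) (by decide +kernel)
theorem cert5 (n : ℤ) (hr : (n : ZMod 3) = 2) :
    2 * QS n (eF F5') = FS n (fun a B d => eF co5 a B a d - eF co5 (B + d) 0 d a) :=
  engineEv n 2 hr F5' co5 (by decide +kernel) (by decide +kernel)
theorem cert6 (n : ℤ) (hr : (n : ZMod 3) = 1) :
    2 * QS n (eF F6) = FS n (fun a B d => eF co6 a B a d - eF co6 (B + d) 0 d a) :=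
  engineEv n 1 hr F6 co6 (by decide +kernel) (by decide +kernel)
end

section
lemma FS_eq {R : Type*} [AddCommMonoid R] (n : ℕ) (F : ℤ → ℤ → ℤ → R) :
    FS (n : ℤ) F = ∑ x ∈ n.divisorsAntidiagonal, ∑ j ∈ Finset.range (x.2 - 1),
      F (x.1 : ℤ) ((x.2 : ℤ) - ((j : ℤ) + 1)) ((j : ℤ) + 1) := by
  rw [FS, QS, ← Finset.sum_filter (fun p : ℤ × ℤ × ℤ × ℤ => p.1 = p.2.2.1)
    (fun p => F p.1 p.2.1 p.2.2.2), Finset.sum_sigma']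
  refine Finset.sum_bij' (fun p _ => ⟨(p.1.toNat, (p.2.1 + p.2.2.2).toNat), (p.2.2.2 - 1).toNat⟩)
    (fun y _ => ((y.1.1 : ℤ), (y.1.2 : ℤ) - ((y.2 : ℤ) + 1), (y.1.1 : ℤ), (y.2 : ℤ) + 1)) ?_ ?_ ?_ ?_ ?_
  · rintro ⟨a, B, c, d⟩ hp
    obtain ⟨hp, h⟩ := Finset.mem_filter.1 hp
    obtain ⟨h1, h2, h3, h4, h5⟩ := mem_quads.1 hp
    dsimp only at h
    subst h
    lift a to ℕ using h1.le
    lift B to ℕ using h2.le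
    lift d to ℕ using h4.le
    simp only [Finset.mem_sigma, Nat.mem_divisorsAntidiagonal, Finset.mem_range]
    refine ⟨⟨?_, ?_⟩, by omega⟩
    · zify
      rw [Int.toNat_of_nonneg (by omega), Int.toNat_of_nonneg (by omega)]
      rw [← h5]; ring
    · rintro rfl
      have : (0:ℤ) < a * d + B * a := by positivity
      simp at h5; omega
  · rintro ⟨⟨x, y⟩, j⟩ hp
    simp only [Finset.mem_sigma, Nat.mem_divisorsAntidiagonal, Finset.mem_range] at hp
    obtain ⟨⟨h1, h2⟩, h3⟩ := hp
    have hx : 0 < x := Nat.pos_of_ne_zero (by rintro rfl; simp at h1; omega)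
    refine Finset.mem_filter.2 ⟨mem_quads.2 ⟨by exact_mod_cast hx, by dsimp only; omega, by exact_mod_cast hx, by dsimp only; omega, ?_⟩, rfl⟩
    rw [← h1]; push_cast; ring
  · rintro ⟨a, B, c, d⟩ hp
    obtain ⟨hp, h⟩ := Finset.mem_filter.1 hp
    obtain ⟨h1, h2, h3, h4, h5⟩ := mem_quads.1 hp
    dsimp only at h ⊢
    subst h
    rw [Int.toNat_of_nonneg (by omega), Int.toNat_of_nonneg (by omega), Int.toNat_of_nonneg (by omega)]
    ext <;> simp
  · rintro ⟨⟨x, y⟩, j⟩ hp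
    simp only [Int.toNat_natCast, add_sub_cancel_right, sub_add_cancel]
  · rintro ⟨a, B, c, d⟩ hp
    obtain ⟨hp, h⟩ := Finset.mem_filter.1 hp
    obtain ⟨h1, h2, h3, h4, h5⟩ := mem_quads.1 hp
    dsimp only at h ⊢
    subst h
    rw [Int.toNat_of_nonneg (by omega), Int.toNat_of_nonneg (by omega), Int.toNat_of_nonneg (by omega)]
    simp

lemma range_three_sum (f : ℕ → ℤ) (k : ℕ) :
    ∑ j ∈ Finset.range (3 * k), f j
      = ∑ j ∈ Finset.range k, (f (3 * j) + f (3 * j + 1) + f (3 * j + 2)) := by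
  induction k with
  | zero => simp
  | succ k ih =>
    rw [show 3 * (k + 1) = 3 * k + 1 + 1 + 1 by ring, Finset.sum_range_succ, Finset.sum_range_succ,
      Finset.sum_range_succ, ih, Finset.sum_range_succ]
    ring

lemma sum3 (x1 y1 z1 x2 y2 z2 x0 y0 z0 : ℤ) (f : ℕ → ℤ)
    (h1 : ∀ j : ℕ, f (3 * j) = x1 + y1 * (3 * j + 1) + z1 * (3 * j + 1) ^ 2)
    (h2 : ∀ j : ℕ, f (3 * j + 1) = x2 + y2 * (3 * j + 2) + z2 * (3 * j + 2) ^ 2)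
    (h0 : ∀ j : ℕ, f (3 * j + 2) = x0 + y0 * (3 * j + 3) + z0 * (3 * j + 3) ^ 2) (k : ℕ) :
    2 * ∑ j ∈ Finset.range (3 * k), f j
      = (2 * k * x1 + y1 * (3 * k * (k - 1) + 2 * k)
          + z1 * (3 * k * (k - 1) * (2 * k - 1) + 6 * k * (k - 1) + 2 * k))
      + (2 * k * x2 + y2 * (3 * k * (k - 1) + 4 * k)
          + z2 * (3 * k * (k - 1) * (2 * k - 1) + 12 * k * (k - 1) + 8 * k))
      + (2 * k * x0 + y0 * (3 * k * (k - 1) + 6 * k)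
          + z0 * (3 * k * (k - 1) * (2 * k - 1) + 18 * k * (k - 1) + 18 * k)) := by
  rw [range_three_sum]
  induction k with
  | zero => simp
  | succ k ih =>
    rw [Finset.sum_range_succ, mul_add, ih, h1, h2, h0]
    push_cast; ring

def KC (C : ZMod 3 → ZMod 3 → ZMod 3 → ZMod 3 → Fin 10 → ℤ) (a N d : ZMod 3) : Fin 6 → ℤ :=
  let k := C a (N - d) a d
  let l := C N 0 d a
  ![k 0 + k 2 + k 7 - l 9, k 1 + k 5 - l 3, -k 1 + k 3 - k 5 + k 8 - l 8, k 4 - l 0,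
    -2 * k 4 + k 6 - l 2, k 4 - k 6 + k 9 - l 7]

def evK (k : Fin 6 → ℤ) (a N d : ℤ) : ℤ :=
  (k 0 * a ^ 2 + k 1 * (a * N) + k 3 * N ^ 2) + (k 2 * a + k 4 * N) * d + k 5 * d ^ 2

noncomputable def faceT (C : ZMod 3 → ZMod 3 → ZMod 3 → ZMod 3 → Fin 10 → ℤ) (a N d : ℤ) : ℤ :=
  eF C a (N - d) a d - eF C (N - d + d) 0 d a

lemma faceT_eq (C : ZMod 3 → ZMod 3 → ZMod 3 → ZMod 3 → Fin 10 → ℤ) (a N d : ℤ) :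
    faceT C a N d = evK (KC C a N d) a N d := by
  simp only [faceT, eF, sub_add_cancel, Int.cast_sub, Int.cast_zero, ev, evK, KC, Matrix.cons_val]
  ring

lemma face_inner1 (C : ZMod 3 → ZMod 3 → ZMod 3 → ZMod 3 → Fin 10 → ℤ) (ra : ZMod 3)
    (a : ℤ) (ha : (a : ZMod 3) = ra) (k : ℕ) (v1 v2 v0 : Fin 6 → ℤ)
    (h1 : KC C ra 1 1 = v1) (h2 : KC C ra 1 2 = v2) (h0 : KC C ra 1 0 = v0) :
    2 * ∑ j ∈ Finset.range (3 * k + 1 - 1), faceT C a ((3 * k + 1 : ℕ) : ℤ) (j + 1)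
      = (evK v1 a (3 * k + 1) 0 * (2 * k)
          + (v1 2 * a + v1 4 * (3 * k + 1)) * (3 * k * (k - 1) + 2 * k)
          + v1 5 * (3 * k * (k - 1) * (2 * k - 1) + 6 * k * (k - 1) + 2 * k))
      + (evK v2 a (3 * k + 1) 0 * (2 * k)
          + (v2 2 * a + v2 4 * (3 * k + 1)) * (3 * k * (k - 1) + 4 * k)
          + v2 5 * (3 * k * (k - 1) * (2 * k - 1) + 12 * k * (k - 1) + 8 * k))
      + (evK v0 a (3 * k + 1) 0 * (2 * k)
          + (v0 2 * a + v0 4 * (3 * k + 1)) * (3 * k * (k - 1) + 6 * k)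
          + v0 5 * (3 * k * (k - 1) * (2 * k - 1) + 18 * k * (k - 1) + 18 * k)) := by
  have e3 : (3 : ZMod 3) = 0 := rfl
  rw [Nat.add_sub_cancel]
  rw [sum3 (evK v1 a (3 * k + 1) 0) (v1 2 * a + v1 4 * (3 * k + 1)) (v1 5)
    (evK v2 a (3 * k + 1) 0) (v2 2 * a + v2 4 * (3 * k + 1)) (v2 5)
    (evK v0 a (3 * k + 1) 0) (v0 2 * a + v0 4 * (3 * k + 1)) (v0 5)]
  · ring
  · intro j
    rw [faceT_eq, ha]; push_cast; rw [e3, ← h1]; simp only [zero_mul, zero_add, evK]; ring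
  · intro j
    rw [faceT_eq, ha]; push_cast; rw [e3, ← h2]; simp only [zero_mul, zero_add, evK]; norm_num; ring
  · intro j
    rw [faceT_eq, ha]; push_cast; rw [e3, ← h0]; simp only [zero_mul, zero_add, evK]
    rw [show (2 : ZMod 3) + 1 = 0 from rfl]; ring

lemma face_inner2 (C : ZMod 3 → ZMod 3 → ZMod 3 → ZMod 3 → Fin 10 → ℤ) (ra : ZMod 3)
    (a : ℤ) (ha : (a : ZMod 3) = ra) (k : ℕ) (v1 v2 v0 : Fin 6 → ℤ)
    (h1 : KC C ra 2 1 = v1) (h2 : KC C ra 2 2 = v2) (h0 : KC C ra 2 0 = v0) :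
    2 * ∑ j ∈ Finset.range (3 * k + 2 - 1), faceT C a ((3 * k + 2 : ℕ) : ℤ) (j + 1)
      = (evK v1 a (3 * k + 2) 0 * (2 * k)
          + (v1 2 * a + v1 4 * (3 * k + 2)) * (3 * k * (k - 1) + 2 * k)
          + v1 5 * (3 * k * (k - 1) * (2 * k - 1) + 6 * k * (k - 1) + 2 * k))
      + (evK v2 a (3 * k + 2) 0 * (2 * k)
          + (v2 2 * a + v2 4 * (3 * k + 2)) * (3 * k * (k - 1) + 4 * k)
          + v2 5 * (3 * k * (k - 1) * (2 * k - 1) + 12 * k * (k - 1) + 8 * k))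
      + (evK v0 a (3 * k + 2) 0 * (2 * k)
          + (v0 2 * a + v0 4 * (3 * k + 2)) * (3 * k * (k - 1) + 6 * k)
          + v0 5 * (3 * k * (k - 1) * (2 * k - 1) + 18 * k * (k - 1) + 18 * k))
      + 2 * evK v1 a (3 * k + 2) (3 * k + 1) := by
  have e3 : (3 : ZMod 3) = 0 := rfl
  rw [show 3 * k + 2 - 1 = 3 * k + 1 by omega, Finset.sum_range_succ, mul_add]
  have g1 : ∀ j : ℕ, faceT C a ((3 * k + 2 : ℕ) : ℤ) (((3 * j : ℕ) : ℤ) + 1)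
      = evK v1 a (3 * k + 2) (3 * j + 1) := by
    intro j
    rw [faceT_eq, ha]; push_cast; rw [e3, ← h1]; simp only [zero_mul, zero_add]
  rw [sum3 (evK v1 a (3 * k + 2) 0) (v1 2 * a + v1 4 * (3 * k + 2)) (v1 5)
    (evK v2 a (3 * k + 2) 0) (v2 2 * a + v2 4 * (3 * k + 2)) (v2 5)
    (evK v0 a (3 * k + 2) 0) (v0 2 * a + v0 4 * (3 * k + 2)) (v0 5), g1]
  · ring
  · intro j
    rw [g1]; simp only [evK]; ring
  · intro j
    rw [faceT_eq, ha]; push_cast; rw [e3, ← h2]; simp only [zero_mul, zero_add, evK]; norm_num; ring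
  · intro j
    rw [faceT_eq, ha]; push_cast; rw [e3, ← h0]; simp only [zero_mul, zero_add, evK]
    rw [show (2 : ZMod 3) + 1 = 0 from rfl]; ring

lemma inner1_1 (a : ℤ) (N : ℕ) (ha : (a : ZMod 3) = 1) (hN : N % 3 = 2) :
    18 * ∑ j ∈ Finset.range (N - 1), faceT co1 a N (j + 1) = 2 * (24 + 18*N - 6*N^2 + 6*(a*N) + 6*(a*N^2) - 6*a^2 - 6*(a^2*N)) := by
  obtain ⟨k, rfl⟩ : ∃ k, N = 3 * k + 2 := ⟨N / 3, by omega⟩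
  have := face_inner2 co1 1 a ha k ![-2, 2, 0, -2, 12, -12] ![0, 0, 0, 0, 0, 0] ![0, 0, 0, 0, 0, 0]
    (by decide +kernel) (by decide +kernel) (by decide +kernel)
  simp only [evK, Matrix.cons_val] at this
  push_cast at this ⊢
  linear_combination 9 * this

lemma inner1_2 (a : ℤ) (N : ℕ) (ha : (a : ZMod 3) = 2) (hN : N % 3 = 1) :
    18 * ∑ j ∈ Finset.range (N - 1), faceT co1 a N (j + 1) = 2 * (-24 + 18*N + 6*N^2 - 6*(a*N) + 6*(a*N^2) + 6*a^2 - 6*(a^2*N)) := by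
  obtain ⟨k, rfl⟩ : ∃ k, N = 3 * k + 1 := ⟨N / 3, by omega⟩
  have := face_inner1 co1 2 a ha k ![0, 0, 0, 0, 0, 0] ![-2, 2, 0, -2, 12, -12] ![0, 0, 0, 0, 0, 0]
    (by decide +kernel) (by decide +kernel) (by decide +kernel)
  simp only [evK, Matrix.cons_val] at this
  push_cast at this ⊢
  linear_combination 9 * this

lemma inner2_1 (a : ℤ) (N : ℕ) (ha : (a : ZMod 3) = 1) (hN : N % 3 = 2) :
    18 * ∑ j ∈ Finset.range (N - 1), faceT co2 a N (j + 1) = 2 * (-36*a - 18*(a*N) + 18*(a*N^2)) := by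
  obtain ⟨k, rfl⟩ : ∃ k, N = 3 * k + 2 := ⟨N / 3, by omega⟩
  have := face_inner2 co2 1 a ha k ![0, 0, 0, 0, 0, 0] ![0, 6, -6, 0, 0, 0] ![0, 0, 6, 0, 0, 0]
    (by decide +kernel) (by decide +kernel) (by decide +kernel)
  simp only [evK, Matrix.cons_val] at this
  push_cast at this ⊢
  linear_combination 9 * this

lemma inner2_2 (a : ℤ) (N : ℕ) (ha : (a : ZMod 3) = 2) (hN : N % 3 = 1) :
    18 * ∑ j ∈ Finset.range (N - 1), faceT co2 a N (j + 1) = 2 * (-36*a + 18*(a*N) + 18*(a*N^2)) := by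
  obtain ⟨k, rfl⟩ : ∃ k, N = 3 * k + 1 := ⟨N / 3, by omega⟩
  have := face_inner1 co2 2 a ha k ![0, 6, -6, 0, 0, 0] ![0, 0, 0, 0, 0, 0] ![0, 0, 6, 0, 0, 0]
    (by decide +kernel) (by decide +kernel) (by decide +kernel)
  simp only [evK, Matrix.cons_val] at this
  push_cast at this ⊢
  linear_combination 9 * this

lemma inner3_1 (a : ℤ) (N : ℕ) (ha : (a : ZMod 3) = 1) (hN : N % 3 = 1) :
    18 * ∑ j ∈ Finset.range (N - 1), faceT co3 a N (j + 1) = 2 * (-18*N+18*N^2-18*a^2+18*(a^2*N)) := by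
  obtain ⟨k, rfl⟩ : ∃ k, N = 3 * k + 1 := ⟨N / 3, by omega⟩
  have := face_inner1 co3 1 a ha k ![2, 0, 0, 0, 2, -4] ![2, 0, 0, 0, 4, -4] ![2, 0, 0, -2, 6, -4]
    (by decide +kernel) (by decide +kernel) (by decide +kernel)
  simp only [evK, Matrix.cons_val] at this
  push_cast at this ⊢
  linear_combination 9 * this

lemma inner3_2 (a : ℤ) (N : ℕ) (ha : (a : ZMod 3) = 2) (hN : N % 3 = 2) :
    18 * ∑ j ∈ Finset.range (N - 1), faceT co3 a N (j + 1) = 2 * (-18*N+18*N^2-18*a^2+18*(a^2*N)) := by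
  obtain ⟨k, rfl⟩ : ∃ k, N = 3 * k + 2 := ⟨N / 3, by omega⟩
  have := face_inner2 co3 2 a ha k ![2, 0, 0, 0, 4, -4] ![2, 0, 0, 0, 2, -4] ![2, 0, 0, -2, 6, -4]
    (by decide +kernel) (by decide +kernel) (by decide +kernel)
  simp only [evK, Matrix.cons_val] at this
  push_cast at this ⊢
  linear_combination 9 * this

lemma inner5_1 (a : ℤ) (N : ℕ) (ha : (a : ZMod 3) = 1) (hN : N % 3 = 2) :
    18 * ∑ j ∈ Finset.range (N - 1), faceT co5 a N (j + 1) = 2 * (3*(-64-48*N-16*N^3+12*(a*N)+12*(a*N^2)+6*a^2+6*(a^2*N))) := by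
  obtain ⟨k, rfl⟩ : ∃ k, N = 3 * k + 2 := ⟨N / 3, by omega⟩
  have := face_inner2 co5 1 a ha k ![6, 12, 0, 0, -96, 96] ![0, 0, 0, 0, 0, 0] ![0, 0, 0, 0, 0, 0]
    (by decide +kernel) (by decide +kernel) (by decide +kernel)
  simp only [evK, Matrix.cons_val] at this
  push_cast at this ⊢
  linear_combination 9 * this

lemma inner5_2 (a : ℤ) (N : ℕ) (ha : (a : ZMod 3) = 2) (hN : N % 3 = 1) :
    18 * ∑ j ∈ Finset.range (N - 1), faceT co5 a N (j + 1) = 2 * (3*(64-48*N-16*N^3-12*(a*N)+12*(a*N^2)-6*a^2+6*(a^2*N))) := by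
  obtain ⟨k, rfl⟩ : ∃ k, N = 3 * k + 1 := ⟨N / 3, by omega⟩
  have := face_inner1 co5 2 a ha k ![0, 0, 0, 0, 0, 0] ![6, 12, 0, 0, -96, 96] ![0, 0, 0, 0, 0, 0]
    (by decide +kernel) (by decide +kernel) (by decide +kernel)
  simp only [evK, Matrix.cons_val] at this
  push_cast at this ⊢
  linear_combination 9 * this

lemma inner6_1 (a : ℤ) (N : ℕ) (ha : (a : ZMod 3) = 1) (hN : N % 3 = 1) :
    18 * ∑ j ∈ Finset.range (N - 1), faceT co6 a N (j + 1) = 2 * (-4+108*N-104*N^3+312*a-12*(a*N)-300*(a*N^2)) := by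
  obtain ⟨k, rfl⟩ : ∃ k, N = 3 * k + 1 := ⟨N / 3, by omega⟩
  have := face_inner1 co6 1 a ha k ![0, -52, 52, 0, -70, 70] ![0, -48, 0, 0, -68, 68] ![0, 0, -52, 0, -70, 70]
    (by decide +kernel) (by decide +kernel) (by decide +kernel)
  simp only [evK, Matrix.cons_val] at this
  push_cast at this ⊢
  linear_combination 9 * this

lemma inner6_2 (a : ℤ) (N : ℕ) (ha : (a : ZMod 3) = 2) (hN : N % 3 = 2) :
    18 * ∑ j ∈ Finset.range (N - 1), faceT co6 a N (j + 1) = 2 * (4+108*N-104*N^3+312*a+12*(a*N)-300*(a*N^2)) := by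
  obtain ⟨k, rfl⟩ : ∃ k, N = 3 * k + 2 := ⟨N / 3, by omega⟩
  have := face_inner2 co6 2 a ha k ![0, -48, 0, 0, -68, 68] ![0, -52, 52, 0, -70, 70] ![0, 0, -52, 0, -70, 70]
    (by decide +kernel) (by decide +kernel) (by decide +kernel)
  simp only [evK, Matrix.cons_val] at this
  push_cast at this ⊢
  linear_combination 9 * this
end

section
/-- sum over ordered factorisations -/
noncomputable def DS {R : Type*} [AddCommMonoid R] (n : ℕ) (h : ℕ → ℕ → R) : R :=
  ∑ x ∈ n.divisorsAntidiagonal, h x.1 x.2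

lemma DS_congr {R : Type*} [AddCommMonoid R] {n : ℕ} {h k : ℕ → ℕ → R}
    (H : ∀ a N, a * N = n → 0 < a → 0 < N → h a N = k a N) : DS n h = DS n k := by
  refine Finset.sum_congr rfl ?_
  rintro ⟨a, N⟩ hx
  rw [Nat.mem_divisorsAntidiagonal] at hx
  obtain ⟨h1, h2⟩ := hx
  refine H a N h1 (Nat.pos_of_ne_zero ?_) (Nat.pos_of_ne_zero ?_) <;> rintro rfl <;> simp at h1 <;> omega

lemma DS_swap {R : Type*} [AddCommMonoid R] (n : ℕ) (h : ℕ → ℕ → R) :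
    DS n (fun a N => h N a) = DS n h := by
  refine Finset.sum_nbij' Prod.swap Prod.swap ?_ ?_ ?_ ?_ ?_ <;> simp

lemma DS_add {R : Type*} [AddCommMonoid R] (n : ℕ) (h k : ℕ → ℕ → R) :
    DS n (fun a N => h a N + k a N) = DS n h + DS n k := Finset.sum_add_distrib
lemma DS_sub {R : Type*} [AddCommGroup R] (n : ℕ) (h k : ℕ → ℕ → R) :
    DS n (fun a N => h a N - k a N) = DS n h - DS n k := Finset.sum_sub_distrib ..
lemma DS_mul {R : Type*} [CommRing R] (n : ℕ) (c : R) (h : ℕ → ℕ → R) :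
    DS n (fun a N => c * h a N) = c * DS n h := (Finset.mul_sum ..).symm

/-- two summands with the same symmetrization have the same sum -/
lemma DS_sym {n : ℕ} {h k : ℕ → ℕ → ℤ}
    (H : ∀ a N, a * N = n → 0 < a → 0 < N → h a N + h N a = k a N + k N a) : DS n h = DS n k := by
  have h1 := DS_congr (n := n) (h := fun a N => h a N + h N a) (k := fun a N => k a N + k N a) H
  rw [DS_add, DS_add, DS_swap n h, DS_swap n k] at h1
  linarith

lemma FS_face (C : ZMod 3 → ZMod 3 → ZMod 3 → ZMod 3 → Fin 10 → ℤ) (n : ℕ) :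
    FS (n : ℤ) (fun a B d => eF C a B a d - eF C (B + d) 0 d a)
      = DS n (fun a N => ∑ j ∈ Finset.range (N - 1), faceT C a N (j + 1)) := by
  rw [FS_eq]; rfl

lemma nat_res {a N n : ℕ} (h : a * N = n) (h3 : n % 3 = 2) :
    (a % 3 = 1 ∧ N % 3 = 2) ∨ (a % 3 = 2 ∧ N % 3 = 1) := by
  have : (a % 3) * (N % 3) % 3 = 2 := by rw [← Nat.mul_mod, h, h3]
  have ha := Nat.mod_lt a (show 0 < 3 by norm_num)
  have hN := Nat.mod_lt N (show 0 < 3 by norm_num)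
  interval_cases a % 3 <;> interval_cases N % 3 <;> simp_all

lemma nat_res1 {a N n : ℕ} (h : a * N = n) (h3 : n % 3 = 1) :
    (a % 3 = 1 ∧ N % 3 = 1) ∨ (a % 3 = 2 ∧ N % 3 = 2) := by
  have : (a % 3) * (N % 3) % 3 = 1 := by rw [← Nat.mul_mod, h, h3]
  have ha := Nat.mod_lt a (show 0 < 3 by norm_num)
  have hN := Nat.mod_lt N (show 0 < 3 by norm_num)
  interval_cases a % 3 <;> interval_cases N % 3 <;> simp_all

lemma cast_res {a : ℕ} {r : ℕ} (h : a % 3 = r) : ((a : ℤ) : ZMod 3) = (r : ZMod 3) := by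
  rw [← h]; simp

/-- `±1` according to the residue mod 3 -/
def eps (a : ℕ) : ℤ := if a % 3 = 1 then 1 else -1

lemma sumDS2 (n : ℕ) (h3 : n % 3 = 2) (C : ZMod 3 → ZMod 3 → ZMod 3 → ZMod 3 → Fin 10 → ℤ)
    (F : ZMod 3 → ZMod 3 → ZMod 3 → ZMod 3 → Fin 10 → ℤ) (p : ℕ → ℕ → ℤ)
    (hc : ∀ n : ℤ, (n : ZMod 3) = 2 →
      2 * QS n (eF F) = FS n (fun a B d => eF C a B a d - eF C (B + d) 0 d a))
    (h1 : ∀ a N : ℕ, a * N = n → a % 3 = 1 → N % 3 = 2 →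
       18 * ∑ j ∈ Finset.range (N - 1), faceT C a N (j + 1) = 2 * p a N)
    (h2 : ∀ a N : ℕ, a * N = n → a % 3 = 2 → N % 3 = 1 →
       18 * ∑ j ∈ Finset.range (N - 1), faceT C a N (j + 1) = 2 * p a N) :
    18 * QS n (eF F) = DS n p := by
  have := hc n (by have := cast_res h3; exact_mod_cast this)
  rw [FS_face] at this
  have h : DS n (fun a N => 18 * ∑ j ∈ Finset.range (N - 1), faceT C a N (j + 1))
      = DS n (fun a N => 2 * p a N) := by
    refine DS_congr ?_
    intro a N h _ _
    rcases nat_res h h3 with h' | h'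
    · exact h1 a N h h'.1 h'.2
    · exact h2 a N h h'.1 h'.2
  rw [DS_mul, DS_mul] at h
  linarith

lemma sumDS1 (n : ℕ) (h3 : n % 3 = 1) (C : ZMod 3 → ZMod 3 → ZMod 3 → ZMod 3 → Fin 10 → ℤ)
    (F : ZMod 3 → ZMod 3 → ZMod 3 → ZMod 3 → Fin 10 → ℤ) (p : ℕ → ℕ → ℤ)
    (hc : ∀ n : ℤ, (n : ZMod 3) = 1 →
      2 * QS n (eF F) = FS n (fun a B d => eF C a B a d - eF C (B + d) 0 d a))
    (h1 : ∀ a N : ℕ, a * N = n → a % 3 = 1 → N % 3 = 1 →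
       18 * ∑ j ∈ Finset.range (N - 1), faceT C a N (j + 1) = 2 * p a N)
    (h2 : ∀ a N : ℕ, a * N = n → a % 3 = 2 → N % 3 = 2 →
       18 * ∑ j ∈ Finset.range (N - 1), faceT C a N (j + 1) = 2 * p a N) :
    18 * QS n (eF F) = DS n p := by
  have := hc n (by have := cast_res h3; exact_mod_cast this)
  rw [FS_face] at this
  have h : DS n (fun a N => 18 * ∑ j ∈ Finset.range (N - 1), faceT C a N (j + 1))
      = DS n (fun a N => 2 * p a N) := by
    refine DS_congr ?_
    intro a N h _ _
    rcases nat_res1 h h3 with h' | h'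
    · exact h1 a N h h'.1 h'.2
    · exact h2 a N h h'.1 h'.2
  rw [DS_mul, DS_mul] at h
  linarith

noncomputable def sig (n : ℕ) : ℤ := DS n (fun _ N => (N : ℤ))

lemma cast_mul_eq {a N n : ℕ} (h : a * N = n) : (a : ℤ) * N = n := by exact_mod_cast h

theorem J1 (n : ℕ) (h3 : n % 3 = 2) : QS n (eF F1) = sig n := by
  have := sumDS2 n h3 co1 F1
    (fun a N => 18 * N + eps a * (24 - 6 * N ^ 2 + 6 * n - 6 * a ^ 2) + 6 * n * N - 6 * n * a) cert1
    (fun a N h ha hN => by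
      rw [inner1_1 a N (by simpa using cast_res ha) hN, ← h, eps, if_pos ha]; push_cast; ring)
    (fun a N h ha hN => by
      rw [inner1_2 a N (by simpa using cast_res ha) hN, ← h, eps, if_neg (by omega)]; push_cast; ring)
  have h2 : DS n (fun a N => 18 * N + eps a * (24 - 6 * N ^ 2 + 6 * n - 6 * a ^ 2) + 6 * n * N - 6 * n * a)
      = DS n (fun a N => 18 * (N : ℤ)) := by
    refine DS_sym ?_
    intro a N h _ _
    rcases nat_res h h3 with ⟨ha, hN⟩ | ⟨ha, hN⟩ <;> simp [eps, ha, hN] <;> ring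
  rw [h2, DS_mul] at this
  rw [sig]; linarith

theorem J2 (n : ℕ) (h3 : n % 3 = 2) : QS n (eF F2) = (n - 2) * sig n := by
  have := sumDS2 n h3 co2 F2
    (fun a N => - 36 * a - 18 * n * eps a + 18 * n * N) cert2
    (fun a N h ha hN => by
      rw [inner2_1 a N (by simpa using cast_res ha) hN, ← h, eps, if_pos ha]; push_cast; ring)
    (fun a N h ha hN => by
      rw [inner2_2 a N (by simpa using cast_res ha) hN, ← h, eps, if_neg (by omega)]; push_cast; ring)
  have h2 : DS n (fun a N => - 36 * a - 18 * n * eps a + 18 * n * N)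
      = DS n (fun a N => (18 * (n - 2)) * (N : ℤ)) := by
    refine DS_sym ?_
    intro a N h _ _
    rcases nat_res h h3 with ⟨ha, hN⟩ | ⟨ha, hN⟩ <;> simp [eps, ha, hN] <;> ring
  rw [h2, DS_mul] at this
  rw [sig]; linarith

theorem J3 (n : ℕ) (h3 : n % 3 = 1) : QS n (eF F3) = (n - 1) * sig n := by
  have := sumDS1 n h3 co3 F3
    (fun a N => -18 * N + 18 * N ^ 2 - 18 * a ^ 2 + 18 * n * a) cert3
    (fun a N h ha hN => by
      rw [inner3_1 a N (by simpa using cast_res ha) hN, ← h]; push_cast; ring)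
    (fun a N h ha hN => by
      rw [inner3_2 a N (by simpa using cast_res ha) hN, ← h]; push_cast; ring)
  have h2 : DS n (fun a N => (-18 : ℤ) * N + 18 * N ^ 2 - 18 * a ^ 2 + 18 * n * a)
      = DS n (fun a N => (18 * (n - 1)) * (N : ℤ)) := by
    refine DS_sym ?_
    intro a N h _ _
    ring
  rw [h2, DS_mul] at this
  rw [sig]; linarith

lemma QS_mul3 (n : ℤ) (x y z : ℤ) (F G H : ZMod 3 → ZMod 3 → ZMod 3 → ZMod 3 → Fin 10 → ℤ) :
    QS n (eF (fun a B c d i => x * F a B c d i - y * G a B c d i - z * H a B c d i))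
      = x * QS n (eF F) - y * QS n (eF G) - z * QS n (eF H) := by
  rw [← QS_mul, ← QS_mul, ← QS_mul, ← QS_sub, ← QS_sub]
  refine QS_congr ?_
  intros; simp only [eF, ev]; ring

theorem J5 (n : ℕ) (h3 : n % 3 = 2) : 18 * QS n (eF F5) = 72 * sig n + 12 * (n - 2) * sig n
    + DS n (fun a N => eps a * (-64 + 12 * n + 6 * a ^ 2) - 48 * N - 16 * N ^ 3 + 12 * n * N + 6 * n * a) := by
  have := sumDS2 n h3 co5 F5'
    (fun a N => 3 * (eps a * (-64 + 12 * n + 6 * a ^ 2) - 48 * N - 16 * N ^ 3 + 12 * n * N + 6 * n * a)) cert5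
    (fun a N h ha hN => by
      rw [inner5_1 a N (by simpa using cast_res ha) hN, ← h, eps, if_pos ha]; push_cast; ring)
    (fun a N h ha hN => by
      rw [inner5_2 a N (by simpa using cast_res ha) hN, ← h, eps, if_neg (by omega)]; push_cast; ring)
  rw [DS_mul] at this
  have e : QS n (eF F5') = _ := QS_mul3 n 3 12 2 F5 F1 F2
  rw [e, J1 n h3, J2 n h3] at this
  linarith

theorem J6 (n : ℕ) (h3 : n % 3 = 1) : 18 * (2 * QS n (eF F5) - 3 * QS n (eF FG))
    = 18 * 23 * (n - 1) * sig n
    + DS n (fun a N => eps a * (-4 - 12 * n) + 108 * N - 104 * N ^ 3 + 312 * a - 300 * n * N) := by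
  have := sumDS1 n h3 co6 F6
    (fun a N => eps a * (-4 - 12 * n) + 108 * N - 104 * N ^ 3 + 312 * a - 300 * n * N) cert6
    (fun a N h ha hN => by
      rw [inner6_1 a N (by simpa using cast_res ha) hN, ← h, eps, if_pos ha]; push_cast; ring)
    (fun a N h ha hN => by
      rw [inner6_2 a N (by simpa using cast_res ha) hN, ← h, eps, if_neg (by omega)]; push_cast; ring)
  have e : QS n (eF F6) = _ := QS_mul3 n 2 3 23 F5 FG F3
  rw [e, J3 n h3] at this
  linarith
end

section
open PowerSeries
set_option linter.unusedSimpArgs false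

lemma zmod3_cases : ∀ x : ZMod 3, x = 0 ∨ x = 1 ∨ x = 2 := by decide
lemma z01 : ((0 : ZMod 3) = 1) = False := by simp
lemma z02 : ((0 : ZMod 3) = 2) = False := eq_false (by decide)
lemma z12 : ((1 : ZMod 3) = 2) = False := eq_false (by decide)
lemma z21 : ((2 : ZMod 3) = 1) = False := eq_false (by decide)

lemma DS_conv (n : ℕ) (f g : ℕ → ℕ → ℤ) :
    ∑ x ∈ Finset.HasAntidiagonal.antidiagonal n, DS x.1 f * DS x.2 g
      = QS n (fun a B c d => f a.toNat d.toNat * g c.toNat B.toNat) := by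
  have : ∀ x ∈ Finset.HasAntidiagonal.antidiagonal n, DS x.1 f * DS x.2 g =
      ∑ y ∈ x.1.divisorsAntidiagonal ×ˢ x.2.divisorsAntidiagonal, f y.1.1 y.1.2 * g y.2.1 y.2.2 := by
    intro x _
    rw [DS, DS, Finset.sum_mul_sum, Finset.sum_product]
  rw [Finset.sum_congr rfl this, Finset.sum_sigma', QS]
  refine Finset.sum_bij' (fun y _ => ((y.2.1.1 : ℤ), (y.2.2.2 : ℤ), (y.2.2.1 : ℤ), (y.2.1.2 : ℤ)))
    (fun p _ => ⟨((p.1 * p.2.2.2).toNat, (p.2.1 * p.2.2.1).toNat),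
      ((p.1.toNat, p.2.2.2.toNat), (p.2.2.1.toNat, p.2.1.toNat))⟩) ?_ ?_ ?_ ?_ ?_
  · rintro ⟨⟨i, j⟩, ⟨⟨a, d⟩, ⟨c, B⟩⟩⟩ h
    simp only [Finset.mem_sigma, Finset.HasAntidiagonal.mem_antidiagonal, Finset.mem_product,
      Nat.mem_divisorsAntidiagonal] at h
    obtain ⟨h1, ⟨h2, h3⟩, h4, h5⟩ := h
    have h6 : a * d ≠ 0 := h2 ▸ h3
    have h7 : c * B ≠ 0 := h4 ▸ h5
    have h8 : a ≠ 0 ∧ d ≠ 0 := by simpa using h6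
    have h9 : c ≠ 0 ∧ B ≠ 0 := by simpa using h7
    refine mem_quads.2 ⟨?_, ?_, ?_, ?_, ?_⟩
    · dsimp only; omega
    · dsimp only; omega
    · dsimp only; omega
    · dsimp only; omega
    · dsimp only; rw [← h1, ← h2, ← h4]; push_cast; ring
  · rintro ⟨a, B, c, d⟩ hp
    obtain ⟨h1, h2, h3, h4, h5⟩ := mem_quads.1 hp
    lift a to ℕ using h1.le
    lift B to ℕ using h2.le
    lift c to ℕ using h3.le
    lift d to ℕ using h4.le
    simp only [Finset.mem_sigma, Finset.HasAntidiagonal.mem_antidiagonal, Finset.mem_product,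
      Nat.mem_divisorsAntidiagonal, ← Nat.cast_mul, Int.toNat_natCast]
    norm_cast at h1 h2 h3 h4 h5
    refine ⟨h5, ⟨trivial, by positivity⟩, mul_comm _ _, by positivity⟩
  · rintro ⟨⟨i, j⟩, ⟨⟨a, d⟩, ⟨c, B⟩⟩⟩ h
    simp only [Finset.mem_sigma, Finset.HasAntidiagonal.mem_antidiagonal, Finset.mem_product,
      Nat.mem_divisorsAntidiagonal] at h
    obtain ⟨h1, ⟨h2, h3⟩, h4, h5⟩ := h
    simp only [← Nat.cast_mul, Int.toNat_natCast, h2, mul_comm B c, h4]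
  · rintro ⟨a, B, c, d⟩ hp
    obtain ⟨h1, h2, h3, h4, h5⟩ := mem_quads.1 hp
    simp only [Int.toNat_of_nonneg h1.le, Int.toNat_of_nonneg h2.le, Int.toNat_of_nonneg h3.le,
      Int.toNat_of_nonneg h4.le]
  · rintro ⟨⟨i, j⟩, ⟨⟨a, d⟩, ⟨c, B⟩⟩⟩ h
    simp

noncomputable def psD (h : ℕ → ℕ → ℤ) : PowerSeries ℤ := PowerSeries.mk (fun n => DS n h)

lemma coeff_psD_mul (n : ℕ) (f g : ℕ → ℕ → ℤ) : coeff n (psD f * psD g)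
    = QS n (fun a B c d => f a.toNat d.toNat * g c.toNat B.toNat) := by
  rw [coeff_mul, ← DS_conv]
  simp [psD]

noncomputable def DD (f : PowerSeries ℤ) : PowerSeries ℤ := X * PowerSeries.derivative ℤ f

lemma coeff_DD (n : ℕ) (f : PowerSeries ℤ) : coeff n (DD f) = n * coeff n f := by
  cases n with
  | zero => simp [DD]
  | succ n => rw [DD, coeff_succ_X_mul, PowerSeries.coeff_derivative]; push_cast; ring

lemma DD_mul (f g : PowerSeries ℤ) : DD (f * g) = DD f * g + f * DD g := by
  simp only [DD, Derivation.leibniz, smul_eq_mul]; ring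
lemma DD_sub (f g : PowerSeries ℤ) : DD (f - g) = DD f - DD g := by
  simp only [DD, map_sub]; ring
lemma DD_add (f g : PowerSeries ℤ) : DD (f + g) = DD f + DD g := by
  simp only [DD, map_add]; ring
lemma DD_C (c : ℤ) (f : PowerSeries ℤ) : DD (PowerSeries.C c * f) = PowerSeries.C c * DD f := by
  ext n; rw [coeff_DD, coeff_C_mul, coeff_C_mul, coeff_DD]; ring

def fs1 (a N : ℕ) : ℤ := if (a : ZMod 3) * N = 1 then N else 0
def fs2 (a N : ℕ) : ℤ := if (a : ZMod 3) * N = 2 then N else 0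
def fE (a N : ℕ) : ℤ := if (a : ZMod 3) = 0 ∧ (N : ZMod 3) ≠ 0 then N else 0
def fe (a N : ℕ) : ℤ := if (a : ZMod 3) = 0 then N else 0

lemma cast_toNat {a : ℤ} (h : 0 < a) : ((a.toNat : ℕ) : ZMod 3) = (a : ZMod 3) := by
  have h' := congrArg (Int.cast : ℤ → ZMod 3) (Int.toNat_of_nonneg h.le)
  simpa only [Int.cast_natCast] using h'

lemma coeff_fs1 (n : ℕ) : coeff n (psD fs1) = if (n : ZMod 3) = 1 then sig n else 0 := by
  rw [psD, coeff_mk, sig]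
  split_ifs with h
  · refine DS_congr ?_
    intro a N h1 _ _
    rw [fs1, if_pos (by rw [← h, ← h1]; push_cast; rfl)]
  · rw [DS]
    refine Finset.sum_eq_zero ?_
    intro x hx
    rw [Nat.mem_divisorsAntidiagonal] at hx
    rw [fs1, if_neg (by rw [← Nat.cast_mul, hx.1]; exact h)]

lemma coeff_fs2 (n : ℕ) : coeff n (psD fs2) = if (n : ZMod 3) = 2 then sig n else 0 := by
  rw [psD, coeff_mk, sig]
  split_ifs with h
  · refine DS_congr ?_
    intro a N h1 _ _
    rw [fs2, if_pos (by rw [← h, ← h1]; push_cast; rfl)]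
  · rw [DS]
    refine Finset.sum_eq_zero ?_
    intro x hx
    rw [Nat.mem_divisorsAntidiagonal] at hx
    rw [fs2, if_neg (by rw [← Nat.cast_mul, hx.1]; exact h)]

lemma QS_eF_zero (n : ℤ) (F : ZMod 3 → ZMod 3 → ZMod 3 → ZMod 3 → Fin 10 → ℤ) (r : ZMod 3)
    (hF : ∀ a B c d : ZMod 3, a * d + B * c ≠ r → ∀ i, F a B c d i = 0) (h : (n : ZMod 3) ≠ r) :
    QS n (eF F) = 0 := by
  rw [← Finset.sum_const_zero (s := quads n)]
  refine QS_congr (G := fun _ _ _ _ => (0 : ℤ)) ?_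
  intro a B c d _ _ _ _ h5
  have : (a : ZMod 3) * d + B * c ≠ r := by
    rw [← h5] at h; push_cast at h; exact h
  simp [eF, ev, hF _ _ _ _ this]

lemma ev_uBd (x a B c d : ℤ) : ev (uBd x) a B c d = x * (B * d) := by
  simp [ev, uBd]

lemma mod_of_cast {n r : ℕ} (hr : r < 3) (h : (n : ZMod 3) = (r : ZMod 3)) : n % 3 = r := by
  rw [ZMod.natCast_eq_natCast_iff] at h
  rw [h, Nat.mod_eq_of_lt hr]

/-- first identity -/
theorem PS1 : 3 * (psD fs1 * psD fs1) = psD fs2 * (1 + 12 * psD fE) := by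
  have key : 3 * (psD fs1 * psD fs1) - 12 * (psD fs2 * psD fE) = psD fs2 := by
    ext n
    have e3 : ∀ f : PowerSeries ℤ, coeff n (3 * f) = 3 * coeff n f := fun f => by
      rw [show (3 : PowerSeries ℤ) = PowerSeries.C 3 by simp, coeff_C_mul]
    have e12 : ∀ f : PowerSeries ℤ, coeff n (12 * f) = 12 * coeff n f := fun f => by
      rw [show (12 : PowerSeries ℤ) = PowerSeries.C 12 by simp, coeff_C_mul]
    rw [map_sub, e3, e12, coeff_psD_mul, coeff_psD_mul, coeff_fs2, ← QS_mul, ← QS_mul, ← QS_sub]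
    have : QS n (fun a B c d => 3 * (fs1 a.toNat d.toNat * fs1 c.toNat B.toNat)
        - 12 * (fs2 a.toNat d.toNat * fE c.toNat B.toNat)) = QS n (eF F1) := by
      refine QS_congr ?_
      intro a B c d ha hB hc hd _
      simp only [fs1, fs2, fE, cast_toNat ha, cast_toNat hB, cast_toNat hc, cast_toNat hd,
        Int.toNat_of_nonneg ha.le, Int.toNat_of_nonneg hB.le, Int.toNat_of_nonneg hc.le,
        Int.toNat_of_nonneg hd.le, eF, F1, ev_uBd, mul_comm (c : ZMod 3) (B : ZMod 3)]
      rcases zmod3_cases ((a : ZMod 3) * d) with h | h | h <;>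
        simp only [h, z01, z02, z12, z21, true_and, false_and, if_true, if_false] <;>
        split_ifs <;> first | ring1 | (exfalso; tauto)
    rw [this]
    split_ifs with h
    · exact J1 n (mod_of_cast (r := 2) (by norm_num) h)
    · exact QS_eF_zero n F1 2 (by decide +kernel) (by exact_mod_cast h)
  linear_combination key

theorem PS2 : DD (psD fs2) = psD fs2 * (2 - 12 * psD fe + 18 * psD fE) := by
  have key : 18 * (psD fs2 * psD fE) - 12 * (psD fs2 * psD fe) = DD (psD fs2) - 2 * psD fs2 := by
    ext n
    have e2 : ∀ f : PowerSeries ℤ, coeff n (2 * f) = 2 * coeff n f := fun f => by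
      rw [show (2 : PowerSeries ℤ) = PowerSeries.C 2 by simp, coeff_C_mul]
    have e18 : ∀ f : PowerSeries ℤ, coeff n (18 * f) = 18 * coeff n f := fun f => by
      rw [show (18 : PowerSeries ℤ) = PowerSeries.C 18 by simp, coeff_C_mul]
    have e12 : ∀ f : PowerSeries ℤ, coeff n (12 * f) = 12 * coeff n f := fun f => by
      rw [show (12 : PowerSeries ℤ) = PowerSeries.C 12 by simp, coeff_C_mul]
    rw [map_sub, map_sub, e18, e12, e2, coeff_DD, coeff_psD_mul, coeff_psD_mul, coeff_fs2,
      ← QS_mul, ← QS_mul, ← QS_sub]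
    have : QS n (fun a B c d => 18 * (fs2 a.toNat d.toNat * fE c.toNat B.toNat)
        - 12 * (fs2 a.toNat d.toNat * fe c.toNat B.toNat)) = QS n (eF F2) := by
      refine QS_congr ?_
      intro a B c d ha hB hc hd _
      simp only [fe, fs2, fE, cast_toNat ha, cast_toNat hB, cast_toNat hc, cast_toNat hd,
        Int.toNat_of_nonneg ha.le, Int.toNat_of_nonneg hB.le, Int.toNat_of_nonneg hc.le,
        Int.toNat_of_nonneg hd.le, eF, F2, ev_uBd, mul_comm (c : ZMod 3) (B : ZMod 3)]
      rcases zmod3_cases ((a : ZMod 3) * d) with h | h | h <;>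
        simp only [h, z01, z02, z12, z21, true_and, false_and, if_true, if_false] <;>
        split_ifs <;> first | ring1 | (exfalso; tauto)
    rw [this]
    split_ifs with h
    · rw [J2 n (mod_of_cast (r := 2) (by norm_num) h)]; ring
    · rw [QS_eF_zero n F2 2 (by decide +kernel) (by exact_mod_cast h)]; simp
  linear_combination -key

theorem PS3 : DD (psD fs1) = psD fs1 * (1 - 12 * psD fe + 6 * psD fE) + 3 * (psD fs2 * psD fs2) := by
  have key : 6 * (psD fs1 * psD fE) - 12 * (psD fs1 * psD fe) + 3 * (psD fs2 * psD fs2)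
      = DD (psD fs1) - psD fs1 := by
    ext n
    have e3 : ∀ f : PowerSeries ℤ, coeff n (3 * f) = 3 * coeff n f := fun f => by
      rw [show (3 : PowerSeries ℤ) = PowerSeries.C 3 by simp, coeff_C_mul]
    have e6 : ∀ f : PowerSeries ℤ, coeff n (6 * f) = 6 * coeff n f := fun f => by
      rw [show (6 : PowerSeries ℤ) = PowerSeries.C 6 by simp, coeff_C_mul]
    have e12 : ∀ f : PowerSeries ℤ, coeff n (12 * f) = 12 * coeff n f := fun f => by
      rw [show (12 : PowerSeries ℤ) = PowerSeries.C 12 by simp, coeff_C_mul]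
    rw [map_add, map_sub, map_sub, e6, e12, e3, coeff_DD, coeff_psD_mul, coeff_psD_mul,
      coeff_psD_mul, coeff_fs1, ← QS_mul, ← QS_mul, ← QS_mul, ← QS_sub, ← QS_add]
    have : QS n (fun a B c d => 6 * (fs1 a.toNat d.toNat * fE c.toNat B.toNat)
        - 12 * (fs1 a.toNat d.toNat * fe c.toNat B.toNat)
        + 3 * (fs2 a.toNat d.toNat * fs2 c.toNat B.toNat)) = QS n (eF F3) := by
      refine QS_congr ?_
      intro a B c d ha hB hc hd _
      simp only [fe, fs1, fs2, fE, cast_toNat ha, cast_toNat hB, cast_toNat hc, cast_toNat hd,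
        Int.toNat_of_nonneg ha.le, Int.toNat_of_nonneg hB.le, Int.toNat_of_nonneg hc.le,
        Int.toNat_of_nonneg hd.le, eF, F3, ev_uBd, mul_comm (c : ZMod 3) (B : ZMod 3)]
      rcases zmod3_cases ((a : ZMod 3) * d) with h | h | h <;>
        simp only [h, z01, z02, z12, z21, true_and, false_and, if_true, if_false] <;>
        split_ifs <;> first | ring1 | (exfalso; tauto)
    rw [this]
    split_ifs with h
    · rw [J3 n (mod_of_cast (r := 1) (by norm_num) (by exact_mod_cast h))]; ring
    · rw [QS_eF_zero n F3 1 (by decide +kernel) (by exact_mod_cast h)]; simp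
  linear_combination -key

/-- the cusp form -/
noncomputable def GG : PowerSeries ℤ := psD fs1 * (1 + 12 * psD fE) - 3 * (psD fs2 * psD fs2)

lemma coeff_GG (n : ℕ) (h3 : n % 3 = 1) : coeff n GG = sig n + QS n (eF FG) := by
  have : GG = psD fs1 + (12 * (psD fs1 * psD fE) - 3 * (psD fs2 * psD fs2)) := by
    rw [GG]; ring
  have e3 : ∀ f : PowerSeries ℤ, coeff n (3 * f) = 3 * coeff n f := fun f => by
    rw [show (3 : PowerSeries ℤ) = PowerSeries.C 3 by simp, coeff_C_mul]
  have e12 : ∀ f : PowerSeries ℤ, coeff n (12 * f) = 12 * coeff n f := fun f => by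
    rw [show (12 : PowerSeries ℤ) = PowerSeries.C 12 by simp, coeff_C_mul]
  rw [this, map_add, map_sub, e3, e12, coeff_fs1, coeff_psD_mul, coeff_psD_mul, ← QS_mul, ← QS_mul,
    ← QS_sub, if_pos (by have := cast_res h3; exact_mod_cast this)]
  congr 1
  refine QS_congr ?_
  intro a B c d ha hB hc hd _
  simp only [fs1, fs2, fE, cast_toNat ha, cast_toNat hB, cast_toNat hc, cast_toNat hd,
    Int.toNat_of_nonneg ha.le, Int.toNat_of_nonneg hB.le, Int.toNat_of_nonneg hc.le,
    Int.toNat_of_nonneg hd.le, eF, FG, ev_uBd, mul_comm (c : ZMod 3) (B : ZMod 3)]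
  rcases zmod3_cases ((a : ZMod 3) * d) with h | h | h <;>
    simp only [h, z01, z02, z12, z21, true_and, false_and, if_true, if_false] <;>
    split_ifs <;> first | ring1 | (exfalso; tauto)

lemma fs2_ne : psD fs2 ≠ 0 := by
  intro h
  have := congrArg (coeff 2) h
  rw [coeff_fs2, if_pos (by rfl)] at this
  simp [sig, DS, show Nat.divisorsAntidiagonal 2 = {(1, 2), (2, 1)} from rfl] at this

theorem GG_ode : DD GG = GG * (1 - 24 * psD fe) := by
  have h1 := PS1
  have h2 := PS2
  have h3 := PS3
  have C3 : ∀ f, DD (3 * f) = 3 * DD f := fun f => by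
    rw [show (3 : PowerSeries ℤ) = PowerSeries.C 3 by simp, DD_C]
  have h4 := congrArg DD PS1
  rw [C3, DD_mul, DD_mul, h3, h2] at h4
  set s1 := psD fs1
  set s2 := psD fs2
  set e := psD fe
  set E := psD fE
  have h5 : DD (1 + 12 * E) = (1 + 12 * E) * (- 12 * e - 6 * E) + 18 * (s1 * s2) := by
    apply mul_left_cancel₀ fs2_ne
    linear_combination -h4 + (2 - 24 * e + 12 * E) * h1
  rw [GG, DD_sub, C3, DD_mul, DD_mul, h3, h5, h2]
  linear_combination 6 * s2 * h1
end

section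
open PowerSeries

/-- `∑_{j≥1} X^{3kj}` -/
noncomputable def LL (k : ℕ) : PowerSeries ℤ :=
  PowerSeries.mk (fun n => if n ≠ 0 ∧ 3 * k ∣ n then 1 else 0)

lemma LL_mul (k : ℕ) (hk : 0 < k) : (1 - X ^ (3 * k)) * LL k = X ^ (3 * k) := by
  ext n
  rw [sub_mul, one_mul, map_sub, coeff_X_pow_mul', coeff_X_pow]
  simp only [LL, coeff_mk]
  have h3 : 0 < 3 * k := by omega
  by_cases h : 3 * k ≤ n
  · rw [if_pos h]
    by_cases h' : n = 3 * k
    · subst h'; simp; omega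
    · have : (n - 3 * k ≠ 0 ∧ 3 * k ∣ n - 3 * k) ↔ (n ≠ 0 ∧ 3 * k ∣ n) := by
        constructor
        · rintro ⟨_, h2⟩
          exact ⟨by omega, (Nat.dvd_sub_iff_left h dvd_rfl).1 h2⟩
        · rintro ⟨_, h2⟩
          exact ⟨by omega, (Nat.dvd_sub_iff_left h dvd_rfl).2 h2⟩
      simp only [this, h', if_false, sub_self]
  · have k1 : ¬ (n ≠ 0 ∧ 3 * k ∣ n) := by
      rintro ⟨h1, h2⟩; exact h (Nat.le_of_dvd (by omega) h2)
    have k2 : ¬ (n = 3 * k) := by omega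
    rw [if_neg k1, if_neg h, if_neg k2]; rfl

lemma DD_pow (f : PowerSeries ℤ) (m : ℕ) : DD (f ^ (m + 1)) = (m + 1 : ℕ) * f ^ m * DD f := by
  induction m with
  | zero => simp
  | succ m ih => rw [pow_succ, DD_mul, ih]; push_cast; ring

lemma DD_factor (k : ℕ) (hk : 0 < k) :
    DD ((1 - X ^ (3 * k)) ^ 8) = (1 - X ^ (3 * k)) ^ 8 * (- ((24 : PowerSeries ℤ) * (k : PowerSeries ℤ) * LL k)) := by
  have h1 : DD (1 - X ^ (3 * k)) = - (3 * (k : PowerSeries ℤ) * X ^ (3 * k)) := by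
    ext n
    rw [coeff_DD, map_sub, coeff_X_pow, coeff_one, map_neg,
      show (3 * (k : PowerSeries ℤ)) = PowerSeries.C (3 * k : ℤ) by simp, coeff_C_mul, coeff_X_pow]
    split_ifs with h1 h2 h2 <;> simp_all
  rw [DD_pow _ 7, h1]
  have := LL_mul k hk
  linear_combination 24 * (k : PowerSeries ℤ) * (1 - X ^ (3 * k)) ^ 7 * this

noncomputable def PP (m : ℕ) : PowerSeries ℤ := X * ∏ k ∈ Finset.Icc 1 m, (1 - X ^ (3 * k)) ^ 8

lemma DD_PP (m : ℕ) : DD (PP m) = PP m * (1 - 24 * ∑ k ∈ Finset.Icc 1 m, (k : PowerSeries ℤ) * LL k) := by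
  induction m with
  | zero =>
    simp only [PP, Finset.Icc_self, Finset.Icc_eq_empty_of_lt (show 0 < 1 by norm_num),
      Finset.prod_empty, Finset.sum_empty, mul_one, mul_zero, sub_zero]
    simp [DD]
  | succ m ih =>
    have : PP (m + 1) = PP m * (1 - X ^ (3 * (m + 1))) ^ 8 := by
      rw [PP, PP, Finset.prod_Icc_succ_top (by omega), mul_assoc]
    rw [this, DD_mul, ih, DD_factor _ (by omega), Finset.sum_Icc_succ_top (by omega)]
    push_cast; ring

lemma coeff_sumLL (m j : ℕ) (hj : j ≤ m) :
    coeff j (∑ k ∈ Finset.Icc 1 m, (k : PowerSeries ℤ) * LL k) = coeff j (psD fe) := by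
  rw [map_sum, psD, coeff_mk, DS]
  have h1 : ∀ k : ℕ, coeff j ((k : PowerSeries ℤ) * LL k) = if j ≠ 0 ∧ 3 * k ∣ j then (k : ℤ) else 0 := by
    intro k
    rw [show (k : PowerSeries ℤ) = PowerSeries.C (k : ℤ) by simp, coeff_C_mul, LL, coeff_mk]
    split_ifs <;> simp
  simp only [h1]
  rw [← Finset.sum_filter]
  simp only [fe]
  rw [← Finset.sum_filter]
  refine Finset.sum_bij' (fun k _ => (j / k, k)) (fun x _ => x.2) ?_ ?_ ?_ ?_ ?_
  · intro k hk
    simp only [Finset.mem_filter, Finset.mem_Icc] at hk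
    obtain ⟨⟨hk1, h2⟩, h3, h4⟩ := hk
    obtain ⟨q, rfl⟩ := h4
    simp only [Finset.mem_filter, Nat.mem_divisorsAntidiagonal]
    have : 3 * k * q / k = 3 * q := by
      rw [show 3 * k * q = k * (3 * q) by ring, Nat.mul_div_cancel_left _ hk1]
    rw [this]
    refine ⟨⟨by ring, h3⟩, ?_⟩
    push_cast
    rw [show (3 : ZMod 3) = 0 from rfl, zero_mul]
  · rintro ⟨c, B⟩ hx
    simp only [Finset.mem_filter, Nat.mem_divisorsAntidiagonal] at hx
    obtain ⟨⟨h1, h2⟩, h3⟩ := hx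
    have h3' : 3 ∣ c := by
      have := (ZMod.natCast_eq_zero_iff c 3).1 h3
      exact this
    obtain ⟨q, rfl⟩ := h3'
    have hB : 0 < B := Nat.pos_of_ne_zero (by rintro rfl; simp at h1; omega)
    have hq : 0 < q := Nat.pos_of_ne_zero (by rintro rfl; simp at h1; omega)
    simp only [Finset.mem_filter, Finset.mem_Icc]
    refine ⟨⟨hB, ?_⟩, h2, ⟨q, by rw [← h1]; ring⟩⟩
    nlinarith
  · intro k hk; rfl
  · rintro ⟨c, B⟩ hx
    simp only [Finset.mem_filter, Nat.mem_divisorsAntidiagonal] at hx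
    obtain ⟨⟨h1, h2⟩, h3⟩ := hx
    have hB : 0 < B := Nat.pos_of_ne_zero (by rintro rfl; simp at h1; omega)
    rw [← h1, Nat.mul_div_cancel _ hB]
  · intro k hk; rfl

lemma ode_rec (f g : PowerSeries ℤ) (hf : DD f = f * (1 - 24 * g)) (n : ℕ) :
    ((n : ℤ) - 1) * coeff n f
      = - 24 * ∑ x ∈ Finset.HasAntidiagonal.antidiagonal n, coeff x.1 f * coeff x.2 g := by
  have := congrArg (coeff n) hf
  rw [coeff_DD, mul_sub, mul_one, map_sub, show f * (24 * g) = PowerSeries.C 24 * (f * g) by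
    rw [show (PowerSeries.C (24 : ℤ)) = (24 : PowerSeries ℤ) by simp]; ring, coeff_C_mul, coeff_mul] at this
  linarith

theorem etaCoeff_eq (n : ℕ) (h3 : n % 3 = 1) : etaCoeff n = sig n + QS n (eF FG) := by
  rw [← coeff_GG n h3]
  have e1 : etaCoeff n = coeff n (PP n) := by
    rw [etaCoeff, PP, ← Polynomial.coeff_coe]
    congr 1
    rw [Polynomial.coe_mul, Polynomial.coe_X]
    congr 1
    rw [← Polynomial.coeToPowerSeries.ringHom_apply, map_prod]
    refine Finset.prod_congr rfl ?_
    intros; simp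
  rw [e1]
  have main : ∀ j, j ≤ n → coeff j (PP n) = coeff j GG := by
    intro j
    induction j using Nat.strong_induction_on with
    | _ j ih =>
    intro hj
    by_cases h1 : j = 1
    · subst h1
      rw [coeff_GG 1 rfl]
      have h2 : QS ((1 : ℕ) : ℤ) (eF FG) = 0 := by
        rw [← Finset.sum_const_zero (s := quads (1 : ℕ))]
        refine QS_congr (G := fun _ _ _ _ => (0 : ℤ)) ?_
        intro a B c d h1 h2 h3 h4 h5
        push_cast at h5
        nlinarith [mul_pos h1 h4, mul_pos h2 h3]
      rw [h2]
      rw [PP, show (1 : ℕ) = 0 + 1 from rfl, coeff_succ_X_mul, coeff_zero_eq_constantCoeff, map_prod]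
      rw [Finset.prod_eq_one]
      · simp [sig, DS]
      · intro k hk
        rw [Finset.mem_Icc] at hk
        have : 3 * k ≠ 0 := by omega
        simp [this]
    · have r1 := ode_rec _ _ (DD_PP n) j
      have r2 := ode_rec _ _ GG_ode j
      have : ∑ x ∈ Finset.HasAntidiagonal.antidiagonal j, coeff x.1 (PP n)
            * coeff x.2 (∑ k ∈ Finset.Icc 1 n, (k : PowerSeries ℤ) * LL k)
          = ∑ x ∈ Finset.HasAntidiagonal.antidiagonal j, coeff x.1 GG * coeff x.2 (psD fe) := by
        refine Finset.sum_congr rfl ?_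
        rintro ⟨x, y⟩ hx
        rw [Finset.HasAntidiagonal.mem_antidiagonal] at hx
        dsimp only at hx ⊢
        rw [coeff_sumLL n y (by omega)]
        rcases Nat.eq_zero_or_pos y with h0 | h0
        · subst h0
          have : coeff 0 (psD fe) = 0 := by simp [psD, DS]
          rw [this, mul_zero, mul_zero]
        · rw [ih x (by omega) (by omega)]
      rw [this, ← r2] at r1
      exact mul_left_cancel₀ (by omega) r1
  exact main n le_rfl
end

section
/-- six times the weight -/
def w6 (b A C : ℤ) : ℤ :=
  if b < A ∧ b < C ∧ -b < A ∧ -b < C then 6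
  else if b ≤ A ∧ b ≤ C ∧ -b ≤ A ∧ -b ≤ C then (if A = C then 2 else 3) else 0

/-- twice the Heaviside function -/
def hh (x : ℤ) : ℤ := if 0 < x then 2 else if x = 0 then 1 else 0

lemma hh_pos {x : ℤ} (h : 0 < x) : hh x = 2 := by simp [hh, h]
lemma hh_zero {x : ℤ} (h : x = 0) : hh x = 1 := by simp [hh, h]
lemma hh_neg {x : ℤ} (h : x < 0) : hh x = 0 := by simp [hh, h.ne, not_lt.2 h.le]

def X2 (a B c d : ℤ) : ℤ :=
  (if d < B then 2 else 0) + (if a < B ∧ a < c then 4 else 0) - (if c < a then 2 else 0)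
    - (if a + B + c < d then 4 else 0)

def r1 (a B c d : ℤ) : ℤ :=
  (if c < a then hh (d - a + c) else 0) - (if d - a < B + c then hh (d - a - c) else 0)

def r2 (a B c d : ℤ) : ℤ :=
  hh (B - c) * hh (B + (d - a)) * (if c < a then hh (d - a + c) else 0)
    - hh (B - c) * hh (d - a - c) * hh (B - (d - a))

def F2w (a B c d : ℤ) : ℤ :=
  X2 a B c d - w6 (a - d) B c + 2 * r1 a B c d + r2 a B c d
    - (if d = a + B + c then 4 else 0) + (if a = c then 2 + 4 * hh (B - c) else 0)

lemma hh_cases (x : ℤ) : (0 < x ∧ hh x = 2) ∨ (x = 0 ∧ hh x = 1) ∨ (x < 0 ∧ hh x = 0) := by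
  unfold hh; split_ifs <;> omega

lemma ite_cases (p : Prop) [Decidable p] (x y : ℤ) :
    (p ∧ (if p then x else y) = x) ∨ (¬ p ∧ (if p then x else y) = y) := by
  by_cases h : p <;> simp [h]

set_option maxHeartbeats 4000000 in
lemma F2w_aux (a B c d : ℤ) (ha : 0 < a) (hB : 0 < B) (hc : 0 < c) (hd : 0 < d)
    (h1 : a ≤ d) (h2 : B ≤ c) :
    F2w a B c d + F2w d B c a + F2w a c B d + F2w d c B a = 0 := by
  unfold F2w X2 r1 r2
  rcases h1.eq_or_lt with hD | hD <;> rcases h2.eq_or_lt with he | he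
  · subst hD; subst he
    simp (discharger := omega) only [hh_pos, hh_zero, hh_neg, w6, if_pos, if_neg, if_true, mul_zero, zero_mul, sub_zero] <;>
    omega
  · subst hD
    simp (discharger := omega) only [hh_pos, hh_zero, hh_neg, w6, if_pos, if_neg, if_true, mul_zero, zero_mul, sub_zero] <;>
    omega
  · subst he
    rcases lt_trichotomy (d - a) B with h | h | h <;>
    (try rcases lt_trichotomy (d - a) (2 * B) with h2 | h2 | h2) <;> (try omega) <;>
    simp (discharger := omega) only [hh_pos, hh_zero, hh_neg, w6, if_pos, if_neg, if_true, mul_zero, zero_mul, sub_zero] <;>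
    omega
  · rcases lt_trichotomy (d - a) B with h | h | h <;>
    rcases lt_trichotomy (d - a) c with h1 | h1 | h1 <;> (try omega) <;>
    rcases lt_trichotomy (d - a) (B + c) with h2 | h2 | h2 <;> (try omega) <;>
    simp (discharger := omega) only [hh_pos, hh_zero, hh_neg, w6, if_pos, if_neg, if_true, mul_zero, zero_mul, sub_zero] <;>
    omega

lemma F2w_sym (a B c d : ℤ) (ha : 0 < a) (hB : 0 < B) (hc : 0 < c) (hd : 0 < d) :
    F2w a B c d + F2w d B c a + F2w a c B d + F2w d c B a = 0 := by
  rcases le_total a d with h1 | h1 <;> rcases le_total B c with h2 | h2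
  · exact F2w_aux a B c d ha hB hc hd h1 h2
  · have := F2w_aux a c B d ha hc hB hd h1 h2; linarith
  · have := F2w_aux d B c a hd hB hc ha h1 h2; linarith
  · have := F2w_aux d c B a hd hc hB ha h1 h2; linarith
end

section
noncomputable def GS (g : ℤ → ℝ) (n : ℤ) (f : ℤ → ℤ → ℤ → ℤ → ℤ) : ℝ :=
  QS n (fun a B c d => g (a + d) * (f a B c d : ℝ))

section
variable (g : ℤ → ℝ) (n : ℤ)

lemma GS_congr {f f' : ℤ → ℤ → ℤ → ℤ → ℤ}
    (h : ∀ a B c d, 0 < a → 0 < B → 0 < c → 0 < d → a * d + B * c = n → f a B c d = f' a B c d) :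
    GS g n f = GS g n f' :=
  QS_congr (fun a B c d h1 h2 h3 h4 h5 => by rw [h a B c d h1 h2 h3 h4 h5])

lemma GS_add (f f' : ℤ → ℤ → ℤ → ℤ → ℤ) :
    GS g n (fun a B c d => f a B c d + f' a B c d) = GS g n f + GS g n f' := by
  unfold GS; rw [← QS_add]; exact QS_congr (fun a B c d _ _ _ _ _ => by push_cast; ring)

lemma GS_sub (f f' : ℤ → ℤ → ℤ → ℤ → ℤ) :
    GS g n (fun a B c d => f a B c d - f' a B c d) = GS g n f - GS g n f' := by
  unfold GS; rw [← QS_sub]; exact QS_congr (fun a B c d _ _ _ _ _ => by push_cast; ring)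

lemma GS_mul (k : ℤ) (f : ℤ → ℤ → ℤ → ℤ → ℤ) :
    GS g n (fun a B c d => k * f a B c d) = k * GS g n f := by
  unfold GS; rw [← QS_mul]; exact QS_congr (fun a B c d _ _ _ _ _ => by push_cast; ring)

lemma GS_s1 (f : ℤ → ℤ → ℤ → ℤ → ℤ) : GS g n (fun a B c d => f d B c a) = GS g n f := by
  unfold GS
  rw [← QS_sym1 n (fun a B c d => g (a + d) * (f a B c d : ℝ))]
  exact QS_congr (fun a B c d _ _ _ _ _ => by rw [add_comm])

lemma GS_s2 (f : ℤ → ℤ → ℤ → ℤ → ℤ) : GS g n (fun a B c d => f a c B d) = GS g n f := by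
  unfold GS
  rw [← QS_sym2 n (fun a B c d => g (a + d) * (f a B c d : ℝ))]

/-- the shift -/
lemma GS_shift (f f' : ℤ → ℤ → ℤ → ℤ → ℤ)
    (h1 : ∀ a B c d, 0 < a → 0 < B → 0 < c → 0 < d → f a B c d ≠ 0 → c < a ∧ a - d < B + c)
    (h2 : ∀ a B c d, 0 < a → 0 < B → 0 < c → 0 < d → f' a B c d ≠ 0 → c < d ∧ d - a < B + c)
    (h : ∀ a B c d, 0 < a → 0 < B → 0 < c → c < d → d - a < B + c →
      f' a B c d = f (a + c) (B + c - (d - a)) c (d - c)) :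
    GS g n f = GS g n f' := by
  have := QS_bij n (P := fun a B c d => c < d ∧ d - a < B + c) (Q := fun a B c d => c < a ∧ a - d < B + c)
    (F := fun a B c d => g (a + d) * (f' a B c d : ℝ)) (G := fun a B c d => g (a + d) * (f a B c d : ℝ))
    (fun a B c d => (a + c, B + c - (d - a), c, d - c)) (fun a B c d => (a - c, B + c + (d - a), c, d + c))
    (by intros; dsimp only at *; omega) (by intros; dsimp only at *; omega)
    (by intros; dsimp only; ext <;> dsimp only <;> ring) (by intros; dsimp only; ext <;> dsimp only <;> ring)
    (by intros; dsimp only; ring)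
    (by
      intro a B c d ha hB hc hd hn hP
      dsimp only at *
      rw [h a B c d ha hB hc hP.1 hP.2, show a + c + (d - c) = a + d by ring])
  have e1 : GS g n f = QS n (fun a B c d => if c < a ∧ a - d < B + c then g (a + d) * (f a B c d : ℝ) else 0) := by
    refine QS_congr (fun a B c d ha hB hc hd _ => ?_)
    by_cases hf : f a B c d = 0
    · simp [hf]
    · rw [if_pos (h1 a B c d ha hB hc hd hf)]
  have e2 : GS g n f' = QS n (fun a B c d => if c < d ∧ d - a < B + c then g (a + d) * (f' a B c d : ℝ) else 0) := by
    refine QS_congr (fun a B c d ha hB hc hd _ => ?_)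
    by_cases hf : f' a B c d = 0
    · simp [hf]
    · rw [if_pos (h2 a B c d ha hB hc hd hf)]
  rw [e1, e2]
  convert this.symm

lemma hh_ne {x : ℤ} (h : hh x ≠ 0) : 0 ≤ x := by
  by_contra hx; exact h (hh_neg (by omega))

lemma GS_r1 : GS g n r1 = 0 := by
  unfold r1
  rw [GS_sub, sub_eq_zero]
  refine GS_shift g n _ _ ?_ ?_ ?_
  · intro a B c d ha hB hc hd hf
    by_cases h : c < a
    · rw [if_pos h] at hf; have := hh_ne hf; omega
    · simp [h] at hf
  · intro a B c d ha hB hc hd hf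
    by_cases h : d - a < B + c
    · rw [if_pos h] at hf; have := hh_ne hf; omega
    · simp [h] at hf
  · intro a B c d ha hB hc hd h
    rw [if_pos h, if_pos (by omega)]; congr 1; ring

lemma GS_r2 : GS g n r2 = 0 := by
  unfold r2
  rw [GS_sub, sub_eq_zero]
  refine GS_shift g n _ _ ?_ ?_ ?_
  · intro a B c d ha hB hc hd hf
    by_cases h : c < a
    · rw [if_pos h] at hf; have := hh_ne (right_ne_zero_of_mul hf); omega
    · simp [h] at hf
  · intro a B c d ha hB hc hd hf
    have h1 := hh_ne (right_ne_zero_of_mul hf)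
    have h2 := hh_ne (right_ne_zero_of_mul (left_ne_zero_of_mul hf))
    omega
  · intro a B c d ha hB hc hd h
    rw [if_pos (show c < a + c by omega), show B + c - (d - a) - c = B - (d - a) by ring,
      show B + c - (d - a) + (d - c - (a + c)) = B - c by ring, show d - c - (a + c) + c = d - a - c by ring]
    ring

lemma GS_X2 : GS g n X2 = GS g n (fun a B c d => w6 (a - d) B c)
    + GS g n (fun a B c d => if d = a + B + c then 4 else 0)
    - GS g n (fun a B c d => if a = c then 2 + 4 * hh (B - c) else 0) := by
  have h : GS g n F2w = 0 := by
    have : GS g n (fun a B c d => F2w a B c d + F2w d B c a + F2w a c B d + F2w d c B a) = 0 := by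
      rw [GS_congr g n (f' := fun _ _ _ _ => 0) (fun a B c d h1 h2 h3 h4 _ => F2w_sym a B c d h1 h2 h3 h4)]
      simp [GS, QS]
    rw [GS_add, GS_add, GS_add, GS_s1, GS_s2, GS_s1 g n (fun a B c d => F2w a c B d), GS_s2] at this
    linarith
  have e : GS g n F2w = GS g n X2 - GS g n (fun a B c d => w6 (a - d) B c) + 2 * GS g n r1 + GS g n r2
     - GS g n (fun a B c d => if d = a + B + c then 4 else 0)
     + GS g n (fun a B c d => if a = c then 2 + 4 * hh (B - c) else 0) := by
    unfold F2w
    rw [GS_add, GS_sub, GS_add, GS_add, GS_sub, GS_mul]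
    norm_num
  rw [GS_r1, GS_r2] at e
  linarith

end
end

section
set_option linter.unusedVariables false
set_option linter.unusedSimpArgs false

section
variable (g : ℤ → ℝ) (n : ℤ)

/-- convenient form of `QS_bij` for an integrand of the form `g (linear)` -/
lemma GB {P Q : ℤ → ℤ → ℤ → ℤ → Prop}
    [∀ a B c d, Decidable (P a B c d)] [∀ a B c d, Decidable (Q a B c d)]
    {u v : ℤ → ℤ → ℤ → ℤ → ℤ}
    (i j : ℤ → ℤ → ℤ → ℤ → ℤ × ℤ × ℤ × ℤ)
    (hi : ∀ a B c d, 0 < a → 0 < B → 0 < c → 0 < d → P a B c d →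
      (0 < (i a B c d).1 ∧ 0 < (i a B c d).2.1 ∧ 0 < (i a B c d).2.2.1 ∧ 0 < (i a B c d).2.2.2) ∧
      Q (i a B c d).1 (i a B c d).2.1 (i a B c d).2.2.1 (i a B c d).2.2.2)
    (hj : ∀ a B c d, 0 < a → 0 < B → 0 < c → 0 < d → Q a B c d →
      (0 < (j a B c d).1 ∧ 0 < (j a B c d).2.1 ∧ 0 < (j a B c d).2.2.1 ∧ 0 < (j a B c d).2.2.2) ∧
      P (j a B c d).1 (j a B c d).2.1 (j a B c d).2.2.1 (j a B c d).2.2.2)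
    (hij : ∀ a B c d, j (i a B c d).1 (i a B c d).2.1 (i a B c d).2.2.1 (i a B c d).2.2.2
      = (a, B, c, d))
    (hji : ∀ a B c d, i (j a B c d).1 (j a B c d).2.1 (j a B c d).2.2.1 (j a B c d).2.2.2
      = (a, B, c, d))
    (hn : ∀ a B c d, (i a B c d).1 * (i a B c d).2.2.2 + (i a B c d).2.1 * (i a B c d).2.2.1
      = a * d + B * c)
    (hF : ∀ a B c d, u a B c d = v (i a B c d).1 (i a B c d).2.1 (i a B c d).2.2.1 (i a B c d).2.2.2) :
    QS n (fun a B c d => if P a B c d then g (u a B c d) else 0)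
      = QS n (fun a B c d => if Q a B c d then g (v a B c d) else 0) := by
  have := QS_bij n (P := P) (Q := Q) (F := fun a B c d => g (u a B c d)) (G := fun a B c d => g (v a B c d))
    i j hi hj hij hji hn (by intros; rw [hF])
  convert this

lemma U1 : QS n (fun a B c d => if c < a then g (a + d - c) else 0)
    = QS n (fun a B c d => if d < B then g (a + d) else 0) :=
  GB g n (fun a B c d => (a - c, B + d, c, d)) (fun a B c d => (a + c, B - d, c, d))
    (by intros; dsimp only at *; omega) (by intros; dsimp only at *; omega)
    (by intros; dsimp only; ext <;> dsimp only <;> ring) (by intros; dsimp only; ext <;> dsimp only <;> ring)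
    (by intros; dsimp only; ring) (by intros; dsimp only; ring)

lemma U3 : QS n (fun a B c d => if a < c ∧ c < d then g (a + d - c) else 0)
    = QS n (fun a B c d => if a < B ∧ a < c then g (a + d) else 0) :=
  GB g n (fun a B c d => (a, B + a, c, d - c)) (fun a B c d => (a, B - a, c, d + c))
    (by intros; dsimp only at *; omega) (by intros; dsimp only at *; omega)
    (by intros; dsimp only; ext <;> dsimp only <;> ring) (by intros; dsimp only; ext <;> dsimp only <;> ring)
    (by intros; dsimp only; ring) (by intros; dsimp only; ring)

lemma U4 : QS n (fun a B c d => if a < c ∧ c = d then g a else 0)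
    = QS n (fun a B c d => if d < a ∧ a = c then g d else 0) :=
  GB g n (fun a B c d => (d, B, c, a)) (fun a B c d => (d, B, c, a))
    (by intros; dsimp only at *; omega) (by intros; dsimp only at *; omega)
    (by intros; rfl) (by intros; rfl)
    (by intros; dsimp only; ring) (by intros; rfl)

lemma U7 : QS n (fun a B c d => if a + d + B < c then g (c - a - d) else 0)
    = QS n (fun a B c d => if a < B ∧ a < c then g (a + d) else 0) :=
  GB g n (fun a B c d => (B, a + B, d + B, c - a - d - B)) (fun a B c d => (B - a, a, d + B + c - a, c - a))
    (by intros; dsimp only at *; omega) (by intros; dsimp only at *; omega)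
    (by intros; dsimp only; ext <;> dsimp only <;> ring) (by intros; dsimp only; ext <;> dsimp only <;> ring)
    (by intros; dsimp only; ring) (by intros; dsimp only; ring)

lemma V1 : QS n (fun a B c d => if d < B then g (a + d + c) else 0)
    = QS n (fun a B c d => if c < a then g (a + d) else 0) :=
  GB g n (fun a B c d => (a + c, B - d, c, d)) (fun a B c d => (a - c, B + d, c, d))
    (by intros; dsimp only at *; omega) (by intros; dsimp only at *; omega)
    (by intros; dsimp only; ext <;> dsimp only <;> ring) (by intros; dsimp only; ext <;> dsimp only <;> ring)
    (by intros; dsimp only; ring) (by intros; dsimp only; ring)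

lemma V2 : QS n (fun a B c d => if B = d then g (a + d + c) else 0)
    = QS n (fun a B c d => if a = c then g (a + B + d) else 0) :=
  GB g n (fun a B c d => (d, c, B, a)) (fun a B c d => (d, c, B, a))
    (by intros; dsimp only at *; omega) (by intros; dsimp only at *; omega)
    (by intros; rfl) (by intros; rfl)
    (by intros; dsimp only; ring) (by intros; dsimp only; ring)

lemma V3 : QS n (fun a B c d => if B < d ∧ a < B then g (a + d + c) else 0)
    = QS n (fun a B c d => if a + B + c < d then g (a + d) else 0) :=
  GB g n (fun a B c d => (a, B - a, c, d + c)) (fun a B c d => (a, B + a, c, d - c))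
    (by intros; dsimp only at *; omega) (by intros; dsimp only at *; omega)
    (by intros; dsimp only; ext <;> dsimp only <;> ring) (by intros; dsimp only; ext <;> dsimp only <;> ring)
    (by intros; dsimp only; ring) (by intros; dsimp only; ring)

lemma V4 : QS n (fun a B c d => if B < d ∧ a = B then g (a + d + c) else 0)
    = QS n (fun a B c d => if a < d ∧ a = c then g (a + B + d) else 0) :=
  GB g n (fun a B c d => (a, c, B, d)) (fun a B c d => (a, c, B, d))
    (by intros; dsimp only at *; omega) (by intros; dsimp only at *; omega)
    (by intros; rfl) (by intros; rfl)
    (by intros; dsimp only; ring) (by intros; dsimp only; ring)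

lemma V5 : QS n (fun a B c d => if B < d ∧ B < a then g (a + d + c) else 0)
    = QS n (fun a B c d => if a + B + c < d then g (a + d) else 0) :=
  GB g n (fun a B c d => (B, a - B, d - B, c + a + d - B)) (fun a B c d => (B + a, a, d - B - c - a, c + a))
    (by intros; dsimp only at *; omega) (by intros; dsimp only at *; omega)
    (by intros; dsimp only; ext <;> dsimp only <;> ring) (by intros; dsimp only; ext <;> dsimp only <;> ring)
    (by intros; dsimp only; ring) (by intros; dsimp only; ring)

/-- the sum over the region Ω -/
noncomputable def Om (f : ℤ → ℤ → ℤ → ℤ → ℤ) : ℝ :=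
  QS n (fun a B c d => if a < c ∧ d < c ∧ c < a + d + B then g (a + d - c) * (f a B c d : ℝ) else 0)

lemma Om_rot (f : ℤ → ℤ → ℤ → ℤ → ℤ) :
    Om g n (fun a B c d => f d (c - d) (B + d) (a + B + d - c)) = Om g n f := by
  have := QS_bij n (P := fun a B c d => a < c ∧ d < c ∧ c < a + d + B) (Q := fun a B c d => a < c ∧ d < c ∧ c < a + d + B)
    (F := fun a B c d => g (a + d - c) * (f d (c - d) (B + d) (a + B + d - c) : ℝ))
    (G := fun a B c d => g (a + d - c) * (f a B c d : ℝ))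
    (fun a B c d => (d, c - d, B + d, a + B + d - c)) (fun a B c d => (d - c + a + B, c - a, B + a, a))
    (by intros; dsimp only at *; omega) (by intros; dsimp only at *; omega)
    (by intros; dsimp only; ext <;> dsimp only <;> ring) (by intros; dsimp only; ext <;> dsimp only <;> ring)
    (by intros; dsimp only; ring) (by intros; dsimp only; congr 2; ring)
  unfold Om
  convert this

lemma Om_w : Om g n (fun a B c d => if 0 ≤ B + d - c ∧ 0 ≤ d - a then
      (if 0 < B + d - c ∧ 0 < d - a then 6 else if B + d - c = 0 ∧ d - a = 0 then 2 else 3) else 0)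
    = 2 * Om g n (fun _ _ _ _ => 1) := by
  set W : ℤ → ℤ → ℤ → ℤ → ℤ := fun a B c d => if 0 ≤ B + d - c ∧ 0 ≤ d - a then
      (if 0 < B + d - c ∧ 0 < d - a then 6 else if B + d - c = 0 ∧ d - a = 0 then 2 else 3) else 0 with hW
  have h1 := Om_rot g n W
  have h2 := Om_rot g n (fun a B c d => W d (c - d) (B + d) (a + B + d - c))
  have : Om g n W + Om g n (fun a B c d => W d (c - d) (B + d) (a + B + d - c))
     + Om g n (fun a B c d => (fun a B c d => W d (c - d) (B + d) (a + B + d - c)) d (c - d) (B + d) (a + B + d - c))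
     = 6 * Om g n (fun _ _ _ _ => 1) := by
    unfold Om
    rw [← QS_add, ← QS_add, ← QS_mul]
    refine QS_congr (fun a B c d h1 h2 h3 h4 _ => ?_)
    by_cases h : a < c ∧ d < c ∧ c < a + d + B
    · simp only [if_pos h]
      have : W a B c d + W d (c - d) (B + d) (a + B + d - c) +
        W (a + B + d - c) (B + d - (a + B + d - c)) (c - d + (a + B + d - c)) (d + (c - d) + (a + B + d - c) - (B + d)) = 6 := by
        simp only [hW]
        clear_value W
        clear hW 
        split_ifs <;> omega
      have := congrArg (Int.cast : ℤ → ℝ) this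
      push_cast at this ⊢
      linear_combination g (a + d - c) * this
    · simp [if_neg h]
  linarith


lemma U_eq (hg : ∀ t, g (-t) = g t) : QS n (fun a _ c d => g (a + d - c))
    = QS n (fun a B c d => if d < B then g (a + d) else 0)
     + QS n (fun a B c d => if a = c then g d else 0)
     + QS n (fun a B c d => if a < B ∧ a < c then g (a + d) else 0)
     + QS n (fun a B c d => if d < a ∧ a = c then g d else 0)
     + Om g n (fun _ _ _ _ => 1)
     + QS n (fun a B c d => if c = a + d + B then g B else 0)
     + QS n (fun a B c d => if a < B ∧ a < c then g (a + d) else 0) := by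
  nth_rw 2 [← U7 g n]
  rw [← U1, ← U3, ← U4, Om]
  simp only [← QS_add]
  refine QS_congr (fun a B c d h1 h2 h3 h4 _ => ?_)
  have e1 : g (c - a - d) = g (a + d - c) := by rw [← hg]; congr 1; ring
  rw [e1]
  rcases lt_trichotomy a c with h | h | h
  · rcases lt_trichotomy c d with h' | h' | h'
    · simp (discharger := omega) only [if_pos, if_neg, if_true, and_true]; ring
    · subst h'
      simp (discharger := omega) only [if_pos, if_neg, if_true, and_true]; rw [show a + c - c = a by ring]; ring
    · rcases lt_trichotomy c (a + d + B) with k | k | k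
      · simp (discharger := omega) only [if_pos, if_neg, if_true, and_true]; push_cast; ring
      · subst k
        simp (discharger := omega) only [if_pos, if_neg, if_true, and_true]; rw [show a + d - (a + d + B) = -B by ring, hg]; ring
      · simp (discharger := omega) only [if_pos, if_neg, if_true, and_true]; ring
  · subst h
    simp (discharger := omega) only [if_pos, if_neg, if_true, and_true]; rw [show a + d - a = d by ring]; ring
  · simp (discharger := omega) only [if_pos, if_neg, if_true, and_true]; ring

lemma V_eq : QS n (fun a _ c d => g (a + d + c))
    = QS n (fun a B c d => if c < a then g (a + d) else 0)
     + QS n (fun a B c d => if a = c then g (a + B + d) else 0)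
     + QS n (fun a B c d => if a + B + c < d then g (a + d) else 0)
     + QS n (fun a B c d => if a < d ∧ a = c then g (a + B + d) else 0)
     + QS n (fun a B c d => if a + B + c < d then g (a + d) else 0) := by
  nth_rw 2 [← V5 g n]
  rw [← V1, ← V2, ← V3, ← V4]
  simp only [← QS_add]
  refine QS_congr (fun a B c d h1 h2 h3 h4 _ => ?_)
  rcases lt_trichotomy B d with h | h | h <;> rcases lt_trichotomy a B with h' | h' | h' <;>
  simp (discharger := omega) only [if_pos, if_neg, if_true, and_true] <;> ring

lemma UV_eq (hg : ∀ t, g (-t) = g t) : 2 * (QS n (fun a _ c d => g (a + d - c)) - QS n (fun a _ c d => g (a + d + c)))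
    = GS g n (fun a B c d => w6 (a - d) B c)
    + Om g n (fun a B c d => if 0 ≤ B + d - c ∧ 0 ≤ d - a then
      (if 0 < B + d - c ∧ 0 < d - a then 6 else if B + d - c = 0 ∧ d - a = 0 then 2 else 3) else 0)
    + QS n (fun a B c d => if d = a + B + c then 4 * g (a + d) else 0)
    + QS n (fun a B c d => if c = a + d + B then 2 * g B else 0)
    + FS n (fun a B d => 2 * g d * (if d < a then 2 else 1)
        - 2 * g (a + B + d) * (if a < d then 2 else 1) - g (a + d) * (2 + 4 * (hh (B - a) : ℝ))) := by
  have e1 : GS g n X2 = 2 * QS n (fun a B c d => if d < B then g (a + d) else 0)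
     + 4 * QS n (fun a B c d => if a < B ∧ a < c then g (a + d) else 0)
     - 2 * QS n (fun a B c d => if c < a then g (a + d) else 0)
     - 4 * QS n (fun a B c d => if a + B + c < d then g (a + d) else 0) := by
    unfold GS
    rw [← QS_mul, ← QS_mul, ← QS_mul, ← QS_mul, ← QS_add, ← QS_sub, ← QS_sub]
    refine QS_congr (fun a B c d h1 h2 h3 h4 _ => ?_)
    unfold X2
    push_cast
    split_ifs <;> ring
  have e2 := GS_X2 g n
  have e3 := Om_w g n
  have e4 : QS n (fun a B c d => if d = a + B + c then 4 * g (a + d) else 0)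
      = GS g n (fun a B c d => if d = a + B + c then 4 else 0) := by
    refine QS_congr (fun a B c d h1 h2 h3 h4 _ => ?_)
    push_cast; split_ifs <;> ring
  have e5 : QS n (fun a B c d => if c = a + d + B then 2 * g B else 0)
      = 2 * QS n (fun a B c d => if c = a + d + B then g B else 0) := by
    rw [← QS_mul]
    refine QS_congr (fun a B c d h1 h2 h3 h4 _ => ?_)
    split_ifs <;> ring
  have e6 : FS n (fun a B d => 2 * g d * (if d < a then 2 else 1)
        - 2 * g (a + B + d) * (if a < d then 2 else 1) - g (a + d) * (2 + 4 * (hh (B - a) : ℝ)))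
      = 2 * QS n (fun a B c d => if a = c then g d else 0)
      + 2 * QS n (fun a B c d => if d < a ∧ a = c then g d else 0)
      - 2 * QS n (fun a B c d => if a = c then g (a + B + d) else 0)
      - 2 * QS n (fun a B c d => if a < d ∧ a = c then g (a + B + d) else 0)
      - GS g n (fun a B c d => if a = c then 2 + 4 * hh (B - c) else 0) := by
    unfold FS GS
    rw [← QS_mul, ← QS_mul, ← QS_mul, ← QS_mul, ← QS_add, ← QS_sub, ← QS_sub, ← QS_sub]
    refine QS_congr (fun a B c d h1 h2 h3 h4 _ => ?_)
    by_cases h : a = c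
    · subst h
      simp only [if_true, and_true]
      push_cast
      split_ifs <;> ring
    · simp [h]
  rw [U_eq g n hg, V_eq, e4, e5, e6]
  linarith

end
end

section
set_option linter.unusedVariables false
set_option linter.unusedSimpArgs false

lemma formAct_mul (γ δ : Matrix.SpecialLinearGroup (Fin 2) ℤ) (Q : ℤ × ℤ × ℤ) :
    formAct γ (formAct δ Q) = formAct (δ * γ) Q := by
  obtain ⟨A, b, C⟩ := Q
  simp only [formAct, formEval, Matrix.SpecialLinearGroup.coe_mul, Matrix.mul_apply, Fin.sum_univ_two]
  ext <;> dsimp only <;> ring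

lemma formAct_one (Q : ℤ × ℤ × ℤ) : formAct 1 Q = Q := by
  obtain ⟨A, b, C⟩ := Q
  simp [formAct, formEval]; ring

lemma det_eq (γ : Matrix.SpecialLinearGroup (Fin 2) ℤ) :
    γ.1 0 0 * γ.1 1 1 - γ.1 0 1 * γ.1 1 0 = 1 := by
  rw [← Matrix.det_fin_two]; exact γ.2

lemma formDisc_act (γ : Matrix.SpecialLinearGroup (Fin 2) ℤ) (Q : ℤ × ℤ × ℤ) :
    formDisc (formAct γ Q) = formDisc Q := by
  have h := det_eq γ
  obtain ⟨A, b, C⟩ := Q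
  simp only [formDisc, formAct, formEval]
  linear_combination (b ^ 2 - 4 * A * C) * (γ.1 0 0 * γ.1 1 1 - γ.1 0 1 * γ.1 1 0 + 1) * h

lemma formEval_pos {Q : ℤ × ℤ × ℤ} (hQ : IsPosDef Q) {x y : ℤ} (h : x ≠ 0 ∨ y ≠ 0) :
    0 < formEval Q x y := by
  obtain ⟨A, b, C⟩ := Q
  obtain ⟨h1, h2⟩ := hQ
  simp only [formDisc, formEval] at *
  have : 0 < 4 * A * (A * x ^ 2 + b * x * y + C * y ^ 2) := by
    rcases eq_or_ne y 0 with rfl | hy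
    · have : x ≠ 0 := by simpa using h
      have := sq_pos_of_ne_zero this
      nlinarith [mul_pos h1 h1, mul_pos (mul_pos h1 h1) this]
    · have := sq_pos_of_ne_zero hy
      nlinarith [sq_nonneg (2 * A * x + b * y), mul_pos this (neg_pos.2 h2)]
  exact (mul_pos_iff_of_pos_left (by positivity)).1 this

lemma IsPosDef_act (γ : Matrix.SpecialLinearGroup (Fin 2) ℤ) {Q : ℤ × ℤ × ℤ} (hQ : IsPosDef Q) :
    IsPosDef (formAct γ Q) := by
  refine ⟨?_, by rw [formDisc_act]; exact hQ.2⟩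
  refine formEval_pos hQ ?_
  by_contra h
  push Not at h
  have := det_eq γ
  rw [h.1, h.2] at this
  simp at this

/-- weight of a form -/
def wt (Q : ℤ × ℤ × ℤ) : ℤ := w6 Q.2.1 Q.1 Q.2.2

noncomputable def WW (Q : ℤ × ℤ × ℤ) : ℤ := ∑ᶠ γ : Matrix.SpecialLinearGroup (Fin 2) ℤ, wt (formAct γ Q)

lemma WW_act (δ : Matrix.SpecialLinearGroup (Fin 2) ℤ) (Q : ℤ × ℤ × ℤ) : WW (formAct δ Q) = WW Q := by
  unfold WW
  simp only [formAct_mul]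
  exact finsum_comp_equiv (Equiv.mulLeft δ) (f := fun γ => wt (formAct γ Q))

lemma w6_ne {b A C : ℤ} (h : w6 b A C ≠ 0) : b ≤ A ∧ b ≤ C ∧ -b ≤ A ∧ -b ≤ C := by
  unfold w6 at h
  split_ifs at h <;> first | omega

lemma mink (A b C x y : ℤ) (h1 : b ≤ A) (h2 : -b ≤ A) (h3 : A ≤ C) (hy : y ≠ 0) :
    C ≤ A * x ^ 2 + b * x * y + C * y ^ 2 := by
  have hA : 0 ≤ A := by omega
  have e1 : -(A * (|x| * |y|)) ≤ b * x * y := by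
    have : |b * x * y| ≤ A * (|x| * |y|) := by
      rw [abs_mul, abs_mul, mul_assoc]
      exact mul_le_mul_of_nonneg_right (abs_le.2 ⟨by omega, h1⟩) (by positivity)
    exact (abs_le.1 this).1
  have hy1 : 1 ≤ |y| := Int.one_le_abs hy
  have hx0 := abs_nonneg x
  rw [← sq_abs x, ← sq_abs y]
  set X := |x|
  set Y := |y|
  rcases le_total Y X with h | h
  · nlinarith [mul_nonneg hA (mul_nonneg hx0 (sub_nonneg.2 h)), mul_nonneg (hA.trans h3) (show 0 ≤ Y^2 - 1 by nlinarith)]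
  · have e2 : 1 ≤ X ^ 2 - X * Y + Y ^ 2 := by
      rcases hx0.eq_or_lt with h0 | h0
      · rw [← h0]; nlinarith
      · have : 1 ≤ X := h0
        nlinarith [mul_nonneg (sub_nonneg.2 h) (sub_nonneg.2 hy1)]
    nlinarith [mul_nonneg (sub_nonneg.2 h3) (mul_nonneg hx0 (sub_nonneg.2 h)), mul_nonneg (hA.trans h3) (sub_nonneg.2 e2)]

lemma small (A b C x y : ℤ) (h0 : 0 < A) (h1 : b ≤ A) (h2 : -b ≤ A) (h3 : A ≤ C)
    (h : A * x ^ 2 + b * x * y + C * y ^ 2 ≤ A) : |x| ≤ 1 ∧ |y| ≤ 1 := by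
  have e1 : -(A * (|x| * |y|)) ≤ b * x * y := by
    have : |b * x * y| ≤ A * (|x| * |y|) := by
      rw [abs_mul, abs_mul, mul_assoc]
      exact mul_le_mul_of_nonneg_right (abs_le.2 ⟨by omega, h1⟩) (by positivity)
    exact (abs_le.1 this).1
  have hx0 := abs_nonneg x
  have hy0 := abs_nonneg y
  rw [← sq_abs x, ← sq_abs y] at h
  set X := |x|
  set Y := |y|
  have : A * (X ^ 2 - X * Y + Y ^ 2) ≤ A * 1 := by nlinarith [mul_nonneg (sub_nonneg.2 h3) (sq_nonneg Y)]
  have := le_of_mul_le_mul_left this h0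
  constructor
  · by_contra hh; push Not at hh; nlinarith [sq_nonneg (X - 2 * Y)]
  · by_contra hh; push Not at hh; nlinarith [sq_nonneg (Y - 2 * X)]

lemma q_small (A b q s : ℤ) (h0 : 0 < A) (h1 : b ≤ A) (h2 : -b ≤ A) (hs : |s| = 1)
    (h : A * q ^ 2 + b * q * s ≤ 0) : |q| ≤ 1 := by
  have e1 : -(A * |q|) ≤ b * q * s := by
    have : |b * q * s| ≤ A * |q| := by
      rw [abs_mul, abs_mul, hs, mul_one]
      exact mul_le_mul_of_nonneg_right (abs_le.2 ⟨by omega, h1⟩) (by positivity)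
    exact (abs_le.1 this).1
  rw [← sq_abs q] at h
  have hq0 := abs_nonneg q
  by_contra hh; push Not at hh
  nlinarith [mul_pos h0 (show 0 < |q| * (|q| - 1) by nlinarith)]

lemma entries (A b C p q r s : ℤ) (h0 : 0 < A) (h1 : b ≤ A) (h2 : -b ≤ A) (h3 : A ≤ C)
    (hd : p * s - q * r = 1)
    (hw : w6 (2 * A * p * q + b * (p * s + q * r) + 2 * C * r * s) (A * p ^ 2 + b * p * r + C * r ^ 2)
      (A * q ^ 2 + b * q * s + C * s ^ 2) ≠ 0) :
    |p| ≤ 1 ∧ |q| ≤ 1 ∧ |r| ≤ 1 ∧ |s| ≤ 1 := by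
  obtain ⟨k1, k2, k3, k4⟩ := w6_ne hw
  set A' := A * p ^ 2 + b * p * r + C * r ^ 2 with hA'
  set C' := A * q ^ 2 + b * q * s + C * s ^ 2 with hC'
  set b' := 2 * A * p * q + b * (p * s + q * r) + 2 * C * r * s with hb'
  have E1 : A' * s ^ 2 + b' * s * (-r) + C' * (-r) ^ 2 = A := by
    rw [hA', hC', hb']; linear_combination A * (p * s - q * r + 1) * hd
  have E2 : A' * (-q) ^ 2 + b' * (-q) * p + C' * p ^ 2 = C := by
    rw [hA', hC', hb']; linear_combination C * (p * s - q * r + 1) * hd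
  have fin : A' ≤ A → C' ≤ A → |p| ≤ 1 ∧ |q| ≤ 1 ∧ |r| ≤ 1 ∧ |s| ≤ 1 := by
    intro ha hc
    have := small A b C p r h0 h1 h2 h3 ha
    have := small A b C q s h0 h1 h2 h3 hc
    tauto
  rcases le_total A' C' with h | h
  · by_cases hr : r = 0
    · subst hr
      have hps : p * s = 1 := by linarith
      have hp : |p| = 1 ∧ |s| = 1 := by
        rcases Int.mul_eq_one_iff_eq_one_or_neg_one.1 hps with ⟨rfl, rfl⟩ | ⟨rfl, rfl⟩ <;> simp
      have hp0 : p ≠ 0 := by rintro rfl; simp at hps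
      have := mink A' b' C' (-q) p k1 k3 h hp0
      rw [E2, hC'] at this
      have hs2 : s ^ 2 = 1 := by rw [← sq_abs, hp.2]; norm_num
      rw [hs2] at this
      have := q_small A b q s h0 h1 h2 hp.2 (by linarith)
      simp [hp.1, hp.2, this]
    · have := mink A' b' C' s (-r) k1 k3 h (by simpa using hr)
      rw [E1] at this
      exact fin (h.trans this) this
  · by_cases hs : s = 0
    · subst hs
      have hps : q * (-r) = 1 := by linarith
      have hp : |q| = 1 ∧ |r| = 1 := by
        rcases Int.mul_eq_one_iff_eq_one_or_neg_one.1 hps with ⟨rfl, h⟩ | ⟨rfl, h⟩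
        · rw [show r = -1 by omega]; simp
        · rw [show r = 1 by omega]; simp
      have hp0 : -q ≠ 0 := by intro hh; rw [neg_eq_zero.1 hh] at hps; simp at hps
      have := mink C' b' A' p (-q) k2 k4 h hp0
      rw [show C' * p ^ 2 + b' * p * (-q) + A' * (-q) ^ 2 = C by linarith, hA'] at this
      have hs2 : r ^ 2 = 1 := by rw [← sq_abs, hp.2]; norm_num
      rw [hs2] at this
      have := q_small A b p r h0 h1 h2 hp.2 (by linarith)
      simp [hp.1, hp.2, this]
    · have := mink C' b' A' (-r) s k2 k4 h hs
      rw [show C' * (-r) ^ 2 + b' * (-r) * s + A' * s ^ 2 = A by linarith] at this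
      exact fin this (h.trans this)
end

section
set_option linter.unusedVariables false
set_option linter.unusedSimpArgs false

def fent (A b C : ℤ) (v : ℤ × ℤ × ℤ × ℤ) : ℤ :=
  w6 (2 * A * v.1 * v.2.1 + b * (v.1 * v.2.2.2 + v.2.1 * v.2.2.1) + 2 * C * v.2.2.1 * v.2.2.2)
    (A * v.1 ^ 2 + b * v.1 * v.2.2.1 + C * v.2.2.1 ^ 2)
      (A * v.2.1 ^ 2 + b * v.2.1 * v.2.2.2 + C * v.2.2.2 ^ 2)

def K20 : List (ℤ × ℤ × ℤ × ℤ) :=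
  [(1,0,0,1),(0,1,-1,0),(1,1,0,1),(1,-1,0,1),(1,0,1,1),(1,0,-1,1),(0,1,-1,1),(0,1,-1,-1),(1,1,-1,0),(-1,1,-1,0),
   (-1,0,0,-1),(0,-1,1,0),(-1,-1,0,-1),(-1,1,0,-1),(-1,0,-1,-1),(-1,0,1,-1),(0,-1,1,-1),(0,-1,1,1),(-1,-1,1,0),(1,-1,1,0)]

lemma mem_K20 : ∀ p ∈ Finset.Icc (-1 : ℤ) 1, ∀ q ∈ Finset.Icc (-1 : ℤ) 1, ∀ r ∈ Finset.Icc (-1 : ℤ) 1,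
    ∀ s ∈ Finset.Icc (-1 : ℤ) 1, (p * s - q * r = 1 ↔ (p, q, r, s) ∈ K20.toFinset) := by decide

lemma K20_det : ∀ v ∈ K20.toFinset, v.1 * v.2.2.2 - v.2.1 * v.2.2.1 = 1 := by decide

set_option maxHeartbeats 1000000 in
lemma sum_K20 (A b C : ℤ) (h0 : 0 < A) (h1 : b ≤ A) (h2 : -b ≤ A) (h3 : A ≤ C) :
    ∑ v ∈ K20.toFinset, fent A b C v = 24 := by
  rw [List.sum_toFinset _ (by decide)]
  simp only [K20, List.map_cons, List.map_nil, List.sum_cons, List.sum_nil, fent]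
  ring_nf
  rcases h3.eq_or_lt with h | h <;> rcases lt_trichotomy b 0 with k | k | k
  · subst h
    rcases h2.eq_or_lt with h | h <;> simp (discharger := omega) only [w6, if_pos, if_neg, if_true] <;> rfl
  · subst h; subst k
    simp (discharger := omega) only [w6, if_pos, if_neg, if_true] <;> rfl
  · subst h
    rcases h1.eq_or_lt with h | h <;> simp (discharger := omega) only [w6, if_pos, if_neg, if_true] <;> rfl
  · rcases h2.eq_or_lt with h | h <;> simp (discharger := omega) only [w6, if_pos, if_neg, if_true] <;> rfl
  · subst k
    simp (discharger := omega) only [w6, if_pos, if_neg, if_true] <;> rfl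
  · rcases h1.eq_or_lt with h | h <;> simp (discharger := omega) only [w6, if_pos, if_neg, if_true] <;> rfl

lemma WW_red (A b C : ℤ) (h0 : 0 < A) (h1 : b ≤ A) (h2 : -b ≤ A) (h3 : A ≤ C) :
    WW (A, b, C) = 24 := by
  rw [← sum_K20 A b C h0 h1 h2 h3]
  let φ : Matrix.SpecialLinearGroup (Fin 2) ℤ → ℤ × ℤ × ℤ × ℤ :=
    fun γ => (γ.1 0 0, γ.1 0 1, γ.1 1 0, γ.1 1 1)
  have hφ : Function.Injective φ := by
    intro γ δ h
    simp only [φ, Prod.mk.injEq] at h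
    apply Subtype.ext
    ext i j
    fin_cases i <;> fin_cases j <;> simp [h]
  have e1 : ∀ γ, wt (formAct γ (A, b, C)) = fent A b C (φ γ) := by
    intro γ
    simp only [wt, formAct, formEval, fent, φ]
    congr 1; ring
  unfold WW
  simp only [e1]
  rw [← finsum_mem_range (f := fent A b C) hφ]
  refine finsum_mem_eq_sum_of_inter_support_eq _ ?_
  ext ⟨p, q, r, s⟩
  simp only [Set.mem_inter_iff, Function.mem_support, SetLike.mem_coe]
  constructor
  · rintro ⟨⟨γ, hγ⟩, hf⟩
    refine ⟨?_, hf⟩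
    have hd : p * s - q * r = 1 := by
      have := det_eq γ
      simp only [φ, Prod.mk.injEq] at hγ
      rw [hγ.1, hγ.2.1, hγ.2.2.1, hγ.2.2.2] at this
      exact this
    obtain ⟨k1, k2, k3, k4⟩ := entries A b C p q r s h0 h1 h2 h3 hd hf
    rw [abs_le] at k1 k2 k3 k4
    exact (mem_K20 p (Finset.mem_Icc.2 k1) q (Finset.mem_Icc.2 k2) r (Finset.mem_Icc.2 k3) s (Finset.mem_Icc.2 k4)).1 hd
  · rintro ⟨hm, hf⟩
    refine ⟨⟨⟨!![p, q; r, s], ?_⟩, ?_⟩, hf⟩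
    · rw [Matrix.det_fin_two_of]; exact K20_det _ hm
    · simp [φ]

/-- reduction -/
lemma exists_red (Q : ℤ × ℤ × ℤ) (hQ : IsPosDef Q) :
    ∃ γ : Matrix.SpecialLinearGroup (Fin 2) ℤ, (formAct γ Q).2.1 ≤ (formAct γ Q).1 ∧
      -(formAct γ Q).2.1 ≤ (formAct γ Q).1 ∧ (formAct γ Q).1 ≤ (formAct γ Q).2.2 := by
  generalize hm : (Q.1 + Q.2.2).toNat = m
  induction m using Nat.strong_induction_on generalizing Q with
  | _ m ih =>
  have step : ∀ δ : Matrix.SpecialLinearGroup (Fin 2) ℤ, ∀ Q', formAct δ Q = Q' →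
      Q'.1 + Q'.2.2 < Q.1 + Q.2.2 →
      ∃ γ : Matrix.SpecialLinearGroup (Fin 2) ℤ, (formAct γ Q).2.1 ≤ (formAct γ Q).1 ∧
      -(formAct γ Q).2.1 ≤ (formAct γ Q).1 ∧ (formAct γ Q).1 ≤ (formAct γ Q).2.2 := by
    intro δ Q' hδ hlt
    have hp : IsPosDef Q' := hδ ▸ IsPosDef_act δ hQ
    have := hp.1
    have hc : 0 < Q'.2.2 := by
      have := formEval_pos hp (x := 0) (y := 1) (by simp)
      simpa [formEval] using this
    obtain ⟨γ, hγ⟩ := ih _ (by omega) Q' hp rfl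
    refine ⟨δ * γ, ?_⟩
    rw [← formAct_mul, hδ]; exact hγ
  obtain ⟨A, b, C⟩ := Q
  dsimp only at *
  by_cases c1 : A < b
  · refine step ⟨!![1, -1; 0, 1], by simp⟩ (A, b - 2 * A, A - b + C) ?_ (by dsimp only; omega)
    simp only [formAct, formEval]
    ext <;> simp <;> ring
  by_cases c2 : A < -b
  · refine step ⟨!![1, 1; 0, 1], by simp⟩ (A, b + 2 * A, A + b + C) ?_ (by dsimp only; omega)
    simp only [formAct, formEval]
    ext <;> simp <;> ring
  by_cases c3 : C < b
  · refine step ⟨!![1, 0; -1, 1], by simp⟩ (A - b + C, b - 2 * C, C) ?_ (by dsimp only; omega)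
    simp only [formAct, formEval]
    ext <;> simp <;> ring
  by_cases c4 : C < -b
  · refine step ⟨!![1, 0; 1, 1], by simp⟩ (A + b + C, b + 2 * C, C) ?_ (by dsimp only; omega)
    simp only [formAct, formEval]
    ext <;> simp <;> ring
  by_cases c5 : A ≤ C
  · refine ⟨1, ?_⟩
    rw [formAct_one]; dsimp only; omega
  · refine ⟨⟨!![0, 1; -1, 0], by simp⟩, ?_⟩
    have : formAct ⟨!![0, 1; -1, 0], by simp⟩ (A, b, C) = (C, -b, A) := by
      simp only [formAct, formEval]
      ext <;> simp <;> ring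
    rw [this]; dsimp only; omega

lemma WW_eq (Q : ℤ × ℤ × ℤ) (hQ : IsPosDef Q) : WW Q = 24 := by
  obtain ⟨γ, h1, h2, h3⟩ := exists_red Q hQ
  rw [← WW_act γ Q]
  exact WW_red _ _ _ (IsPosDef_act γ hQ).1 h1 h2 h3
end

section
set_option linter.unusedVariables false
set_option linter.unusedSimpArgs false

noncomputable def trip (N : ℤ) : Finset (ℤ × ℤ × ℤ) :=
  (Finset.Icc 1 N ×ˢ Finset.Icc (-N) N ×ˢ Finset.Icc 1 N).filter
    (fun Q => 4 * Q.1 * Q.2.2 - Q.2.1 ^ 2 = N ∧ wt Q ≠ 0)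

lemma mem_trip {N : ℤ} {Q : ℤ × ℤ × ℤ} :
    Q ∈ trip N ↔ 0 < Q.1 ∧ 0 < Q.2.2 ∧ 4 * Q.1 * Q.2.2 - Q.2.1 ^ 2 = N ∧ wt Q ≠ 0 := by
  obtain ⟨A, b, C⟩ := Q
  simp only [trip, Finset.mem_filter, Finset.mem_product, Finset.mem_Icc]
  constructor
  · rintro ⟨⟨⟨h1, _⟩, ⟨h2, _⟩, ⟨h3, _⟩⟩, h⟩
    exact ⟨h1, h3, h⟩
  · rintro ⟨h1, h2, h3, h4⟩
    obtain ⟨k1, k2, k3, k4⟩ := w6_ne h4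
    dsimp only at *
    have hb : b ^ 2 ≤ A * C := by
      rw [← sq_abs, sq]
      exact mul_le_mul (abs_le.2 ⟨by omega, k1⟩) (abs_le.2 ⟨by omega, k2⟩) (abs_nonneg _) (by omega)
    have hA : A ≤ N := by nlinarith
    have hC : C ≤ N := by nlinarith
    exact ⟨⟨⟨by omega, hA⟩, ⟨by omega, by omega⟩, ⟨by omega, hC⟩⟩, h3, h4⟩

lemma trip_X {N : ℤ} (hN : 0 < N) {Q : ℤ × ℤ × ℤ} (h : Q ∈ trip N) : formDisc Q = -N ∧ IsPosDef Q := by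
  obtain ⟨h1, h2, h3, h4⟩ := mem_trip.1 h
  have : formDisc Q = -N := by unfold formDisc; linarith
  exact ⟨this, h1, by rw [this]; omega⟩

lemma act_trip {N : ℤ} {Q : ℤ × ℤ × ℤ} (hQ : formDisc Q = -N ∧ IsPosDef Q)
    {γ : Matrix.SpecialLinearGroup (Fin 2) ℤ} (h : wt (formAct γ Q) ≠ 0) : formAct γ Q ∈ trip N := by
  have hp := IsPosDef_act γ hQ.2
  have hd := formDisc_act γ Q
  refine mem_trip.2 ⟨hp.1, ?_, ?_, h⟩
  · have := formEval_pos hp (x := 0) (y := 1) (by simp)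
    simpa [formEval] using this
  · rw [hQ.1, formDisc] at hd; linarith

open scoped Classical in
lemma orbit_sum {N : ℤ} (Q : ℤ × ℤ × ℤ) (hQ : formDisc Q = -N ∧ IsPosDef Q) :
    (Nat.card {γ : Matrix.SpecialLinearGroup (Fin 2) ℤ // formAct γ Q = Q} : ℤ) *
      ∑ Q' ∈ trip N, (if ∃ γ : Matrix.SpecialLinearGroup (Fin 2) ℤ, formAct γ Q = Q' then wt Q' else 0) = 24 := by
  have hW := WW_eq Q hQ.2
  have hfin : (Function.support (fun γ : Matrix.SpecialLinearGroup (Fin 2) ℤ => wt (formAct γ Q))).Finite := by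
    by_contra hinf
    rw [WW, finsum_of_infinite_support hinf] at hW
    norm_num at hW
  rw [← hW, WW, finsum_eq_sum _ hfin, Finset.mul_sum,
    ← Finset.sum_fiberwise_of_maps_to (s := hfin.toFinset) (t := trip N) (g := fun γ => formAct γ Q)]
  · refine Finset.sum_congr rfl (fun Q' hQ' => ?_)
    have hw := (mem_trip.1 hQ').2.2.2
    have e1 : ∑ γ ∈ hfin.toFinset with formAct γ Q = Q', wt (formAct γ Q)
        = (hfin.toFinset.filter (fun γ => formAct γ Q = Q')).card * wt Q' := by
      rw [Finset.sum_congr rfl (g := fun _ => wt Q'), Finset.sum_const, nsmul_eq_mul]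
      intro γ hγ
      rw [(Finset.mem_filter.1 hγ).2]
    rw [e1]
    have e2 : (hfin.toFinset.filter (fun γ => formAct γ Q = Q')).card
        = Nat.card {γ : Matrix.SpecialLinearGroup (Fin 2) ℤ // formAct γ Q = Q'} := by
      rw [← Nat.card_eq_finsetCard]
      refine Nat.card_congr (Equiv.subtypeEquivRight (fun γ => ?_))
      simp only [Finset.mem_filter, Set.Finite.mem_toFinset, Function.mem_support]
      constructor
      · exact fun h => h.2
      · exact fun h => ⟨by rw [h]; exact hw, h⟩
    rw [e2]
    by_cases hex : ∃ γ : Matrix.SpecialLinearGroup (Fin 2) ℤ, formAct γ Q = Q'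
    · rw [if_pos hex]
      obtain ⟨γ₀, h₀⟩ := hex
      congr 2
      refine Nat.card_congr ((Equiv.mulRight γ₀).subtypeEquiv (fun γ => ?_))
      simp only [Equiv.coe_mulRight]
      rw [← formAct_mul]
      constructor
      · intro h; rw [h, h₀]
      · intro h
        have := congrArg (formAct γ₀⁻¹) (h.trans h₀.symm)
        rw [formAct_mul, formAct_mul, formAct_mul, mul_inv_cancel, mul_one, formAct_one] at this
        exact this
    · rw [if_neg hex, mul_zero]
      have : IsEmpty {γ : Matrix.SpecialLinearGroup (Fin 2) ℤ // formAct γ Q = Q'} :=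
        ⟨fun γ => hex ⟨γ.1, γ.2⟩⟩
      simp
  · intro γ hγ
    exact act_trip hQ (by simpa using hγ)

theorem hurwitz_eq (N : ℤ) (hN : 0 < N) : 12 * hurwitzClassNumber N = ((∑ Q ∈ trip N, wt Q : ℤ) : ℝ) := by
  classical
  rw [hurwitzClassNumber, if_neg hN.ne']
  have key : ∀ c : FormClasses N, (2 : ℝ) / (Nat.card {γ : Matrix.SpecialLinearGroup (Fin 2) ℤ //
      formAct γ c.out.1 = c.out.1}) = ∑ Q' ∈ trip N, (if ∃ γ : Matrix.SpecialLinearGroup (Fin 2) ℤ, formAct γ c.out.1 = Q' then (wt Q' : ℝ) / 12 else 0) := by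
    intro c
    have := orbit_sum c.out.1 c.out.2
    have h2 := congrArg (Int.cast : ℤ → ℝ) this
    push_cast at h2
    set k : ℝ := (Nat.card {γ : Matrix.SpecialLinearGroup (Fin 2) ℤ // formAct γ c.out.1 = c.out.1} : ℝ) with hk
    have hk0 : k ≠ 0 := by intro h; rw [h, zero_mul] at h2; norm_num at h2
    have e : ∑ Q' ∈ trip N, (if ∃ γ : Matrix.SpecialLinearGroup (Fin 2) ℤ, formAct γ c.out.1 = Q' then (wt Q' : ℝ) / 12 else 0)
       = (∑ Q' ∈ trip N, (if ∃ γ : Matrix.SpecialLinearGroup (Fin 2) ℤ, formAct γ c.out.1 = Q' then (wt Q' : ℝ) else 0)) / 12 := by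
      rw [Finset.sum_div]
      refine Finset.sum_congr rfl (fun Q' _ => ?_)
      split_ifs <;> simp
    rw [e, eq_div_iff (by norm_num), div_mul_eq_mul_div, div_eq_iff hk0, mul_comm, mul_comm _ k, h2]
    norm_num
  simp only [key]
  have hr : Equivalence (fun (Q Q' : {Q : ℤ × ℤ × ℤ // formDisc Q = -N ∧ IsPosDef Q}) =>
    ∃ γ : Matrix.SpecialLinearGroup (Fin 2) ℤ, formAct γ Q.1 = Q'.1) := by
    refine ⟨fun Q => ⟨1, formAct_one _⟩, ?_, ?_⟩
    · rintro Q Q' ⟨γ, h⟩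
      exact ⟨γ⁻¹, by rw [← h, formAct_mul, mul_inv_cancel, formAct_one]⟩
    · rintro Q Q' Q'' ⟨γ, h⟩ ⟨δ, h'⟩
      exact ⟨γ * δ, by rw [← formAct_mul, h, h']⟩
  have hiff : ∀ (c : FormClasses N) (Q' : ℤ × ℤ × ℤ) (h : formDisc Q' = -N ∧ IsPosDef Q'),
      (∃ γ : Matrix.SpecialLinearGroup (Fin 2) ℤ, formAct γ c.out.1 = Q') ↔ c = Quot.mk _ ⟨Q', h⟩ := by
    intro c Q' h
    constructor
    · intro hex
      have : Quot.mk _ c.out = (Quot.mk _ ⟨Q', h⟩ : FormClasses N) := Quot.sound hex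
      rwa [Quot.out_eq] at this
    · intro hc
      have : Quot.mk _ c.out = (Quot.mk _ ⟨Q', h⟩ : FormClasses N) := by rw [Quot.out_eq]; exact hc
      have := Quot.eqvGen_exact this
      rw [hr.eqvGen_iff] at this
      exact this
  rw [finsum_sum_comm]
  · rw [Finset.mul_sum]
    push_cast
    refine Finset.sum_congr rfl (fun Q' hQ' => ?_)
    have hX := trip_X hN hQ'
    simp only [hiff _ Q' hX]
    rw [finsum_eq_single _ (Quot.mk _ ⟨Q', hX⟩)]
    · simp; ring
    · intro c hc; rw [if_neg hc]
  · intro Q' hQ'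
    have hX := trip_X hN hQ'
    refine (Set.finite_singleton (Quot.mk _ ⟨Q', hX⟩ : FormClasses N)).subset ?_
    intro c hc
    rw [Function.mem_support] at hc
    by_contra hne
    exact hc (if_neg (fun hex => hne ((hiff c Q' hX).1 hex)))

lemma hurwitz_neg (N : ℤ) (hN : N < 0) : hurwitzClassNumber N = 0 := by
  rw [hurwitzClassNumber, if_neg hN.ne]
  have : IsEmpty (FormClasses N) := by
    refine ⟨fun c => ?_⟩
    have h := c.out.2
    have := h.2.2
    rw [h.1] at this
    omega
  exact finsum_of_isEmpty _
end

section
set_option linter.unusedVariables false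
set_option linter.unusedSimpArgs false

noncomputable def allq (n : ℤ) : Finset (ℤ × ℤ × ℤ × ℤ) :=
  (Finset.Icc (-(4*n)) (4*n) ×ˢ Finset.Icc 1 (4*n) ×ˢ Finset.Icc 1 (4*n) ×ˢ Finset.Icc (-(4*n)) (4*n)).filter
    (fun p => p.1 * p.2.2.2 + p.2.1 * p.2.2.1 = n ∧ w6 (p.1 - p.2.2.2) p.2.1 p.2.2.1 ≠ 0)

lemma w6_bd {b A C : ℤ} (hA : 0 < A) (hC : 0 < C) (h : w6 b A C ≠ 0) : b ^ 2 ≤ A * C := by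
  obtain ⟨h1, h2, h3, h4⟩ := w6_ne h
  rcases le_total 0 b with hb | hb
  · nlinarith [mul_le_mul h1 h2 hb hA.le]
  · nlinarith [mul_le_mul h3 h4 (by linarith) hA.le]

lemma t_bd {n a B c d : ℤ} (hB : 0 < B) (hc : 0 < c) (h : a * d + B * c = n)
    (hw : w6 (a - d) B c ≠ 0) : (a + d) ^ 2 + 3 * (B * c) ≤ 4 * n := by
  have := w6_bd hB hc hw
  nlinarith

lemma mem_allq {n a B c d : ℤ} : (a, B, c, d) ∈ allq n ↔
    0 < B ∧ 0 < c ∧ a * d + B * c = n ∧ w6 (a - d) B c ≠ 0 := by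
  simp only [allq, Finset.mem_filter, Finset.mem_product, Finset.mem_Icc]
  constructor
  · rintro ⟨⟨-, ⟨h2, _⟩, ⟨h3, _⟩, -⟩, h⟩
    exact ⟨h2, h3, h⟩
  · rintro ⟨h1, h2, h3, h4⟩
    have h5 := t_bd h1 h2 h3 h4
    have h6 := w6_ne h4
    have h7 : 0 < B * c := mul_pos h1 h2
    have h8 : B ≤ 4 * n := by nlinarith [sq_nonneg (a + d)]
    have h9 : c ≤ 4 * n := by nlinarith [sq_nonneg (a + d)]
    have h10 : a + d ≤ 4 * n := by nlinarith [sq_nonneg (a + d)]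
    have h11 : -(a + d) ≤ 4 * n := by nlinarith [sq_nonneg (a + d)]
    exact ⟨⟨⟨by omega, by omega⟩, ⟨by omega, by omega⟩, ⟨by omega, by omega⟩, ⟨by omega, by omega⟩⟩, h3, h4⟩

section
variable (g : ℤ → ℝ) (n : ℤ)

noncomputable def GF (p : ℤ × ℤ × ℤ × ℤ) : ℝ := g (p.1 + p.2.2.2) * (w6 (p.1 - p.2.2.2) p.2.1 p.2.2.1 : ℝ)

noncomputable def ell : Finset ℤ := (Finset.Icc (-(4*n)) (4*n)).filter (fun t => t ^ 2 < 4 * n)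

lemma mem_ell {n t : ℤ} : t ∈ ell n ↔ t ^ 2 < 4 * n := by
  simp only [ell, Finset.mem_filter, Finset.mem_Icc, and_iff_right_iff_imp]
  intro h
  constructor <;> nlinarith

lemma ell_sum : ∑ t ∈ ell n, g t * (12 * hurwitzClassNumber (4 * n - t ^ 2)) = ∑ p ∈ allq n, GF g p := by
  have : ∀ t ∈ ell n, g t * (12 * hurwitzClassNumber (4 * n - t ^ 2))
      = ∑ Q ∈ trip (4 * n - t ^ 2), g t * (wt Q : ℝ) := by
    intro t ht
    rw [hurwitz_eq _ (by have := mem_ell.1 ht; linarith), Int.cast_sum, Finset.mul_sum]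
  rw [Finset.sum_congr rfl this, Finset.sum_sigma']
  refine Finset.sum_nbij' (fun x => ((x.1 + x.2.2.1) / 2, x.2.1, x.2.2.2, (x.1 - x.2.2.1) / 2))
    (fun p => ⟨p.1 + p.2.2.2, (p.2.1, p.1 - p.2.2.2, p.2.2.1)⟩) ?_ ?_ ?_ ?_ ?_
  · rintro ⟨t, A, b, C⟩ h
    rw [Finset.mem_sigma, mem_ell, mem_trip] at h
    obtain ⟨h1, h2, h3, h4, h5⟩ := h
    dsimp only at *
    have : Even (t + b) := by
      have : Even ((t + b) * (t - b)) := ⟨2 * (n - A * C), by linarith⟩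
      rcases Int.even_mul.1 this with h | h
      · exact h
      · have : t + b = t - b + 2 * b := by ring
        rw [this]; exact h.add ⟨b, by ring⟩
    obtain ⟨k, hk⟩ := this
    have e1 : (t + b) / 2 = k := by omega
    have e2 : (t - b) / 2 = k - b := by omega
    rw [mem_allq, e1, e2]
    refine ⟨h2, h3, ?_, ?_⟩
    · have : t = 2 * k - b := by omega
      subst this
      linarith
    · have : k - (k - b) = b := by ring
      rw [this]; exact h5
  · rintro ⟨a, B, c, d⟩ h
    obtain ⟨h1, h2, h3, h4⟩ := mem_allq.1 h
    rw [Finset.mem_sigma, mem_ell, mem_trip]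
    refine ⟨?_, h1, h2, ?_, h4⟩
    · have := t_bd h1 h2 h3 h4
      have : 0 < B * c := mul_pos h1 h2
      dsimp only; linarith
    · dsimp only; subst h3; ring
  · rintro ⟨t, A, b, C⟩ h
    rw [Finset.mem_sigma, mem_ell, mem_trip] at h
    obtain ⟨h1, h2, h3, h4, h5⟩ := h
    dsimp only at *
    have : Even (t + b) := by
      have : Even ((t + b) * (t - b)) := ⟨2 * (n - A * C), by linarith⟩
      rcases Int.even_mul.1 this with h | h
      · exact h
      · have : t + b = t - b + 2 * b := by ring
        rw [this]; exact h.add ⟨b, by ring⟩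
    obtain ⟨k, hk⟩ := this
    have e1 : (t + b) / 2 = k := by omega
    have e2 : (t - b) / 2 = k - b := by omega
    rw [e1, e2]
    have : k + (k - b) = t := by omega
    rw [this]
    have : k - (k - b) = b := by ring
    rw [this]
  · rintro ⟨a, B, c, d⟩ h
    ext <;> dsimp only <;> omega
  · rintro ⟨t, A, b, C⟩ h
    rw [Finset.mem_sigma, mem_ell, mem_trip] at h
    obtain ⟨h1, h2, h3, h4, h5⟩ := h
    dsimp only at *
    have : Even (t + b) := by
      have : Even ((t + b) * (t - b)) := ⟨2 * (n - A * C), by linarith⟩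
      rcases Int.even_mul.1 this with h | h
      · exact h
      · have : t + b = t - b + 2 * b := by ring
        rw [this]; exact h.add ⟨b, by ring⟩
    obtain ⟨k, hk⟩ := this
    have e1 : (t + b) / 2 = k := by omega
    have e2 : (t - b) / 2 = k - b := by omega
    unfold GF wt
    dsimp only
    rw [e1, e2]
    have : k + (k - b) = t := by omega
    rw [this]
    have : k - (k - b) = b := by ring
    rw [this]

lemma sum_split (F : ℤ × ℤ × ℤ × ℤ → ℝ) : ∑ p ∈ allq n, F p
    = ∑ p ∈ allq n with 0 < p.1 ∧ 0 < p.2.2.2, F p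
    + ∑ p ∈ allq n with p.1 < 0 ∧ p.2.2.2 < 0, F p
    + ∑ p ∈ allq n with 0 < p.1 ∧ p.2.2.2 < 0, F p
    + ∑ p ∈ allq n with p.1 < 0 ∧ 0 < p.2.2.2, F p
    + ∑ p ∈ allq n with p.1 = 0, F p
    + ∑ p ∈ allq n with p.1 ≠ 0 ∧ p.2.2.2 = 0, F p := by
  simp only [Finset.sum_filter, ← Finset.sum_add_distrib]
  refine Finset.sum_congr rfl ?_
  rintro ⟨a, B, c, d⟩ -
  dsimp only
  rcases lt_trichotomy a 0 with h | h | h <;> rcases lt_trichotomy d 0 with h' | h' | h' <;>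
    simp (discharger := omega) only [if_pos, if_neg] <;> ring

lemma part_pp : ∑ p ∈ allq n with 0 < p.1 ∧ 0 < p.2.2.2, GF g p = GS g n (fun a B c d => w6 (a - d) B c) := by
  unfold GS QS
  refine Finset.sum_subset ?_ ?_
  · rintro ⟨a, B, c, d⟩ h
    obtain ⟨h, h5, h6⟩ := Finset.mem_filter.1 h
    obtain ⟨h1, h2, h3, h4⟩ := mem_allq.1 h
    exact mem_quads.2 ⟨h5, h1, h2, h6, h3⟩
  · rintro ⟨a, B, c, d⟩ h h'
    obtain ⟨h1, h2, h3, h4, h5⟩ := mem_quads.1 h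
    have : w6 (a - d) B c = 0 := by
      by_contra hw
      exact h' (Finset.mem_filter.2 ⟨mem_allq.2 ⟨h2, h3, h5, hw⟩, h1, h4⟩)
    simp [GF, this]

lemma w6_neg (b A C : ℤ) : w6 (-b) A C = w6 b A C := by
  unfold w6
  simp only [neg_neg]
  split_ifs <;> first | rfl | omega

lemma part_nn (hg : ∀ t, g (-t) = g t) : ∑ p ∈ allq n with p.1 < 0 ∧ p.2.2.2 < 0, GF g p
    = ∑ p ∈ allq n with 0 < p.1 ∧ 0 < p.2.2.2, GF g p := by
  refine Finset.sum_nbij' (fun p => (-p.2.2.2, p.2.1, p.2.2.1, -p.1))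
    (fun p => (-p.2.2.2, p.2.1, p.2.2.1, -p.1)) ?_ ?_ ?_ ?_ ?_
  · rintro ⟨a, B, c, d⟩ h
    obtain ⟨h, h5, h6⟩ := Finset.mem_filter.1 h
    obtain ⟨h1, h2, h3, h4⟩ := mem_allq.1 h
    dsimp only at *
    refine Finset.mem_filter.2 ⟨mem_allq.2 ⟨h1, h2, by linarith, ?_⟩, by dsimp only; omega⟩
    convert h4 using 2; ring
  · rintro ⟨a, B, c, d⟩ h
    obtain ⟨h, h5, h6⟩ := Finset.mem_filter.1 h
    obtain ⟨h1, h2, h3, h4⟩ := mem_allq.1 h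
    dsimp only at *
    refine Finset.mem_filter.2 ⟨mem_allq.2 ⟨h1, h2, by linarith, ?_⟩, by dsimp only; omega⟩
    convert h4 using 2; ring
  · rintro ⟨a, B, c, d⟩ -; ext <;> dsimp only <;> ring
  · rintro ⟨a, B, c, d⟩ -; ext <;> dsimp only <;> ring
  · rintro ⟨a, B, c, d⟩ -
    unfold GF; dsimp only
    have : -d + -a = -(a + d) := by ring
    rw [this, hg]
    have : -d - -a = a - d := by ring
    rw [this]

lemma part_np : ∑ p ∈ allq n with p.1 < 0 ∧ 0 < p.2.2.2, GF g p
    = ∑ p ∈ allq n with 0 < p.1 ∧ p.2.2.2 < 0, GF g p := by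
  refine Finset.sum_nbij' (fun p => (p.2.2.2, p.2.1, p.2.2.1, p.1))
    (fun p => (p.2.2.2, p.2.1, p.2.2.1, p.1)) ?_ ?_ ?_ ?_ ?_
  · rintro ⟨a, B, c, d⟩ h
    obtain ⟨h, h5, h6⟩ := Finset.mem_filter.1 h
    obtain ⟨h1, h2, h3, h4⟩ := mem_allq.1 h
    dsimp only at *
    refine Finset.mem_filter.2 ⟨mem_allq.2 ⟨h1, h2, by linarith, ?_⟩, by dsimp only; omega⟩
    rw [← w6_neg] at h4
    convert h4 using 2; ring
  · rintro ⟨a, B, c, d⟩ h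
    obtain ⟨h, h5, h6⟩ := Finset.mem_filter.1 h
    obtain ⟨h1, h2, h3, h4⟩ := mem_allq.1 h
    dsimp only at *
    refine Finset.mem_filter.2 ⟨mem_allq.2 ⟨h1, h2, by linarith, ?_⟩, by dsimp only; omega⟩
    rw [← w6_neg] at h4
    convert h4 using 2; ring
  · rintro ⟨a, B, c, d⟩ -; rfl
  · rintro ⟨a, B, c, d⟩ -; rfl
  · rintro ⟨a, B, c, d⟩ -
    unfold GF; dsimp only
    rw [← w6_neg (a - d), add_comm a d]
    have : -(a - d) = d - a := by ring
    rw [this]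

def omw (a B c d : ℤ) : ℤ := if 0 ≤ B + d - c ∧ 0 ≤ d - a then
  (if 0 < B + d - c ∧ 0 < d - a then 6 else if B + d - c = 0 ∧ d - a = 0 then 2 else 3) else 0

lemma omw_eq {a B c d : ℤ} (ha : 0 < a) (hB : 0 < B) (hc : 0 < c) (hd : 0 < d) (h : d < c) :
    w6 (a + c - d) c (a + B) = omw a B c d := by
  unfold w6 omw
  split_ifs <;> first | rfl | omega

lemma part_pn : ∑ p ∈ allq n with 0 < p.1 ∧ p.2.2.2 < 0, GF g p = Om g n omw := by
  unfold Om QS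
  rw [← Finset.sum_filter (fun p : ℤ × ℤ × ℤ × ℤ => p.1 < p.2.2.1 ∧ p.2.2.2 < p.2.2.1 ∧ p.2.2.1 < p.1 + p.2.2.2 + p.2.1)
    (fun p => g (p.1 + p.2.2.2 - p.2.2.1) * (omw p.1 p.2.1 p.2.2.1 p.2.2.2 : ℝ))]
  rw [← Finset.sum_filter_of_ne (p := fun p : ℤ × ℤ × ℤ × ℤ => omw p.1 p.2.1 p.2.2.1 p.2.2.2 ≠ 0)
    (s := Finset.filter _ (quads n))]
  swap
  · intro p _ h h'
    rw [h'] at h; simp at h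
  refine Finset.sum_nbij' (fun p => (p.1, p.2.2.1 - p.1, p.2.1, p.2.1 + p.2.2.2))
    (fun p => (p.1, p.2.2.1, p.1 + p.2.1, p.2.2.2 - p.2.2.1)) ?_ ?_ ?_ ?_ ?_
  · rintro ⟨a, B, c, d⟩ h
    obtain ⟨h, h5, h6⟩ := Finset.mem_filter.1 h
    obtain ⟨h1, h2, h3, h4⟩ := mem_allq.1 h
    dsimp only at *
    have := w6_ne h4
    have hw : omw a (c - a) B (B + d) ≠ 0 := by
      rw [← omw_eq (by omega) (by omega) (by omega) (by omega) (by omega)]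
      convert h4 using 2 <;> ring
    refine Finset.mem_filter.2 ⟨Finset.mem_filter.2 ⟨mem_quads.2 ⟨by omega, by omega, by omega, by omega, ?_⟩, ?_⟩, hw⟩
    · rw [← h3]; ring
    · dsimp only; omega
  · rintro ⟨a, B, c, d⟩ h
    obtain ⟨h, h5⟩ := Finset.mem_filter.1 h
    obtain ⟨h, h6, h7, h8⟩ := Finset.mem_filter.1 h
    obtain ⟨h1, h2, h3, h4, h9⟩ := mem_quads.1 h
    dsimp only at *
    refine Finset.mem_filter.2 ⟨mem_allq.2 ⟨h3, by omega, ?_, ?_⟩, ?_⟩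
    · rw [← h9]; ring
    · rw [← omw_eq h1 h2 h3 h4 h7] at h5
      convert h5 using 2; ring
    · dsimp only; omega
  · rintro ⟨a, B, c, d⟩ -; ext <;> dsimp only <;> ring
  · rintro ⟨a, B, c, d⟩ -; ext <;> dsimp only <;> ring
  · rintro ⟨a, B, c, d⟩ h
    obtain ⟨h, h5, h6⟩ := Finset.mem_filter.1 h
    obtain ⟨h1, h2, h3, h4⟩ := mem_allq.1 h
    dsimp only at *
    have := w6_ne h4
    rw [← omw_eq (by omega) (by omega) (by omega) (by omega) (by omega)]
    unfold GF; dsimp only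
    have e1 : w6 (a + B - (B + d)) B (a + (c - a)) = w6 (a - d) B c := by congr 1 <;> ring
    have e2 : a + (B + d) - B = a + d := by ring
    rw [e1, e2]

end
end

section
set_option linter.unusedVariables false
set_option linter.unusedSimpArgs false

section
variable (g : ℤ → ℝ)

noncomputable def SG (k : ℕ) : ℝ := ∑ i ∈ Finset.range k, g i

lemma part_z (n : ℕ) (hg : ∀ t, g (-t) = g t) : ∑ p ∈ allq n with p.1 = 0, GF g p
    = DS n (fun B c => ∑ d ∈ Finset.Icc (-(min B c : ℕ) : ℤ) (min B c : ℕ), g d * (w6 d B c : ℝ)) := by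
  unfold DS
  rw [Finset.sum_sigma']
  rw [← Finset.sum_filter_of_ne (p := fun x : (_ : ℕ × ℕ) × ℤ => w6 x.2 x.1.1 x.1.2 ≠ 0)
    (s := Finset.sigma _ _)]
  swap
  · intro p _ h h'
    rw [h'] at h; simp at h
  refine Finset.sum_nbij' (fun p => ⟨(p.2.1.toNat, p.2.2.1.toNat), -p.2.2.2⟩)
    (fun x => (0, (x.1.1 : ℤ), (x.1.2 : ℤ), -x.2)) ?_ ?_ ?_ ?_ ?_
  · rintro ⟨a, B, c, d⟩ h
    obtain ⟨h, h5⟩ := Finset.mem_filter.1 h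
    obtain ⟨h1, h2, h3, h4⟩ := mem_allq.1 h
    dsimp only at *
    subst h5
    lift B to ℕ using h1.le
    lift c to ℕ using h2.le
    have h4' := w6_ne h4
    rw [zero_sub] at h4
    rw [Finset.mem_filter, Finset.mem_sigma, Nat.mem_divisorsAntidiagonal, Finset.mem_Icc]
    dsimp only
    simp only [Int.toNat_natCast]
    refine ⟨⟨⟨?_, ?_⟩, by omega⟩, h4⟩
    · have : (B : ℤ) * c = n := by linarith
      exact_mod_cast this
    · rintro rfl
      have := mul_pos h1 h2
      push_cast at h3; omega
  · rintro ⟨⟨B, c⟩, d⟩ h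
    rw [Finset.mem_filter, Finset.mem_sigma, Nat.mem_divisorsAntidiagonal, Finset.mem_Icc] at h
    obtain ⟨⟨⟨h1, h2⟩, h3⟩, h4⟩ := h
    dsimp only at *
    have hB : B ≠ 0 := by rintro rfl; simp at h1; omega
    have hc : c ≠ 0 := by rintro rfl; simp at h1; omega
    refine Finset.mem_filter.2 ⟨mem_allq.2 ⟨by omega, by omega, ?_, ?_⟩, rfl⟩
    · rw [← h1]; push_cast; ring
    · simpa using h4
  · rintro ⟨a, B, c, d⟩ h
    obtain ⟨h, h5⟩ := Finset.mem_filter.1 h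
    obtain ⟨h1, h2, h3, h4⟩ := mem_allq.1 h
    dsimp only at *
    subst h5
    ext <;> dsimp only <;> omega
  · rintro ⟨⟨B, c⟩, d⟩ h
    simp
  · rintro ⟨a, B, c, d⟩ h
    obtain ⟨h, h5⟩ := Finset.mem_filter.1 h
    obtain ⟨h1, h2, h3, h4⟩ := mem_allq.1 h
    dsimp only at *
    subst h5
    have e1 : ((B.toNat : ℕ) : ℤ) = B := by omega
    have e2 : ((c.toNat : ℕ) : ℤ) = c := by omega
    unfold GF; dsimp only
    rw [e1, e2, hg, zero_add, zero_sub]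

lemma part_z2 (n : ℤ) (h0 : g 0 = 0) : ∑ p ∈ allq n with p.1 ≠ 0 ∧ p.2.2.2 = 0, GF g p
    = ∑ p ∈ allq n with p.1 = 0, GF g p := by
  rw [← Finset.sum_filter_of_ne (p := fun p : ℤ × ℤ × ℤ × ℤ => p.2.2.2 ≠ 0)
    (s := Finset.filter (fun p => p.1 = 0) _)]
  swap
  · rintro ⟨a, B, c, d⟩ h h' h''
    obtain ⟨h, h5⟩ := Finset.mem_filter.1 h
    dsimp only at *
    subst h5 h''
    simp [GF, h0] at h'
  refine Finset.sum_nbij' (fun p => (p.2.2.2, p.2.1, p.2.2.1, p.1))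
    (fun p => (p.2.2.2, p.2.1, p.2.2.1, p.1)) ?_ ?_ ?_ ?_ ?_
  · rintro ⟨a, B, c, d⟩ h
    obtain ⟨h, h5, h6⟩ := Finset.mem_filter.1 h
    obtain ⟨h1, h2, h3, h4⟩ := mem_allq.1 h
    dsimp only at *
    refine Finset.mem_filter.2 ⟨Finset.mem_filter.2 ⟨mem_allq.2 ⟨h1, h2, by linarith, ?_⟩, by dsimp only; omega⟩, by dsimp only; omega⟩
    rw [← w6_neg] at h4
    convert h4 using 2; ring
  · rintro ⟨a, B, c, d⟩ h
    obtain ⟨h, h5⟩ := Finset.mem_filter.1 h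
    obtain ⟨h, h6⟩ := Finset.mem_filter.1 h
    obtain ⟨h1, h2, h3, h4⟩ := mem_allq.1 h
    dsimp only at *
    refine Finset.mem_filter.2 ⟨mem_allq.2 ⟨h1, h2, by linarith, ?_⟩, by dsimp only; omega⟩
    rw [← w6_neg] at h4
    convert h4 using 2; ring
  · rintro ⟨a, B, c, d⟩ -; rfl
  · rintro ⟨a, B, c, d⟩ -; rfl
  · rintro ⟨a, B, c, d⟩ -
    unfold GF; dsimp only
    rw [← w6_neg (a - d), add_comm a d]
    have : -(a - d) = d - a := by ring
    rw [this]

lemma inner_z (hg : ∀ t, g (-t) = g t) (h0 : g 0 = 0) (B c : ℕ) (hB : 0 < B) (hc : 0 < c) :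
    ∑ d ∈ Finset.Icc (-(min B c : ℕ) : ℤ) (min B c : ℕ), g d * (w6 d B c : ℝ)
    = 12 * SG g (min B c) + g (min B c : ℕ) * (if B = c then 4 else 6) := by
  rw [Finset.sum_Icc_of_even_eq_range (f := fun d => g d * (w6 d B c : ℝ))]
  swap
  · intro t; dsimp only; rw [hg, w6_neg]
  rw [Finset.sum_range_succ, h0]
  have e1 : ∀ i ∈ Finset.range (min B c), g (i : ℤ) * (w6 i B c : ℝ) = 6 * g i := by
    intro i hi
    rw [Finset.mem_range] at hi
    have : w6 i B c = 6 := by unfold w6; rw [if_pos]; omega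
    rw [this]; push_cast; ring
  rw [Finset.sum_congr rfl e1, ← Finset.mul_sum]
  have e2 : w6 (min B c : ℕ) B c = if B = c then 2 else 3 := by
    unfold w6; split_ifs <;> omega
  rw [e2, SG, nsmul_eq_mul]
  split_ifs <;> push_cast <;> ring

theorem ell_eq (n : ℕ) (hg : ∀ t, g (-t) = g t) (h0 : g 0 = 0) :
    ∑ t ∈ ell n, g t * (12 * hurwitzClassNumber (4 * n - t ^ 2))
    = 2 * GS g n (fun a B c d => w6 (a - d) B c) + 2 * Om g n omw
      + DS n (fun B c => 24 * SG g (min B c) + g (min B c : ℕ) * (if B = c then 8 else 12)) := by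
  rw [ell_sum, sum_split, part_z2 g _ h0, part_np, part_nn g _ hg, part_pp, part_pn, part_z g n hg]
  rw [DS_congr (fun a N _ ha hN => inner_z g hg h0 a N ha hN)]
  have : DS n (fun B c => 24 * SG g (min B c) + g (min B c : ℕ) * (if B = c then 8 else 12))
    = DS n (fun B c => 2 * (12 * SG g (min B c) + g (min B c : ℕ) * (if B = c then 4 else 6))) := by
    refine DS_congr ?_
    intro a N _ _ _
    split_ifs <;> ring
  rw [this, DS_mul]; ring

end
end

section
set_option linter.unusedVariables false
set_option linter.unusedSimpArgs false

lemma QS_tri (n : ℕ) (f : ℤ → ℤ → ℤ → ℝ) :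
    QS (n : ℤ) (fun a B c d => if d = a + B + c then f a (a + B) (a + c) else 0)
    = DS n (fun x y => ∑ j ∈ Finset.range (min x y - 1), f ((j : ℤ) + 1) x y) := by
  unfold QS DS
  rw [← Finset.sum_filter (fun p : ℤ × ℤ × ℤ × ℤ => p.2.2.2 = p.1 + p.2.1 + p.2.2.1)
    (fun p => f p.1 (p.1 + p.2.1) (p.1 + p.2.2.1)), Finset.sum_sigma']
  refine Finset.sum_nbij'
    (fun p => ⟨((p.1 + p.2.1).toNat, (p.1 + p.2.2.1).toNat), (p.1 - 1).toNat⟩)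
    (fun x => ((x.2 : ℤ) + 1, (x.1.1 : ℤ) - (x.2 + 1), (x.1.2 : ℤ) - (x.2 + 1), x.1.1 + x.1.2 - (x.2 + 1)))
    ?_ ?_ ?_ ?_ ?_
  · rintro ⟨a, B, c, d⟩ h
    obtain ⟨h, h6⟩ := Finset.mem_filter.1 h
    obtain ⟨h1, h2, h3, h4, h5⟩ := mem_quads.1 h
    dsimp only at *
    rw [Finset.mem_sigma, Nat.mem_divisorsAntidiagonal, Finset.mem_range]
    dsimp only
    refine ⟨⟨?_, ?_⟩, by omega⟩
    · zify
      rw [Int.toNat_of_nonneg (by omega), Int.toNat_of_nonneg (by omega), ← h5, h6]; ring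
    · rintro rfl
      have := mul_pos h1 h4
      have := mul_pos h2 h3
      push_cast at h5; omega
  · rintro ⟨⟨x, y⟩, j⟩ h
    rw [Finset.mem_sigma, Nat.mem_divisorsAntidiagonal, Finset.mem_range] at h
    obtain ⟨⟨h1, h2⟩, h3⟩ := h
    dsimp only at *
    refine Finset.mem_filter.2 ⟨mem_quads.2 ⟨by omega, by omega, by omega, by omega, ?_⟩, ?_⟩
    · rw [← h1]; push_cast; ring
    · dsimp only; ring
  · rintro ⟨a, B, c, d⟩ h
    obtain ⟨h, h6⟩ := Finset.mem_filter.1 h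
    obtain ⟨h1, h2, h3, h4, h5⟩ := mem_quads.1 h
    dsimp only at *
    ext <;> dsimp only <;> omega
  · rintro ⟨⟨x, y⟩, j⟩ h
    have e1 : ((j : ℤ) + 1 + (x - (j + 1))).toNat = x := by omega
    have e2 : ((j : ℤ) + 1 + (y - (j + 1))).toNat = y := by omega
    have e3 : ((j : ℤ) + 1 - 1).toNat = j := by omega
    dsimp only
    rw [e1, e2, e3]
  · rintro ⟨a, B, c, d⟩ h
    obtain ⟨h, h6⟩ := Finset.mem_filter.1 h
    obtain ⟨h1, h2, h3, h4, h5⟩ := mem_quads.1 h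
    dsimp only at *
    congr 1 <;> omega

section
variable (g : ℤ → ℝ)

lemma SG_shift (h0 : g 0 = 0) (k : ℕ) (hk : 0 < k) : ∑ j ∈ Finset.range (k - 1), g ((j : ℤ) + 1) = SG g k := by
  obtain ⟨k, rfl⟩ : ∃ l, k = l + 1 := ⟨k - 1, by omega⟩
  rw [SG, Finset.sum_range_succ']
  simp [h0]

lemma SG_succ (k : ℕ) : SG g (k + 1) = SG g k + g k := Finset.sum_range_succ ..

lemma f1 (h0 : g 0 = 0) (a N : ℕ) (ha : 0 < a) (hN : 0 < N) :
    ∑ j ∈ Finset.range (N - 1), 2 * g ((j : ℤ) + 1) * (if ((j : ℤ) + 1) < a then 2 else 1)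
      = 2 * SG g N + 2 * SG g (min a N) := by
  rw [← SG_shift g h0 N hN, ← SG_shift g h0 (min a N) (by omega)]
  have : ∀ j ∈ Finset.range (N - 1), 2 * g ((j : ℤ) + 1) * (if ((j : ℤ) + 1) < a then 2 else 1)
    = 2 * g ((j : ℤ) + 1) + 2 * (if j < a - 1 then g ((j : ℤ) + 1) else 0) := by
    intro j hj
    by_cases h : (j : ℤ) + 1 < a
    · rw [if_pos h, if_pos (by omega)]; ring
    · rw [if_neg h, if_neg (by omega)]; ring
  rw [Finset.sum_congr rfl this, Finset.sum_add_distrib, ← Finset.mul_sum, ← Finset.mul_sum, ← Finset.sum_filter]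
  congr 3
  ext j; simp only [Finset.mem_filter, Finset.mem_range]; omega

lemma f2 (a N : ℕ) (ha : 0 < a) (hN : 0 < N) :
    ∑ j ∈ Finset.range (N - 1), (if (a : ℤ) < (j : ℤ) + 1 then (2 : ℝ) else 1)
      = ((N : ℝ) - 1) + (if a < N then (N : ℝ) - 1 - a else 0) := by
  induction N, hN using Nat.le_induction with
  | base => simp
  | succ N hN ih =>
    have : N + 1 - 1 = (N - 1) + 1 := by omega
    rw [this, Finset.sum_range_succ, ih]
    have e : ((N - 1 : ℕ) : ℤ) + 1 = N := by omega
    rw [e]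
    rcases lt_trichotomy a N with h | h | h
    · simp (discharger := omega) only [if_pos, if_neg]; push_cast; ring
    · subst h; simp
    · simp (discharger := omega) only [if_pos, if_neg]; push_cast; ring

lemma f3 (a N : ℕ) (hN : 0 < N) :
    ∑ j ∈ Finset.range (N - 1), g ((a : ℤ) + ((j : ℤ) + 1)) = SG g (a + N) - SG g (a + 1) := by
  induction N, hN using Nat.le_induction with
  | base => simp
  | succ N hN ih =>
    have : N + 1 - 1 = (N - 1) + 1 := by omega
    rw [this, Finset.sum_range_succ, ih, ← add_assoc a N 1, SG_succ g (a + N)]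
    have e : (a : ℤ) + (((N - 1 : ℕ) : ℤ) + 1) = (a + N : ℕ) := by omega
    rw [e]; ring

lemma f4 (a N : ℕ) (ha : 0 < a) (hN : 0 < N) :
    ∑ j ∈ Finset.range (N - 1), g ((a : ℤ) + ((j : ℤ) + 1)) * (hh ((N : ℤ) - ((j : ℤ) + 1) - a) : ℝ)
      = if a < N then 2 * (SG g N - SG g (a + 1)) + g N else 0 := by
  by_cases h : a < N
  · rw [if_pos h]
    obtain ⟨k, rfl⟩ : ∃ k, N = a + (k + 1) := ⟨N - a - 1, by omega⟩
    have e : a + (k + 1) - 1 = (k + 1) + (a - 1) := by omega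
    rw [e, Finset.sum_range_add, Finset.sum_eq_zero (s := Finset.range (a - 1)), add_zero,
      Finset.sum_range_succ]
    · have e1 : ∀ j ∈ Finset.range k, g ((a : ℤ) + ((j : ℤ) + 1)) * (hh (((a + (k + 1) : ℕ) : ℤ) - ((j : ℤ) + 1) - a) : ℝ) = 2 * g ((a : ℤ) + ((j : ℤ) + 1)) := by
        intro j hj
        rw [Finset.mem_range] at hj
        rw [hh_pos (by omega)]; push_cast; ring
      rw [Finset.sum_congr rfl e1, ← Finset.mul_sum]
      have := f3 g a (k + 1) (by omega)
      simp only [Nat.add_sub_cancel] at this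
      rw [this, hh_zero (by omega)]
      push_cast; ring
    · intro j _
      rw [hh_neg (by omega)]; simp
  · rw [if_neg h]
    refine Finset.sum_eq_zero fun j _ => ?_
    rw [hh_neg (by omega)]; simp

theorem UI (n : ℕ) (hg : ∀ t, g (-t) = g t) (h0 : g 0 = 0) :
    ∑ t ∈ ell n, g t * (12 * hurwitzClassNumber (4 * n - t ^ 2))
    = 4 * (QS n (fun a _ c d => g (a + d - c)) - QS n (fun a _ c d => g (a + d + c)))
      + DS n (fun a N => 24 * SG g (min a N) + g (min a N : ℕ) * (if a = N then 8 else 12)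
       - 2 * (4 * g (a + N : ℕ) * ((min a N : ℕ) - 1) + 4 * SG g (min a N) + 2 * SG g N
        - 2 * g (a + N : ℕ) * (((N : ℝ) - 1) + (if a < N then (N : ℝ) - 1 - a else 0))
        - 2 * (SG g (a + N) - SG g (a + 1))
        - 4 * (if a < N then 2 * (SG g N - SG g (a + 1)) + g N else 0))) := by
  have h := UV_eq g n hg
  have k1 := QS_tri n (fun a x y => 4 * g (x + y))
  have k2 := QS_tri n (fun a x y => 2 * g a)
  rw [← QS_sym3] at k2
  have k1' : QS (n : ℤ) (fun a B c d => if d = a + B + c then 4 * g (a + d) else 0)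
      = DS n (fun a N => 4 * g (a + N : ℕ) * ((min a N : ℕ) - 1)) := by
    have e : QS (n : ℤ) (fun a B c d => if d = a + B + c then 4 * g (a + d) else 0)
      = QS (n : ℤ) (fun a B c d => if d = a + B + c then 4 * g ((a + B) + (a + c)) else 0) := by
      refine QS_congr (fun a B c d h1 h2 h3 h4 _ => ?_)
      split_ifs with h
      · rw [h]; congr 2; ring
      · rfl
    rw [e, k1]
    refine DS_congr (fun a N _ ha hN => ?_)
    rw [Finset.sum_const, Finset.card_range, nsmul_eq_mul, Nat.cast_sub (by omega)]
    push_cast; ring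
  have k2' : QS (n : ℤ) (fun a B c d => if c = a + d + B then 2 * g B else 0)
      = DS n (fun a N => 2 * SG g (min a N)) := by
    have e : QS (n : ℤ) (fun a B c d => if c = a + d + B then 2 * g B else 0)
      = QS (n : ℤ) (fun a B c d => if c = B + a + d then 2 * g B else 0) := by
      refine QS_congr (fun a B c d h1 h2 h3 h4 _ => ?_)
      congr 1
      apply propext; constructor <;> intro h <;> omega
    rw [e, k2]
    refine DS_congr (fun a N _ ha hN => ?_)
    rw [← Finset.mul_sum, SG_shift g h0 _ (by omega)]
  have k3 : FS (n : ℤ) (fun a B d => 2 * g d * (if d < a then 2 else 1)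
        - 2 * g (a + B + d) * (if a < d then 2 else 1) - g (a + d) * (2 + 4 * (hh (B - a) : ℝ)))
      = DS n (fun a N => 2 * SG g N + 2 * SG g (min a N)
        - 2 * g (a + N : ℕ) * (((N : ℝ) - 1) + (if a < N then (N : ℝ) - 1 - a else 0))
        - 2 * (SG g (a + N) - SG g (a + 1))
        - 4 * (if a < N then 2 * (SG g N - SG g (a + 1)) + g N else 0)) := by
    rw [FS_eq]
    change DS n (fun a N => ∑ j ∈ Finset.range (N - 1), (2 * g ((j : ℤ) + 1) * (if ((j : ℤ) + 1) < (a : ℤ) then 2 else 1)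
        - 2 * g ((a : ℤ) + ((N : ℤ) - ((j : ℤ) + 1)) + ((j : ℤ) + 1)) * (if (a : ℤ) < (j : ℤ) + 1 then 2 else 1)
        - g ((a : ℤ) + ((j : ℤ) + 1)) * (2 + 4 * (hh ((N : ℤ) - ((j : ℤ) + 1) - a) : ℝ)))) = _
    refine DS_congr (fun a N _ ha hN => ?_)
    rw [← f1 g h0 a N ha hN, ← f2 a N ha hN, ← f3 g a N hN, ← f4 g a N ha hN]
    rw [Finset.mul_sum, Finset.mul_sum, Finset.mul_sum, ← Finset.sum_sub_distrib, ← Finset.sum_sub_distrib, ← Finset.sum_sub_distrib]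
    refine Finset.sum_congr rfl fun j _ => ?_
    have : (a : ℤ) + ((N : ℤ) - ((j : ℤ) + 1)) + ((j : ℤ) + 1) = (a + N : ℕ) := by push_cast; ring
    rw [this]; ring
  rw [k1', k2', k3] at h
  rw [ell_eq g n hg h0]
  change _ = _ + Om g n omw + _ + _ + _ at h
  have e : GS g n (fun a B c d => w6 (a - d) B c) + Om g n omw =
    2 * (QS (n : ℤ) (fun a _ c d => g (a + d - c)) - QS (n : ℤ) (fun a _ c d => g (a + d + c)))
    - (DS n (fun a N => 4 * g (a + N : ℕ) * ((min a N : ℕ) - 1)) + DS n (fun a N => 2 * SG g (min a N))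
      + DS n (fun a N => 2 * SG g N + 2 * SG g (min a N)
        - 2 * g (a + N : ℕ) * (((N : ℝ) - 1) + (if a < N then (N : ℝ) - 1 - a else 0))
        - 2 * (SG g (a + N) - SG g (a + 1))
        - 4 * (if a < N then 2 * (SG g N - SG g (a + 1)) + g N else 0))) := by linarith
  rw [← mul_add, e, ← DS_add, ← DS_add]
  have key : ∀ x y z r : ℝ, r = y - 2 * z → 2 * (2 * x - z) + y = 4 * x + r := by
    intro x y z w h; rw [h]; ring
  apply key
  rw [← DS_mul, ← DS_sub]
  refine DS_congr (fun a N _ _ _ => ?_)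
  ring

end
end

section
set_option linter.unusedVariables false
set_option linter.unusedSimpArgs false

noncomputable def g3 (t : ℤ) : ℝ := if 3 ∣ t then 0 else (t : ℝ) ^ 2

lemma g3_neg (t : ℤ) : g3 (-t) = g3 t := by
  unfold g3; simp

lemma g3_zero : g3 0 = 0 := by simp [g3]

lemma g3_n0 {k : ℕ} (h : k % 3 = 0) : g3 k = 0 := by
  unfold g3; rw [if_pos (by omega)]
lemma g3_n {k : ℕ} (h : k % 3 ≠ 0) : g3 k = (k : ℝ) ^ 2 := by
  unfold g3; rw [if_neg (by omega)]; simp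

lemma SG_all (q : ℕ) : SG g3 (3 * q) = 6 * (q : ℝ) ^ 3 - q := by
  induction q with
  | zero => simp [SG]
  | succ q ih =>
    have : 3 * (q + 1) = 3 * q + 1 + 1 + 1 := by ring
    rw [this, SG_succ, SG_succ, SG_succ, ih, g3_n0 (by omega), g3_n (by omega), g3_n (by omega)]
    push_cast; ring

lemma SG0 {k : ℕ} (h : k % 3 = 0) : SG g3 k = (2 * (k : ℝ) ^ 3 - 3 * k) / 9 := by
  obtain ⟨q, rfl⟩ : ∃ q, k = 3 * q := ⟨k / 3, by omega⟩
  rw [SG_all]; push_cast; ring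
lemma SG1 {k : ℕ} (h : k % 3 = 1) : SG g3 k = (2 * (k : ℝ) ^ 3 - 6 * k ^ 2 + 3 * k + 1) / 9 := by
  obtain ⟨q, rfl⟩ : ∃ q, k = 3 * q + 1 := ⟨k / 3, by omega⟩
  rw [SG_succ, SG_all, g3_n0 (by omega)]; push_cast; ring
lemma SG2 {k : ℕ} (h : k % 3 = 2) : SG g3 k = (2 * (k : ℝ) ^ 3 - 3 * k ^ 2 + 3 * k - 1) / 9 := by
  obtain ⟨q, rfl⟩ : ∃ q, k = 3 * q + 1 + 1 := ⟨k / 3, by omega⟩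
  rw [SG_succ, SG_succ, SG_all, g3_n0 (by omega), g3_n (by omega)]; push_cast; ring

lemma zdvd (t : ℤ) : ((t : ℤ) : ZMod 3) = 0 ↔ 3 ∣ t := by
  have := ZMod.intCast_zmod_eq_zero_iff_dvd t 3
  exact_mod_cast this

lemma QS_F5 (n : ℤ) : QS n (fun a _ c d => g3 (a + d - c)) - QS n (fun a _ c d => g3 (a + d + c))
    = ((QS n (eF F5) : ℤ) : ℝ) := by
  rw [← QS_sub]
  unfold QS
  rw [Int.cast_sum]
  refine Finset.sum_congr rfl ?_
  rintro ⟨a, B, c, d⟩ -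
  dsimp only
  have e1 : ((a : ZMod 3) + d - c = 0) ↔ 3 ∣ a + d - c := by rw [← zdvd]; push_cast; rfl
  have e2 : ((a : ZMod 3) + d + c = 0) ↔ 3 ∣ a + d + c := by rw [← zdvd]; push_cast; rfl
  unfold g3 eF F5 ev
  simp only [e1, e2]
  split_ifs <;> simp <;> ring

lemma DS_symR {n : ℕ} {h k : ℕ → ℕ → ℝ}
    (H : ∀ a N, a * N = n → 0 < a → 0 < N → h a N + h N a = k a N + k N a) : DS n h = DS n k := by
  have h1 := DS_congr (n := n) (h := fun a N => h a N + h N a) (k := fun a N => k a N + k N a) H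
  rw [DS_add, DS_add, DS_swap n h, DS_swap n k] at h1
  linarith

lemma DS_cast (n : ℕ) (h : ℕ → ℕ → ℤ) : ((DS n h : ℤ) : ℝ) = DS n (fun a N => (h a N : ℝ)) := by
  unfold DS; push_cast; rfl

/-- face contribution -/
noncomputable def FT (a N : ℕ) : ℝ :=
  24 * SG g3 (min a N) + g3 (min a N : ℕ) * (if a = N then 8 else 12)
       - 2 * (4 * g3 (a + N : ℕ) * ((min a N : ℕ) - 1) + 4 * SG g3 (min a N) + 2 * SG g3 N
        - 2 * g3 (a + N : ℕ) * (((N : ℝ) - 1) + (if a < N then (N : ℝ) - 1 - a else 0))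
        - 2 * (SG g3 (a + N) - SG g3 (a + 1))
        - 4 * (if a < N then 2 * (SG g3 N - SG g3 (a + 1)) + g3 N else 0))
       - (if a = N then 2 * g3 (a + N : ℕ) else 0)

lemma FT12_lt {a N : ℕ} (ha : a % 3 = 1) (hN : N % 3 = 2) (h : a < N) :
    FT a N + FT N a = (a : ℝ) * N ^ 2 * (16 / 3) - (a : ℝ) ^ 2 * (4 / 3) + (a : ℝ) ^ 2 * N * (16 / 3) + (a : ℝ) ^ 3 * (32 / 9) + (N : ℝ) ^ 2 * (4 / 3) + (N : ℝ) ^ 3 * (32 / 9) := by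
  unfold FT
  simp (discharger := omega) only [if_pos, if_neg, min_eq_left h.le, min_eq_right h.le]
  rw [add_comm N a, SG0 (k := a + N) (by omega), SG1 (k := a) ha, SG2 (k := N) hN, SG2 (k := a + 1) (by omega), SG0 (k := N + 1) (by omega),
     g3_n0 (k := a + N) (by omega), g3_n (k := a) (by omega), g3_n (k := N) (by omega)]
  push_cast
  ring

lemma FT21_lt {a N : ℕ} (ha : a % 3 = 2) (hN : N % 3 = 1) (h : a < N) :
    FT a N + FT N a = (a : ℝ) * N ^ 2 * (16 / 3) + (a : ℝ) ^ 2 * (4 / 3) + (a : ℝ) ^ 2 * N * (16 / 3) + (a : ℝ) ^ 3 * (32 / 9) - (N : ℝ) ^ 2 * (4 / 3) + (N : ℝ) ^ 3 * (32 / 9) := by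
  unfold FT
  simp (discharger := omega) only [if_pos, if_neg, min_eq_left h.le, min_eq_right h.le]
  rw [add_comm N a, SG0 (k := a + N) (by omega), SG2 (k := a) ha, SG1 (k := N) hN, SG0 (k := a + 1) (by omega), SG2 (k := N + 1) (by omega),
     g3_n0 (k := a + N) (by omega), g3_n (k := a) (by omega), g3_n (k := N) (by omega)]
  push_cast
  ring

lemma FT11_lt {a N : ℕ} (ha : a % 3 = 1) (hN : N % 3 = 1) (h : a < N) :
    FT a N + FT N a = (1) * (8 / 9 + (a : ℝ) * N * (8 / 3)) + (16 / 3) * ((a : ℝ) + N) + (a : ℝ) * N ^ 2 * (16 / 3) - (a : ℝ) ^ 2 * N * (56 / 3) - (a : ℝ) ^ 3 * (112 / 9) + (N : ℝ) ^ 3 * (104 / 9) := by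
  unfold FT
  simp (discharger := omega) only [if_pos, if_neg, min_eq_left h.le, min_eq_right h.le]
  rw [add_comm N a, SG2 (k := a + N) (by omega), SG1 (k := a) ha, SG1 (k := N) hN, SG2 (k := a + 1) (by omega), SG2 (k := N + 1) (by omega),
     g3_n (k := a + N) (by omega), g3_n (k := a) (by omega), g3_n (k := N) (by omega)]
  push_cast
  ring

lemma FT22_lt {a N : ℕ} (ha : a % 3 = 2) (hN : N % 3 = 2) (h : a < N) :
    FT a N + FT N a = (-1) * (8 / 9 + (a : ℝ) * N * (8 / 3)) + (16 / 3) * ((a : ℝ) + N) + (a : ℝ) * N ^ 2 * (16 / 3) - (a : ℝ) ^ 2 * N * (56 / 3) - (a : ℝ) ^ 3 * (112 / 9) + (N : ℝ) ^ 3 * (104 / 9) := by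
  unfold FT
  simp (discharger := omega) only [if_pos, if_neg, min_eq_left h.le, min_eq_right h.le]
  rw [add_comm N a, SG1 (k := a + N) (by omega), SG2 (k := a) ha, SG2 (k := N) hN, SG0 (k := a + 1) (by omega), SG0 (k := N + 1) (by omega),
     g3_n (k := a + N) (by omega), g3_n (k := a) (by omega), g3_n (k := N) (by omega)]
  push_cast
  ring

lemma FT11_eq {a : ℕ} (ha : a % 3 = 1) : FT a a = (1) * (4 / 9 + (a : ℝ) ^ 2 * (4 / 3)) + (16 / 3) * (a : ℝ) - (a : ℝ) ^ 3 * (64 / 9) := by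
  unfold FT
  simp (discharger := omega) only [if_pos, if_neg, min_self]
  rw [SG2 (k := a + a) (by omega), SG1 (k := a) ha, SG2 (k := a + 1) (by omega),
     g3_n (k := a + a) (by omega), g3_n (k := a) (by omega)]
  push_cast
  ring

lemma FT22_eq {a : ℕ} (ha : a % 3 = 2) : FT a a = (-1) * (4 / 9 + (a : ℝ) ^ 2 * (4 / 3)) + (16 / 3) * (a : ℝ) - (a : ℝ) ^ 3 * (64 / 9) := by
  unfold FT
  simp (discharger := omega) only [if_pos, if_neg, min_self]
  rw [SG1 (k := a + a) (by omega), SG2 (k := a) ha, SG0 (k := a + 1) (by omega),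
     g3_n (k := a + a) (by omega), g3_n (k := a) (by omega)]
  push_cast
  ring


lemma sum2 (n : ℕ) (h3 : n % 3 = 2) : 72 * ((QS n (eF F5) : ℤ) : ℝ) + 18 * DS n FT
    = 216 * n * DS n (fun _ N => (N : ℝ)) := by
  have h := J5 n h3
  have h' : (18 : ℝ) * ((QS n (eF F5) : ℤ) : ℝ) = ((72 * sig n + 12 * (n - 2) * sig n + DS n (fun a N => eps a * (-64 + 12 * n + 6 * a ^ 2)
    - 48 * N - 16 * N ^ 3 + 12 * n * N + 6 * n * a) : ℤ) : ℝ) := by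
    rw [← h]; push_cast; ring
  have e : 72 * ((QS n (eF F5) : ℤ) : ℝ) = 4 * (18 * ((QS n (eF F5) : ℤ) : ℝ)) := by ring
  rw [e, h', sig]
  push_cast
  rw [DS_cast, DS_cast]
  simp only [← DS_mul, ← DS_add]
  refine DS_symR (fun a N han ha hN => ?_)
  have hn : (n : ℝ) = a * N := by rw [← han]; push_cast; ring
  push_cast
  rw [hn]
  have key : ∀ x y : ℝ, 18 * x + 18 * y = 18 * (x + y) := by intros; ring
  rcases nat_res han h3 with ⟨r1, r2⟩ | ⟨r1, r2⟩
  · have e1 : eps a = 1 := by simp [eps, r1]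
    have e2 : eps N = -1 := by simp [eps, r2]
    rw [e1, e2]
    rcases lt_or_gt_of_ne (show a ≠ N by rintro rfl; omega) with h | h
    · have := FT12_lt r1 r2 h
      push_cast; linear_combination 18 * this
    · have := FT21_lt r2 r1 h
      push_cast; linear_combination 18 * this
  · have e1 : eps a = -1 := by simp [eps, r1]
    have e2 : eps N = 1 := by simp [eps, r2]
    rw [e1, e2]
    rcases lt_or_gt_of_ne (show a ≠ N by rintro rfl; omega) with h | h
    · have := FT21_lt r1 r2 h
      push_cast; linear_combination 18 * this
    · have := FT12_lt r2 r1 h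
      push_cast; linear_combination 18 * this

lemma sum1 (n : ℕ) (h3 : n % 3 = 1) : 72 * ((QS n (eF F5) : ℤ) : ℝ) + 18 * DS n FT
    = 108 * (etaCoeff n : ℝ) + 324 * n * DS n (fun _ N => (N : ℝ)) - 216 * n * DS n (fun a N => ((min a N : ℕ) : ℝ))
      - 432 * DS n (fun a N => if a < N then (a : ℝ) ^ 3 else 0) - 216 * DS n (fun a N => if a = N then (a : ℝ) ^ 3 else 0) := by
  have h := J6 n h3
  have hη := etaCoeff_eq n h3
  have h' : (72 : ℝ) * ((QS n (eF F5) : ℤ) : ℝ) = 108 * (etaCoeff n : ℝ) + ((-108 * sig n + 2 * (18 * 23 * (n - 1) * sig n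
     + DS n (fun a N => eps a * (-4 - 12 * n) + 108 * N - 104 * N ^ 3 + 312 * a - 300 * n * N)) : ℤ) : ℝ) := by
    rw [← h, hη]; push_cast; ring
  rw [h', sig]
  push_cast
  rw [DS_cast, DS_cast]
  have key : ∀ x y z w u v t : ℝ, y + z + u + v + w = t → x + y + z = x + t - u - v - w := by
    intros; linarith
  apply key
  simp only [← DS_mul, ← DS_add]
  refine DS_symR (fun a N han ha hN => ?_)
  have hn : (n : ℝ) = a * N := by rw [← han]; push_cast; ring
  push_cast
  rw [hn]
  rcases nat_res1 han h3 with ⟨r1, r2⟩ | ⟨r1, r2⟩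
  · have e1 : eps a = 1 := by simp [eps, r1]
    have e2 : eps N = 1 := by simp [eps, r2]
    rw [e1, e2]
    rcases lt_trichotomy a N with h | h | h
    · have := FT11_lt r1 r2 h
      have hr : (a : ℝ) ≤ N := by exact_mod_cast h.le
      simp (discharger := omega) only [if_pos, if_neg, min_eq_left hr, min_eq_right hr]
      push_cast; linear_combination 18 * this
    · subst h
      have := FT11_eq r1
      simp (discharger := omega) only [if_pos, if_neg, min_self]
      push_cast; linear_combination 36 * this
    · have := FT11_lt r2 r1 h
      have hr : (N : ℝ) ≤ a := by exact_mod_cast h.le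
      simp (discharger := omega) only [if_pos, if_neg, min_eq_left hr, min_eq_right hr]
      push_cast; linear_combination 18 * this
  · have e1 : eps a = -1 := by simp [eps, r1]
    have e2 : eps N = -1 := by simp [eps, r2]
    rw [e1, e2]
    rcases lt_trichotomy a N with h | h | h
    · have := FT22_lt r1 r2 h
      have hr : (a : ℝ) ≤ N := by exact_mod_cast h.le
      simp (discharger := omega) only [if_pos, if_neg, min_eq_left hr, min_eq_right hr]
      push_cast; linear_combination 18 * this
    · subst h
      have := FT22_eq r1
      simp (discharger := omega) only [if_pos, if_neg, min_self]
      push_cast; linear_combination 36 * this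
    · have := FT22_lt r2 r1 h
      have hr : (N : ℝ) ≤ a := by exact_mod_cast h.le
      simp (discharger := omega) only [if_pos, if_neg, min_eq_left hr, min_eq_right hr]
      push_cast; linear_combination 18 * this
end

section
set_option linter.unusedVariables false
set_option linter.unusedSimpArgs false

lemma HH_fin (m : ℤ) (n : ℕ) : HH 2 m 3 n = ∑ t ∈ Finset.Icc (-(4 * n : ℤ)) (4 * n),
    if t % 3 = m % 3 then (t : ℝ) ^ 2 * hurwitzClassNumber (4 * n - t ^ 2) else 0 := by
  unfold HH
  refine finsum_eq_sum_of_support_subset _ ?_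
  intro t ht
  rw [Function.mem_support] at ht
  have : ¬ (4 * (n : ℤ) - t ^ 2 < 0) := by
    intro h
    rw [hurwitz_neg _ h] at ht
    simp at ht
  rw [Finset.coe_Icc, Set.mem_Icc]
  constructor <;> nlinarith

lemma HH_21 (n : ℕ) : HH 2 2 3 n = HH 2 1 3 n := by
  rw [HH_fin, HH_fin]
  refine Finset.sum_nbij' (fun t => -t) (fun t => -t) ?_ ?_ ?_ ?_ ?_
  · intro t ht; rw [Finset.mem_Icc] at *; omega
  · intro t ht; rw [Finset.mem_Icc] at *; omega
  · intro t _; ring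
  · intro t _; ring
  · intro t _
    by_cases h : t % 3 = 2
    · rw [if_pos (by omega), if_pos (by omega)]; push_cast; ring_nf
    · rw [if_neg (by omega), if_neg (by omega)]

lemma HH_Y (n : ℕ) : 2 * HH 2 1 3 n = ∑ t ∈ Finset.Icc (-(4 * n : ℤ)) (4 * n), g3 t * hurwitzClassNumber (4 * n - t ^ 2) := by
  have : 2 * HH 2 1 3 n = HH 2 1 3 n + HH 2 2 3 n := by rw [HH_21]; ring
  rw [this, HH_fin, HH_fin, ← Finset.sum_add_distrib]
  refine Finset.sum_congr rfl fun t _ => ?_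
  unfold g3
  have : t % 3 = 0 ∨ t % 3 = 1 ∨ t % 3 = 2 := by omega
  rcases this with h | h | h <;> simp (discharger := omega) only [if_pos, if_neg] <;> ring

lemma sq_part (n : ℕ) : ∑ t ∈ (Finset.Icc (-(4 * n : ℤ)) (4 * n)).filter (fun t : ℤ => t ^ 2 = 4 * n), g3 t
    = DS n (fun a N => if a = N then 2 * g3 (a + N : ℕ) else 0) := by
  rcases Nat.eq_zero_or_pos n with rfl | hn
  · simp [DS, g3, Finset.filter_singleton]
  by_cases h : ∃ r, n = r * r
  · obtain ⟨r, rfl⟩ := h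
    have hr : 0 < r := Nat.pos_of_mul_pos_left hn
    have e1 : (Finset.Icc (-(4 * (r * r : ℕ) : ℤ)) (4 * (r * r : ℕ))).filter (fun t : ℤ => t ^ 2 = 4 * (r * r : ℕ))
      = {2 * (r : ℤ), -(2 * (r : ℤ))} := by
      ext t
      simp only [Finset.mem_filter, Finset.mem_Icc, Finset.mem_insert, Finset.mem_singleton]
      constructor
      · rintro ⟨_, h⟩
        have : t ^ 2 = (2 * (r : ℤ)) ^ 2 := by rw [h]; push_cast; ring
        exact sq_eq_sq_iff_eq_or_eq_neg.1 this
      · have : (1 : ℤ) ≤ r := by omega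
        rintro (rfl | rfl)
        · refine ⟨⟨?_, ?_⟩, ?_⟩ <;> push_cast <;> nlinarith
        · refine ⟨⟨?_, ?_⟩, ?_⟩ <;> push_cast <;> nlinarith
    rw [e1, Finset.sum_pair (by omega), g3_neg, DS, ← Finset.sum_filter (fun x : ℕ × ℕ => x.1 = x.2) (fun x => 2 * g3 (x.1 + x.2 : ℕ))]
    have e2 : (r * r).divisorsAntidiagonal.filter (fun x => x.1 = x.2) = {(r, r)} := by
      ext ⟨a, b⟩
      simp only [Finset.mem_filter, Nat.mem_divisorsAntidiagonal, Finset.mem_singleton, Prod.mk.injEq]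
      constructor
      · rintro ⟨⟨h, _⟩, rfl⟩
        have := Nat.mul_self_inj.1 h
        exact ⟨this, this⟩
      · rintro ⟨rfl, rfl⟩
        exact ⟨⟨rfl, hn.ne'⟩, rfl⟩
    rw [e2, Finset.sum_singleton]
    have : ((r + r : ℕ) : ℤ) = 2 * r := by push_cast; ring
    rw [this]; ring
  · rw [Finset.sum_eq_zero, DS, Finset.sum_eq_zero]
    · rintro ⟨a, b⟩ hx
      rw [Nat.mem_divisorsAntidiagonal] at hx
      rw [if_neg]
      rintro h'
      dsimp only at *
      subst h'
      exact h ⟨a, hx.1.symm⟩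
    · intro t ht
      exfalso
      have ht := (Finset.mem_filter.1 ht).2
      have : Even t := by
        have : Even (t ^ 2) := ⟨2 * n, by rw [ht]; ring⟩
        exact (Int.even_pow.1 this).1
      obtain ⟨k, rfl⟩ := this
      apply h
      refine ⟨k.natAbs, ?_⟩
      zify
      rw [abs_mul_abs_self]
      linarith

lemma Y_eq (n : ℕ) : 12 * (2 * HH 2 1 3 n) = 4 * ((QS n (eF F5) : ℤ) : ℝ) + DS n FT := by
  have h := UI g3 n g3_neg g3_zero
  rw [QS_F5] at h
  have e : DS n FT = _ - _ := DS_sub n _ _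
  rw [e, ← add_sub_assoc, ← h, ← sq_part, HH_Y]
  unfold ell
  rw [Finset.sum_filter, Finset.sum_filter, Finset.mul_sum, ← Finset.sum_sub_distrib]
  refine Finset.sum_congr rfl fun t _ => ?_
  rcases lt_trichotomy (t ^ 2) (4 * (n : ℤ)) with h | h | h
  · rw [if_pos h, if_neg h.ne]; ring
  · rw [if_neg (by omega), if_pos h]
    have : 4 * (n : ℤ) - t ^ 2 = 0 := by omega
    rw [this]
    simp only [hurwitzClassNumber, if_true]; ring
  · rw [if_neg (by omega), if_neg (by omega), hurwitz_neg _ (by omega)]; ring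

lemma DS_div (n : ℕ) (f : ℕ → ℕ → ℝ) : DS n f = ∑ d ∈ n.divisors, f d (n / d) :=
  Nat.sum_divisorsAntidiagonal f

lemma sq_DS (n : ℕ) (hn : 0 < n) : DS n (fun a N => if a = N then (a : ℝ) ^ 3 else 0)
    = (if IsSquare n then (1 : ℝ) else 0) * (n : ℝ) ^ ((3 : ℝ) / 2) := by
  by_cases h : IsSquare n
  · rw [if_pos h]
    obtain ⟨r, rfl⟩ := h
    rw [DS, ← Finset.sum_filter (fun x : ℕ × ℕ => x.1 = x.2) (fun x => (x.1 : ℝ) ^ 3)]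
    have e2 : (r * r).divisorsAntidiagonal.filter (fun x => x.1 = x.2) = {(r, r)} := by
      ext ⟨a, b⟩
      simp only [Finset.mem_filter, Nat.mem_divisorsAntidiagonal, Finset.mem_singleton, Prod.mk.injEq]
      constructor
      · rintro ⟨⟨h, _⟩, rfl⟩
        have := Nat.mul_self_inj.1 h
        exact ⟨this, this⟩
      · rintro ⟨rfl, rfl⟩
        exact ⟨⟨rfl, hn.ne'⟩, rfl⟩
    rw [e2, Finset.sum_singleton, one_mul]
    have : ((r * r : ℕ) : ℝ) = (r : ℝ) ^ (2 : ℝ) := by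
      rw [Real.rpow_two]; push_cast; ring
    rw [this, ← Real.rpow_mul (by positivity)]
    norm_num
  · rw [if_neg h, zero_mul, DS]
    refine Finset.sum_eq_zero ?_
    rintro ⟨a, b⟩ hx
    rw [Nat.mem_divisorsAntidiagonal] at hx
    rw [if_neg]
    rintro h'
    dsimp only at *
    subst h'
    exact h ⟨a, hx.1.symm⟩

lemma lt_DS (n : ℕ) : DS n (fun a N => if a < N then (a : ℝ) ^ 3 else 0)
    = ∑ d ∈ n.divisors.filter (fun d => d ^ 2 < n), (d : ℝ) ^ 3 := by
  rw [DS_div, Finset.sum_filter]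
  refine Finset.sum_congr rfl fun d hd => ?_
  obtain ⟨k, rfl⟩ := Nat.dvd_of_mem_divisors hd
  have hd0 : 0 < d := Nat.pos_of_mem_divisors hd
  rw [Nat.mul_div_cancel_left _ hd0]
  congr 1
  rw [pow_two, Nat.mul_lt_mul_left hd0]

lemma min_DS (n : ℕ) : DS n (fun a N => ((min a N : ℕ) : ℝ)) = ∑ d ∈ n.divisors, (min d (n / d) : ℝ) := by
  rw [DS_div]
  refine Finset.sum_congr rfl fun d hd => ?_
  rw [Nat.cast_min, Nat.cast_div (Nat.dvd_of_mem_divisors hd)]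
  have := Nat.pos_of_mem_divisors hd
  positivity

lemma id_DS (n : ℕ) : DS n (fun _ N => (N : ℝ)) = ∑ d ∈ n.divisors, (d : ℝ) := by
  rw [DS_swap n (fun a _ => (a : ℝ)), DS_div]
end

/-- Theorem 1.1 (1), case `m ∈ {1,2}`:
for `3 ∤ n`,
`H_{2,m,3}(n) = -δ_{n=□} n^{3/2}/2 - δ_{n ≡ 1 (3)} ∑_{d∣n, d²<n} d³ +`
`(¾ n σ(n) - (n/2) ∑_{d∣n} min(d, n/d) + ¼ a(n)` if `n ≡ 1 (3)`;
`½ n σ(n)` if `n ≡ 2 (3))`. -/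
theorem second_moment_m_ne_zero_three_not_dvd (m : ℤ) (hm : m = 1 ∨ m = 2)
    (n : ℕ) (hn : 0 < n) (h3 : ¬ 3 ∣ n) :
    HH 2 m 3 n =
      -((if IsSquare n then (1 : ℝ) else 0) * (n : ℝ) ^ ((3 : ℝ) / 2) / 2)
      - (if n % 3 = 1 then (1 : ℝ) else 0) *
          (∑ d ∈ n.divisors.filter (fun d => d ^ 2 < n), (d : ℝ) ^ 3)
      + (if n % 3 = 1 then
            3 / 4 * (n : ℝ) * (∑ d ∈ n.divisors, (d : ℝ))
              - (n : ℝ) / 2 * (∑ d ∈ n.divisors, (min d (n / d) : ℝ))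
              + (etaCoeff n : ℝ) / 4
          else
            (n : ℝ) * (∑ d ∈ n.divisors, (d : ℝ)) / 2) := by
  have hH : HH 2 m 3 n = HH 2 1 3 n := by
    rcases hm with rfl | rfl
    · rfl
    · exact HH_21 n
  have hY := Y_eq n
  rw [hH, ← sq_DS n hn, ← lt_DS, ← min_DS, ← id_DS]
  have : n % 3 = 1 ∨ n % 3 = 2 := by omega
  rcases this with h | h
  · have hs := sum1 n h
    rw [if_pos h, if_pos h]
    linarith
  · have hs := sum2 n h
    have hz : DS n (fun a N => if a = N then (a : ℝ) ^ 3 else 0) = DS n (fun _ _ => 0) := by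
      refine DS_congr (fun a N han _ _ => ?_)
      rw [if_neg]
      rintro rfl
      rcases nat_res han h with h' | h' <;> omega
    have hz' : DS n (fun _ _ => (0 : ℝ)) = 0 := by simp [DS]
    rw [hz, hz', if_neg (by omega), if_neg (by omega)]
    linarith

end HurwitzPaper
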